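/- Let u ∈ (−1, 1) and μ ∈ (−1−u, 0). Then there exists a constant c_{u,μ} > 0 such that for every function v of the form v(x) = (1+x²)^{−(1+u)/2} Φ(e^{2iθ(x)}) with Φ : S¹ → ℂ smooth and θ(x) = arccot(x) ∈ (0,π) (i.e. every smooth vector of P(u,+)^∞ in the noncompact picture): ⫴v⫴²_{u+μ} := ∫₀^{2π} ∫_ℝ |ξ|^{−u−μ} |𝓕(π_{u,+}(k_{θ₀}) v)(ξ)|² dξ dθ₀ ≤ c_{u,μ} ∫_ℝ |ξ|^{−u−μ} |𝓕( (1+x²)^{−μ/2} v(x) )(ξ)|² dξ, as an inequality in [0,∞]. -/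

import Mathlib

open MeasureTheory Real Set Filter Complex
open scoped ENNReal NNReal

noncomputable section

/-- The weight-`2m` K-type vector `v_{2m}^{(u)}(x) = (1+x²)^{−(1+u)/2} ((1+xi)/(1−xi))^m`
of the principal series `P(u,+)` in the noncompact picture. -/
def vEven (u : ℂ) (m : ℤ) (x : ℝ) : ℂ :=
  ((1 + x ^ 2 : ℝ) : ℂ) ^ (-(1 + u) / 2) *
    ((1 + (x : ℂ) * Complex.I) / (1 - (x : ℂ) * Complex.I)) ^ m

/-- `z` is the improper Fourier transform of `g` at `ξ`:
`z = lim_{R→∞} ∫_{−R}^R g(x) e^{−2πixξ} dx`. -/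
def IsImpFT (g : ℝ → ℂ) (ξ : ℝ) (z : ℂ) : Prop :=
  Filter.Tendsto
    (fun R : ℝ => ∫ x in Set.Ioc (-R) R,
      g x * Complex.exp (-2 * (Real.pi : ℂ) * Complex.I * (x : ℂ) * (ξ : ℂ)))
    Filter.atTop (nhds z)

/-- The principal-series rotation action
`(π_{s,+}(k_θ)v)(x) = |cos θ − x sin θ|^{−1−s} v((x cos θ + sin θ)/(cos θ − x sin θ))`. -/
def piPlus (s : ℂ) (θ : ℝ) (v : ℝ → ℂ) (x : ℝ) : ℂ :=
  ((|Real.cos θ - x * Real.sin θ| : ℝ) : ℂ) ^ (-1 - s) *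
    v ((x * Real.cos θ + Real.sin θ) / (Real.cos θ - x * Real.sin θ))

/-- The nonspherical principal-series rotation action, with the sign factor
`sgn(cos θ − x sin θ)`. -/
def piMinus (s : ℂ) (θ : ℝ) (v : ℝ → ℂ) (x : ℝ) : ℂ :=
  ((Real.sign (Real.cos θ - x * Real.sin θ) : ℝ) : ℂ) *
    ((|Real.cos θ - x * Real.sin θ| : ℝ) : ℂ) ^ (-1 - s) *
    v ((x * Real.cos θ + Real.sin θ) / (Real.cos θ - x * Real.sin θ))

/-- `arccot x = π/2 − arctan x ∈ (0, π)`. -/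
def arccot (x : ℝ) : ℝ := Real.pi / 2 - Real.arctan x

section

open scoped FourierTransform SchwartzMap Topology

open scoped FourierTransform SchwartzMap

theorem continuous_fourier_of_integrable {f : ℝ → ℂ} (hf : Integrable f) :
    Continuous (𝓕 f) :=
  VectorFourier.fourierIntegral_continuous (V := ℝ) (W := ℝ) (μ := volume)
      Real.continuous_fourierChar (L := innerₗ ℝ) (by exact continuous_inner) hf

theorem integral_fourier_smul_Lp_two (F : Lp ℂ 2 (volume : Measure ℝ)) (φ : 𝓢(ℝ, ℂ)) :
    ∫ x, (𝓕 φ : 𝓢(ℝ, ℂ)) x • F x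
      = ∫ x, φ x • (𝓕 F : Lp ℂ 2 (volume : Measure ℝ)) x := by
  have h := DFunLike.congr_fun (Lp.fourier_toTemperedDistribution_eq F) φ
  rw [TemperedDistribution.fourier_apply, Lp.toTemperedDistribution_apply,
    Lp.toTemperedDistribution_apply] at h
  exact h

/-- Plancherel's theorem for the pointwise Fourier integral of an `L¹ ∩ L²` function. -/
theorem lintegral_enorm_fourier_sq {f : ℝ → ℂ} (hf : Integrable f) (hf2 : MemLp f 2) :
    ∫⁻ ξ, ‖𝓕 f ξ‖ₑ ^ 2 = ∫⁻ x, ‖f x‖ₑ ^ 2 := by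
  obtain ⟨F, hF⟩ : ∃ F : Lp ℂ 2 (volume : Measure ℝ), F =ᵐ[volume] f :=
    ⟨hf2.toLp f, hf2.coeFn_toLp⟩
  obtain ⟨F', hF'⟩ : ∃ F' : Lp ℂ 2 (volume : Measure ℝ), F' = 𝓕 F := ⟨_, rfl⟩
  have hcont : Continuous (𝓕 f) := continuous_fourier_of_integrable hf
  have hF'loc : LocallyIntegrable F' volume := (Lp.memLp F').locallyIntegrable one_le_two
  have hpair : ∀ φ : 𝓢(ℝ, ℂ), ∫ x, (𝓕 φ : 𝓢(ℝ, ℂ)) x • F x = ∫ x, φ x • F' x := by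
    intro φ; rw [hF']; exact integral_fourier_smul_Lp_two F φ
  have hnorm : ‖F'‖ = ‖F‖ := by rw [hF']; exact Lp.norm_fourier_eq F
  clear hF'
  have key : ∀ᵐ ξ, 𝓕 f ξ = F' ξ := by
    refine ae_eq_of_integral_contDiff_smul_eq ?_ hF'loc ?_
    · exact hcont.locallyIntegrable
    · intro g hg hgs
      have hgs' : HasCompactSupport (fun x => (g x : ℂ)) := hgs.comp_left (g := fun y : ℝ => (y : ℂ)) Complex.ofReal_zero
      have hg' : ContDiff ℝ (⊤ : ℕ∞) (fun x => (g x : ℂ)) := Complex.ofRealCLM.contDiff.comp hg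
      let φ : 𝓢(ℝ, ℂ) := hgs'.toSchwartzMap hg'
      have h1 := hpair φ
      have h2 : ∫ x, (𝓕 φ : 𝓢(ℝ, ℂ)) x • F x = ∫ x, (𝓕 φ : 𝓢(ℝ, ℂ)) x • f x := by
        apply integral_congr_ae
        filter_upwards [hF] with x hx
        rw [hx]
      rw [h2] at h1
      have h3 := VectorFourier.integral_bilin_fourierIntegral_eq_flip (ContinuousLinearMap.mul ℂ ℂ)
        (L := innerₗ ℝ) (μ := volume) (ν := volume) Real.continuous_fourierChar
        (by exact continuous_inner) φ.integrable hf
      have h4 : ∫ x, (𝓕 φ : 𝓢(ℝ, ℂ)) x • f x = ∫ x, φ x • 𝓕 f x := by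
        simpa using! h3
      rw [h4] at h1
      exact h1
  have e1 : ∫⁻ ξ, ‖𝓕 f ξ‖ₑ ^ 2 = eLpNorm F' 2 volume ^ 2 := by
    rw [← eLpNorm_congr_ae key, eLpNorm_eq_lintegral_rpow_enorm_toReal (by norm_num) (by norm_num)]
    simp
    rw [← ENNReal.rpow_natCast, ← ENNReal.rpow_mul]; norm_num
  have e2 : ∫⁻ ξ, ‖f ξ‖ₑ ^ 2 = eLpNorm F 2 volume ^ 2 := by
    rw [eLpNorm_congr_ae hF, eLpNorm_eq_lintegral_rpow_enorm_toReal (by norm_num) (by norm_num)]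
    simp
    rw [← ENNReal.rpow_natCast, ← ENNReal.rpow_mul]; norm_num
  rw [e1, e2]
  rw [Lp.norm_def, Lp.norm_def,
    ENNReal.toReal_eq_toReal_iff' (Lp.eLpNorm_ne_top _) (Lp.eLpNorm_ne_top _)] at hnorm
  rw [hnorm]

/-- The improper Fourier transform of a function with derivative `f'`, written through
the absolutely convergent Fourier transform of `f'`. -/
def derivFT (f' : ℝ → ℂ) (ξ : ℝ) : ℂ := (2 * π * I * ξ)⁻¹ * 𝓕 f' ξ

theorem fourier_apply_eq_integral_exp (f : ℝ → ℂ) (ξ : ℝ) :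
    𝓕 f ξ = ∫ x, f x * cexp (-2 * π * I * x * ξ) := by
  rw [Real.fourier_eq']
  congr 1; ext x
  rw [smul_eq_mul, mul_comm]
  congr 2
  simp; ring

theorem isImpFT_of_integrable {f : ℝ → ℂ} (hf : Integrable f) (ξ : ℝ) :
    IsImpFT f ξ (𝓕 f ξ) := by
  unfold IsImpFT
  rw [fourier_apply_eq_integral_exp]
  have hg : Integrable (fun x : ℝ => f x * cexp (-2 * π * I * x * ξ)) := by
    refine hf.mul_bdd (c := 1) (by fun_prop) (ae_of_all _ fun x => ?_)
    rw [Complex.norm_exp]; simp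
  have h := intervalIntegral_tendsto_integral hg tendsto_neg_atTop_atBot tendsto_id
  refine h.congr' ?_
  filter_upwards [eventually_ge_atTop 0] with R hR
  rw [intervalIntegral.integral_of_le (by simp; linarith)]
  rfl

theorem isImpFT_derivFT {f f' : ℝ → ℂ} (hf : ∀ x, HasDerivAt f (f' x) x) (hf' : Integrable f')
    (htop : Tendsto f atTop (𝓝 0)) (hbot : Tendsto f atBot (𝓝 0)) {ξ : ℝ} (hξ : ξ ≠ 0) :
    IsImpFT f ξ (derivFT f' ξ) := by
  have h1 := isImpFT_of_integrable hf' ξ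
  unfold IsImpFT at h1 ⊢
  unfold derivFT
  set c : ℂ := 2 * π * I * ξ with hc
  have hc0 : c ≠ 0 := by simp [hc, hξ, Real.pi_ne_zero]
  have hE : ∀ x : ℝ, cexp (-2 * π * I * x * ξ) = cexp (-c * x) := fun x => by
    rw [hc]; congr 1; ring
  have hEn : ∀ x : ℝ, ‖cexp (-c * x)‖ = 1 := fun x => by
    rw [Complex.norm_exp, hc]; simp
  simp only [hE] at h1 ⊢
  have hbd : ∀ l : Filter ℝ, Tendsto f l (𝓝 0) →
      Tendsto (fun x : ℝ => f x * cexp (-c * x)) l (𝓝 0) := fun l hl => by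
    rw [tendsto_zero_iff_norm_tendsto_zero] at hl ⊢
    refine hl.congr fun x => by rw [norm_mul, hEn, mul_one]
  have key : ∀ R : ℝ, 0 ≤ R → ∫ x in Set.Ioc (-R) R, f x * cexp (-c * x)
      = c⁻¹ * ((∫ x in Set.Ioc (-R) R, f' x * cexp (-c * x))
        - (f R * cexp (-c * R) - f (-R) * cexp (-c * ((-R : ℝ) : ℂ)))) := by
    intro R hR
    rw [← intervalIntegral.integral_of_le (by linarith), ← intervalIntegral.integral_of_le (by linarith)]
    have hdE : ∀ x : ℝ, HasDerivAt (fun x : ℝ => cexp (-c * x)) (-c * cexp (-c * x)) x := by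
      intro x
      have := (((hasDerivAt_id (x : ℂ)).const_mul (-c)).cexp).comp_ofReal
      simpa [mul_comm] using this
    have := intervalIntegral.integral_mul_deriv_eq_deriv_mul (u := f) (u' := f')
      (v := fun x : ℝ => cexp (-c * x)) (v' := fun x : ℝ => -c * cexp (-c * x)) (a := -R) (b := R)
      (fun x _ => hf x) (fun x _ => hdE x) hf'.intervalIntegrable
      (Continuous.intervalIntegrable (by fun_prop) _ _)
    have e : (∫ x in (-R)..R, f x * (-c * cexp (-c * x)))
        = -c * ∫ x in (-R)..R, f x * cexp (-c * x) := by
      rw [← intervalIntegral.integral_const_mul]; congr 1; ext x; ring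
    rw [e] at this
    rw [eq_comm, inv_mul_eq_iff_eq_mul₀ hc0]
    linear_combination this
  have h2 := ((h1.sub ((hbd _ htop).sub ((hbd _ hbot).comp tendsto_neg_atTop_atBot))).const_mul c⁻¹)
  simp only [sub_zero] at h2
  refine h2.congr' ?_
  filter_upwards [eventually_ge_atTop 0] with R hR
  rw [key R hR]; rfl

theorem integrable_translate_sub {f f' : ℝ → ℂ} (hf : ∀ x, HasDerivAt f (f' x) x)
    (hf' : Integrable f') (t : ℝ) : Integrable (fun x => f (x + t) - f x) := by
  have hcont : Continuous f := continuous_iff_continuousAt.2 fun x => (hf x).continuousAt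
  have : IsFiniteMeasure (volume.restrict (Set.uIoc 0 t)) := ⟨by simp [uIoc]⟩
  have hprod : Integrable (fun p : ℝ × ℝ => f' (p.1 + p.2)) (volume.prod (volume.restrict (Set.uIoc 0 t))) := by
    have hmeas : AEStronglyMeasurable (fun p : ℝ × ℝ => f' (p.1 + p.2))
        (volume.prod (volume.restrict (Set.uIoc 0 t))) := by
      have : (fun p : ℝ × ℝ => f' (p.1 + p.2)) = fun p : ℝ × ℝ => deriv f (p.1 + p.2) := by
        ext p; rw [(hf _).deriv]
      rw [this]
      exact ((measurable_deriv f).comp (measurable_fst.add measurable_snd)).aestronglyMeasurable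
    rw [integrable_prod_iff' hmeas]
    refine ⟨ae_of_all _ fun y => hf'.comp_add_right y, ?_⟩
    have : (fun y : ℝ => ∫ x, ‖f' (x + y)‖) = fun _ => ∫ x, ‖f' x‖ := by
      ext y; exact integral_add_right_eq_self (fun x => ‖f' x‖) y
    simp only [this]
    exact integrable_const _
  have h2 := hprod.norm.integral_prod_left
  refine h2.mono' (by fun_prop) (ae_of_all _ fun x => ?_)
  have h3 : ∫ y in (0:ℝ)..t, f' (x + y) = f (x + t) - f x := by
    have := intervalIntegral.integral_eq_sub_of_hasDerivAt (f := fun y => f (x + y))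
      (f' := fun y => f' (x + y)) (a := 0) (b := t) (fun y _ => (hf (x + y)).comp_const_add x y)
      (hf'.comp_add_left x).intervalIntegrable
    simpa using this
  rw [← h3]
  exact intervalIntegral.norm_integral_le_integral_norm_uIoc

theorem fourier_translate_sub {f f' : ℝ → ℂ} (hf : ∀ x, HasDerivAt f (f' x) x)
    (hf' : Integrable f') (t : ℝ) {ξ : ℝ} (hξ : ξ ≠ 0) :
    𝓕 (fun x => f (x + t) - f x) ξ = (cexp (2 * π * I * t * ξ) - 1) * derivFT f' ξ := by
  have hd : ∀ x, HasDerivAt (fun x => f (x + t) - f x) (f' (x + t) - f' x) x := fun x =>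
    ((hf (x + t)).comp_add_const x t).sub (hf x)
  have hde : deriv (fun x => f (x + t) - f x) = fun x => f' (x + t) - f' x := by
    ext x; exact (hd x).deriv
  have hi : Integrable (fun x => f' (x + t) - f' x) := (hf'.comp_add_right t).sub hf'
  have h1 := congrFun (Real.fourier_deriv (integrable_translate_sub hf hf' t)
    (fun x => (hd x).differentiableAt) (hde ▸ hi)) ξ
  rw [hde] at h1
  have h2 : 𝓕 (fun x => f' (x + t) - f' x) ξ = (cexp (2 * π * I * t * ξ) - 1) * 𝓕 f' ξ := by
    simp only [fourier_apply_eq_integral_exp]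
    have hg : ∀ g : ℝ → ℂ, Integrable g → Integrable (fun x : ℝ => g x * cexp (-2 * π * I * x * ξ)) := by
      intro g hg
      refine hg.mul_bdd (c := 1) (by fun_prop) (ae_of_all _ fun x => ?_)
      rw [Complex.norm_exp]; simp
    simp only [sub_mul]
    rw [integral_sub (hg _ (hf'.comp_add_right t)) (hg _ hf'), one_mul]
    congr 1
    rw [← integral_const_mul, ← integral_add_right_eq_self
      (fun x : ℝ => cexp (2 * π * I * t * ξ) * (f' x * cexp (-2 * π * I * x * ξ))) t]
    congr 1; ext x
    rw [mul_left_comm, ← Complex.exp_add]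
    congr 2
    push_cast; ring
  rw [h2, smul_eq_mul] at h1
  unfold derivFT
  have hc0 : (2 * π * I * ξ : ℂ) ≠ 0 := by simp [hξ, Real.pi_ne_zero]
  rw [mul_left_comm, h1, inv_mul_cancel_left₀ hc0]

theorem lintegral_enorm_translate_sub_sq {f f' : ℝ → ℂ} (hf : ∀ x, HasDerivAt f (f' x) x)
    (hf' : Integrable f') {M : ℝ} (hM : ∀ x, ‖f x‖ ≤ M) (t : ℝ) :
    ∫⁻ x, ‖f (x + t) - f x‖ₑ ^ 2
      = ∫⁻ ξ : ℝ, ‖cexp (2 * π * I * t * ξ) - 1‖ₑ ^ 2 * ‖derivFT f' ξ‖ₑ ^ 2 := by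
  have hi := integrable_translate_sub hf hf' t
  have h2 : MemLp (fun x => f (x + t) - f x) 2 := by
    rw [memLp_two_iff_integrable_sq_norm hi.aestronglyMeasurable]
    have := hi.norm.mul_bdd (g := fun x => ‖f (x + t) - f x‖) (c := 2 * M)
      hi.norm.aestronglyMeasurable (ae_of_all _ fun x => by
      rw [norm_norm]; exact (norm_sub_le _ _).trans (by linarith [hM x, hM (x + t)]))
    simpa [sq] using this
  rw [← lintegral_enorm_fourier_sq hi h2]
  refine lintegral_congr_ae ?_
  filter_upwards [Measure.ae_ne volume (0 : ℝ)] with ξ hξ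
  rw [fourier_translate_sub hf hf' t hξ, enorm_mul, mul_pow]

theorem lintegral_comp_abs_eq_two_mul (F : ℝ → ℝ≥0∞) :
    ∫⁻ t : ℝ, F |t| = 2 * ∫⁻ t in Ioi (0:ℝ), F t := by
  have h1 : ∫⁻ t : ℝ, F |t| = (∫⁻ t in Iio (0:ℝ), F |t|) + ∫⁻ t in (Iio (0:ℝ))ᶜ, F |t| :=
    (lintegral_add_compl (μ := (volume : Measure ℝ)) (fun t : ℝ => F |t|) (measurableSet_Iio (a := (0:ℝ)))).symm
  have h2 : ∫⁻ t in (Iio (0:ℝ))ᶜ, F |t| = ∫⁻ t in Ioi (0:ℝ), F t := by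
    rw [compl_Iio, setLIntegral_congr Ioi_ae_eq_Ici.symm]
    exact setLIntegral_congr_fun measurableSet_Ioi fun t ht => by
      simp only [abs_of_pos (show 0 < t from ht)]
  have h3 : ∫⁻ t in Iio (0:ℝ), F |t| = ∫⁻ t in Ioi (0:ℝ), F t := by
    have := (Measure.measurePreserving_neg (volume : Measure ℝ)).setLIntegral_comp_preimage_emb
      (Homeomorph.neg ℝ).measurableEmbedding (fun t => F |t|) (Ioi (0:ℝ))
    rw [show (Neg.neg ⁻¹' (Ioi (0:ℝ))) = Iio 0 by ext; simp] at this
    simp only [abs_neg] at this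
    rw [this]
    exact setLIntegral_congr_fun measurableSet_Ioi fun t ht => by
      simp only [abs_of_pos (show 0 < t from ht)]
  rw [h1, h2, h3, two_mul]

theorem lintegral_comp_mul_left_eq (F : ℝ → ℝ≥0∞) {a : ℝ} (ha : a ≠ 0) :
    ∫⁻ t : ℝ, F (a * t) = ENNReal.ofReal |a⁻¹| * ∫⁻ t, F t := by
  have h := (Homeomorph.mulLeft₀ a ha).measurableEmbedding.lintegral_map F (μ := volume)
  rw [show ⇑(Homeomorph.mulLeft₀ a ha) = (a * ·) from rfl, Real.map_volume_mul_left ha,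
    lintegral_smul_measure] at h
  exact h.symm

/-- The constant `∫ |t|^{-1-σ} |e^{2πit} - 1|² dt` relating the Gagliardo seminorm to the
weighted `L²` norm of the Fourier transform. -/
def gagliardoConst (σ : ℝ) : ℝ≥0∞ :=
  ∫⁻ t : ℝ, ENNReal.ofReal (|t| ^ (-1 - σ)) * ‖cexp (2 * π * I * t) - 1‖ₑ ^ 2

theorem gagliardoConst_ne_zero (σ : ℝ) : gagliardoConst σ ≠ 0 := by
  have hmeas : Measurable fun t : ℝ =>
      ENNReal.ofReal (|t| ^ (-1 - σ)) * ‖cexp (2 * π * I * t) - 1‖ₑ ^ 2 := by fun_prop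
  unfold gagliardoConst
  rw [Ne, lintegral_eq_zero_iff hmeas]
  intro h
  have h2 : volume {t : ℝ | ¬ (ENNReal.ofReal (|t| ^ (-1 - σ)) *
      ‖cexp (2 * π * I * t) - 1‖ₑ ^ 2 = 0)} = 0 := h
  have h3 : Ioo (0:ℝ) 1 ⊆ {t : ℝ | ¬ (ENNReal.ofReal (|t| ^ (-1 - σ)) *
      ‖cexp (2 * π * I * t) - 1‖ₑ ^ 2 = 0)} := by
    intro t ht
    simp only [Set.mem_ofPred_eq, mul_eq_zero, not_or]
    refine ⟨by simpa using Real.rpow_pos_of_pos (abs_pos.2 ht.1.ne') _, ?_⟩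
    simp only [ne_eq, OfNat.ofNat_ne_zero, not_false_eq_true, pow_eq_zero_iff, enorm_eq_zero,
      sub_eq_zero, Complex.exp_eq_one_iff]
    rintro ⟨n, hn⟩
    have : (t : ℂ) = n := by
      have h0 : (2 * π * I : ℂ) ≠ 0 := by simp [Real.pi_ne_zero]
      apply mul_left_cancel₀ h0; rw [hn]; ring
    have : t = n := by exact_mod_cast this
    have h4 := ht.1; have h5 := ht.2
    rw [this] at h4 h5
    have : (0:ℤ) < n := by exact_mod_cast h4
    have : n < (1:ℤ) := by exact_mod_cast h5
    omega
  have := measure_mono_null h3 h2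
  simp at this

theorem setLIntegral_rpow_Ioc_lt_top {r : ℝ} (hr : -1 < r) {R : ℝ} (hR : 0 ≤ R) :
    ∫⁻ t in Ioc (0:ℝ) R, ENNReal.ofReal (t ^ r) < ∞ := by
  have h := (intervalIntegral.intervalIntegrable_rpow' hr (a := 0) (b := R))
  rw [intervalIntegrable_iff_integrableOn_Ioc_of_le hR] at h
  have h2 := h.hasFiniteIntegral
  rw [hasFiniteIntegral_iff_ofReal] at h2
  · exact h2
  · filter_upwards [self_mem_ae_restrict measurableSet_Ioc] with t ht
    exact Real.rpow_nonneg ht.1.le _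

theorem setLIntegral_rpow_Ioi_lt_top {r : ℝ} (hr : r < -1) {R : ℝ} (hR : 0 < R) :
    ∫⁻ t in Ioi (R:ℝ), ENNReal.ofReal (t ^ r) < ∞ := by
  have h2 := (integrableOn_Ioi_rpow_of_lt hr hR).hasFiniteIntegral
  rw [hasFiniteIntegral_iff_ofReal] at h2
  · exact h2
  · filter_upwards [self_mem_ae_restrict measurableSet_Ioi] with t ht
    exact Real.rpow_nonneg (hR.le.trans (le_of_lt ht)) _

theorem gagliardoConst_ne_top {σ : ℝ} (h0 : 0 < σ) (h2 : σ < 2) : gagliardoConst σ ≠ ∞ := by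
  apply ne_of_lt
  have hle : ∀ t : ℝ, ‖cexp (2 * π * I * t) - 1‖ ≤ 2 * π * |t| := fun t => by
    have := Real.norm_exp_I_mul_ofReal_sub_one_le (x := 2 * π * t)
    rw [Real.norm_eq_abs, abs_mul, abs_of_pos Real.two_pi_pos] at this
    convert this using 4
    push_cast; ring
  have hle2 : ∀ t : ℝ, ‖cexp (2 * π * I * t) - 1‖ ≤ 2 := fun t => by
    refine (norm_sub_le _ _).trans ?_
    rw [Complex.norm_exp]; simp; norm_num
  have e : ∀ t : ℝ, ∀ c : ℝ, 0 ≤ c → ‖cexp (2 * π * I * t) - 1‖ ≤ c →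
      ‖cexp (2 * π * I * t) - 1‖ₑ ^ 2 ≤ ENNReal.ofReal (c ^ 2) := fun t c hc h => by
    rw [← ofReal_norm, ← ENNReal.ofReal_pow (norm_nonneg _)]
    exact ENNReal.ofReal_le_ofReal (by gcongr)
  set F : ℝ → ℝ≥0∞ := fun t => ENNReal.ofReal (t ^ (-1 - σ)) *
    (if t ≤ 1 then ENNReal.ofReal ((2 * π * t) ^ 2) else ENNReal.ofReal (2 ^ 2)) with hF
  have hb : gagliardoConst σ ≤ ∫⁻ t : ℝ, F |t| := by
    refine lintegral_mono fun t => ?_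
    simp only [hF]
    gcongr
    split_ifs with h
    · exact e t _ (by positivity) (hle t)
    · exact e t _ (by positivity) (hle2 t)
  refine hb.trans_lt ?_
  rw [lintegral_comp_abs_eq_two_mul]
  refine ENNReal.mul_lt_top (by simp) ?_
  rw [← Ioc_union_Ioi_eq_Ioi (zero_le_one (α := ℝ))]
  refine (lintegral_union_le _ _ _).trans_lt (ENNReal.add_lt_top.2 ⟨?_, ?_⟩)
  · have : ∫⁻ t in Ioc (0:ℝ) 1, F t = ∫⁻ t in Ioc (0:ℝ) 1, ENNReal.ofReal ((2 * π) ^ 2) * ENNReal.ofReal (t ^ (1 - σ)) := by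
      refine setLIntegral_congr_fun measurableSet_Ioc fun t ht => ?_
      simp only [hF, if_pos ht.2]
      rw [← ENNReal.ofReal_mul (Real.rpow_nonneg ht.1.le _), ← ENNReal.ofReal_mul (by positivity)]
      congr 1
      rw [show (1 - σ) = (-1 - σ) + 2 by ring, Real.rpow_add ht.1, Real.rpow_two]; ring
    rw [this, lintegral_const_mul _ (by fun_prop)]
    exact ENNReal.mul_lt_top (by simp) (setLIntegral_rpow_Ioc_lt_top (by linarith) zero_le_one)
  · have : ∫⁻ t in Ioi (1:ℝ), F t = ∫⁻ t in Ioi (1:ℝ), ENNReal.ofReal (2 ^ 2) * ENNReal.ofReal (t ^ (-1 - σ)) := by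
      refine setLIntegral_congr_fun measurableSet_Ioi fun t ht => ?_
      simp only [hF, if_neg (not_le.2 (show 1 < t from ht))]
      rw [mul_comm]
    rw [this, lintegral_const_mul _ (by fun_prop)]
    exact ENNReal.mul_lt_top (by simp) (setLIntegral_rpow_Ioi_lt_top (by linarith) zero_lt_one)

theorem lintegral_abs_rpow_mul_enorm_exp_sub_one {σ : ℝ} {ξ : ℝ} (hξ : ξ ≠ 0) :
    ∫⁻ t : ℝ, ENNReal.ofReal (|t| ^ (-1 - σ)) * ‖cexp (2 * π * I * t * ξ) - 1‖ₑ ^ 2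
      = gagliardoConst σ * ENNReal.ofReal (|ξ| ^ σ) := by
  have hξ' := abs_pos.2 hξ
  have h := lintegral_comp_mul_left_eq (fun t : ℝ => ENNReal.ofReal (|t| ^ (-1 - σ)) *
    ‖cexp (2 * π * I * t) - 1‖ₑ ^ 2) hξ
  have e : ∀ t : ℝ, ENNReal.ofReal (|ξ * t| ^ (-1 - σ)) * ‖cexp (2 * π * I * (ξ * t : ℝ)) - 1‖ₑ ^ 2
      = ENNReal.ofReal (|ξ| ^ (-1 - σ)) *
        (ENNReal.ofReal (|t| ^ (-1 - σ)) * ‖cexp (2 * π * I * t * ξ) - 1‖ₑ ^ 2) := fun t => by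
    rw [abs_mul, Real.mul_rpow (abs_nonneg _) (abs_nonneg _), ENNReal.ofReal_mul (by positivity),
      mul_assoc]
    congr 6; push_cast; ring
  simp only [e] at h
  rw [lintegral_const_mul _ (by fun_prop)] at h
  have h1 : ENNReal.ofReal (|ξ| ^ (1 + σ)) * ENNReal.ofReal (|ξ| ^ (-1 - σ)) = 1 := by
    rw [← ENNReal.ofReal_mul (by positivity), ← Real.rpow_add hξ']; simp
  have h2 := congrArg (ENNReal.ofReal (|ξ| ^ (1 + σ)) * ·) h
  rw [← mul_assoc, h1, one_mul] at h2
  rw [h2, ← mul_assoc, ← ENNReal.ofReal_mul (by positivity), mul_comm]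
  unfold gagliardoConst
  congr 2
  rw [Real.rpow_add hξ', Real.rpow_one, abs_inv]
  field_simp

theorem measurable_derivFT {f' : ℝ → ℂ} (hf' : Integrable f') : Measurable (derivFT f') := by
  have := (continuous_fourier_of_integrable hf').measurable
  unfold derivFT
  fun_prop

/-- The Gagliardo seminorm in terms of the improper Fourier transform. -/
theorem lintegral_gagliardo_eq {σ : ℝ}
    {f f' : ℝ → ℂ} (hf : ∀ x, HasDerivAt f (f' x) x)
    (hf' : Integrable f') {M : ℝ} (hM : ∀ x, ‖f x‖ ≤ M) :
    ∫⁻ x, ∫⁻ y, ‖f x - f y‖ₑ ^ 2 * ENNReal.ofReal (|x - y| ^ (-1 - σ))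
      = gagliardoConst σ * ∫⁻ ξ : ℝ, ENNReal.ofReal (|ξ| ^ σ) * ‖derivFT f' ξ‖ₑ ^ 2 := by
  have hmf : Measurable f := (continuous_iff_continuousAt.2 fun x => (hf x).continuousAt).measurable
  have hmF := measurable_derivFT hf'
  have h1 : ∀ x : ℝ, ∫⁻ y, ‖f x - f y‖ₑ ^ 2 * ENNReal.ofReal (|x - y| ^ (-1 - σ))
      = ∫⁻ t, ‖f (x + t) - f x‖ₑ ^ 2 * ENNReal.ofReal (|t| ^ (-1 - σ)) := fun x => by
    rw [← lintegral_add_left_eq_self _ x]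
    refine lintegral_congr fun t => ?_
    rw [enorm_sub_rev]; simp
  simp only [h1]
  rw [lintegral_lintegral_swap (by fun_prop)]
  have h2 : ∀ t : ℝ, ∫⁻ x, ‖f (x + t) - f x‖ₑ ^ 2 * ENNReal.ofReal (|t| ^ (-1 - σ))
      = ∫⁻ ξ : ℝ, (ENNReal.ofReal (|t| ^ (-1 - σ)) * ‖cexp (2 * π * I * t * ξ) - 1‖ₑ ^ 2)
         * ‖derivFT f' ξ‖ₑ ^ 2 := fun t => by
    rw [lintegral_mul_const _ (by fun_prop), lintegral_enorm_translate_sub_sq hf hf' hM, mul_comm,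
      ← lintegral_const_mul _ (by fun_prop)]
    simp only [mul_assoc]
  simp only [h2]
  rw [lintegral_lintegral_swap (by fun_prop), ← lintegral_const_mul _ (by fun_prop)]
  refine lintegral_congr_ae ?_
  filter_upwards [Measure.ae_ne volume (0 : ℝ)] with ξ hξ
  rw [lintegral_mul_const _ (by fun_prop), lintegral_abs_rpow_mul_enorm_exp_sub_one hξ, mul_assoc]

theorem one_add_sq_pos (x : ℝ) : 0 < 1 + x ^ 2 := by positivity

theorem sin_arccot (x : ℝ) : Real.sin (arccot x) = (1 + x ^ 2) ^ (-1 / 2 : ℝ) := by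
  rw [arccot, Real.sin_pi_div_two_sub, Real.cos_arctan, Real.sqrt_eq_rpow, one_div,
    ← Real.rpow_neg (one_add_sq_pos x).le]
  norm_num

theorem sin_arccot_pos (x : ℝ) : 0 < Real.sin (arccot x) := by
  rw [sin_arccot]; exact Real.rpow_pos_of_pos (one_add_sq_pos x) _

theorem cos_arccot (x : ℝ) : Real.cos (arccot x) = x * Real.sin (arccot x) := by
  rw [arccot, Real.cos_pi_div_two_sub, Real.sin_pi_div_two_sub, Real.sin_arctan, Real.cos_arctan]
  ring

theorem sin_arccot_rpow (x p : ℝ) : Real.sin (arccot x) ^ p = (1 + x ^ 2) ^ (-p / 2) := by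
  rw [sin_arccot, ← Real.rpow_mul (one_add_sq_pos x).le]; congr 1; ring

theorem continuous_arccot : Continuous arccot := continuous_const.sub Real.continuous_arctan

theorem hasDerivAt_arccot (x : ℝ) : HasDerivAt arccot (-(1 + x ^ 2)⁻¹) x := by
  have h := (Real.hasDerivAt_arctan x).const_sub (Real.pi / 2)
  exact h.congr_deriv (by simp)

theorem arccot_mem_Ioo (x : ℝ) : arccot x ∈ Ioo 0 π := by
  have h1 := Real.arctan_lt_pi_div_two x
  have h2 := Real.neg_pi_div_two_lt_arctan x
  constructor <;> unfold arccot <;> linarith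

theorem sin_arccot_sub_arccot (x y : ℝ) : Real.sin (arccot x - arccot y)
    = (y - x) * (Real.sin (arccot x) * Real.sin (arccot y)) := by
  rw [Real.sin_sub, cos_arccot, cos_arccot]; ring

/-- The function on the line with angular profile `g` and decay exponent `p`. -/
def prof (p : ℝ) (g : ℝ → ℂ) (x : ℝ) : ℂ := (((1 + x ^ 2) ^ (-p / 2) : ℝ) : ℂ) * g (arccot x)

theorem prof_eq (p : ℝ) (g : ℝ → ℂ) (x : ℝ) :
    prof p g x = ((Real.sin (arccot x) ^ p : ℝ) : ℂ) * g (arccot x) := by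
  rw [prof, sin_arccot_rpow]

theorem exists_bound_of_periodic {g : ℝ → ℂ} (hg : Continuous g) (hper : Function.Periodic g π) :
    ∃ M, 0 ≤ M ∧ ∀ x, ‖g x‖ ≤ M := by
  obtain ⟨M, hM⟩ := (hper.isBounded_of_continuous Real.pi_ne_zero hg).exists_norm_le
  exact ⟨M, (norm_nonneg _).trans (hM _ (mem_range_self 0)), fun x => hM _ (mem_range_self x)⟩

theorem norm_prof_le {p : ℝ} {g : ℝ → ℂ} {M : ℝ} (hM : ∀ x, ‖g x‖ ≤ M) (x : ℝ) :
    ‖prof p g x‖ ≤ M * (1 + x ^ 2) ^ (-p / 2) := by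
  have h := Real.rpow_nonneg (one_add_sq_pos x).le (-p / 2)
  rw [prof, norm_mul, Complex.norm_real, Real.norm_of_nonneg h, mul_comm]
  gcongr; exact hM _

theorem exists_norm_prof_le {p : ℝ} (hp : 0 ≤ p) {g : ℝ → ℂ} (hg : Continuous g)
    (hper : Function.Periodic g π) : ∃ M, ∀ x, ‖prof p g x‖ ≤ M := by
  obtain ⟨M, hM0, hM⟩ := exists_bound_of_periodic hg hper
  refine ⟨M, fun x => (norm_prof_le hM x).trans ?_⟩
  have : (1 + x ^ 2) ^ (-p / 2) ≤ 1 :=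
    Real.rpow_le_one_of_one_le_of_nonpos (by nlinarith [sq_nonneg x]) (by linarith)
  nlinarith

theorem continuous_prof (p : ℝ) {g : ℝ → ℂ} (hg : Continuous g) : Continuous (prof p g) := by
  refine Continuous.mul (Complex.continuous_ofReal.comp ?_) (hg.comp continuous_arccot)
  exact Continuous.rpow_const (by fun_prop) fun x => Or.inl (one_add_sq_pos x).ne'

theorem hasDerivAt_prof (p : ℝ) {g : ℝ → ℂ} (hg : ContDiff ℝ 1 g) (x : ℝ) :
    HasDerivAt (prof p g) (((-p * x * (1 + x ^ 2) ^ (-p / 2 - 1) : ℝ) : ℂ) * g (arccot x)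
      - (((1 + x ^ 2) ^ (-p / 2 - 1) : ℝ) : ℂ) * deriv g (arccot x)) x := by
  have h1 : HasDerivAt (fun x : ℝ => (1 + x ^ 2) ^ (-p / 2)) (-p * x * (1 + x ^ 2) ^ (-p / 2 - 1)) x := by
    refine (((hasDerivAt_pow 2 x).const_add 1).rpow_const (p := -p / 2)
      (Or.inl (one_add_sq_pos x).ne')).congr_deriv ?_
    simp; ring
  have h2 : HasDerivAt (fun x : ℝ => g (arccot x)) ((-(1 + x ^ 2)⁻¹ : ℝ) • deriv g (arccot x)) x :=
    ((hg.differentiable one_ne_zero _).hasDerivAt).scomp x (hasDerivAt_arccot x)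
  refine (h1.ofReal_comp.mul h2).congr_deriv ?_
  rw [Real.rpow_sub_one (one_add_sq_pos x).ne', Complex.real_smul]
  push_cast
  ring

theorem hasDerivAt_prof_deriv (p : ℝ) {g : ℝ → ℂ} (hg : ContDiff ℝ 1 g) (x : ℝ) :
    HasDerivAt (prof p g) (deriv (prof p g) x) x :=
  (hasDerivAt_prof p hg x).differentiableAt.hasDerivAt

theorem Function.Periodic.deriv_periodic {g : ℝ → ℂ} {c : ℝ} (hper : Function.Periodic g c) :
    Function.Periodic (deriv g) c := fun x => by
  have h : (fun x => g (x + c)) = g := funext hper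
  rw [← deriv_comp_add_const, h]

theorem integrable_one_add_sq_rpow {r : ℝ} (hr : 1 < r) :
    Integrable (fun x : ℝ => (1 + x ^ 2) ^ (-r / 2)) := by
  have h := integrable_rpow_neg_one_add_norm_sq (E := ℝ) (μ := volume) (r := r) (by simpa using hr)
  simpa using h

theorem integrable_deriv_prof {p : ℝ} (hp : 0 < p) {g : ℝ → ℂ} (hg : ContDiff ℝ 1 g)
    (hper : Function.Periodic g π) : Integrable (deriv (prof p g)) := by
  obtain ⟨M, hM0, hM⟩ := exists_bound_of_periodic hg.continuous hper
  obtain ⟨N, hN0, hN⟩ := exists_bound_of_periodic (hg.continuous_deriv le_rfl) hper.deriv_periodic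
  have hi := (integrable_one_add_sq_rpow (show 1 < p + 1 by linarith)).const_mul (p * M + N)
  refine hi.mono' (measurable_deriv _).aestronglyMeasurable (ae_of_all _ fun x => ?_)
  rw [(hasDerivAt_prof p hg x).deriv]
  have hx := one_add_sq_pos x
  have h0 : 0 ≤ (1 + x ^ 2) ^ (-p / 2 - 1) := Real.rpow_nonneg hx.le _
  have h1 : |x| * (1 + x ^ 2) ^ (-p / 2 - 1) ≤ (1 + x ^ 2) ^ (-(p + 1) / 2) := by
    have e : (1 + x ^ 2) ^ (-(p + 1) / 2) = (1 + x ^ 2) ^ (1 / 2 : ℝ) * (1 + x ^ 2) ^ (-p / 2 - 1) := by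
      rw [← Real.rpow_add hx]; congr 1; ring
    rw [e]
    gcongr
    rw [← Real.sqrt_eq_rpow]
    exact Real.abs_le_sqrt (by linarith)
  have h2 : (1 + x ^ 2) ^ (-p / 2 - 1) ≤ (1 + x ^ 2) ^ (-(p + 1) / 2) :=
    Real.rpow_le_rpow_of_exponent_le (by nlinarith [sq_nonneg x]) (by linarith)
  refine (norm_sub_le _ _).trans ?_
  rw [norm_mul, norm_mul, Complex.norm_real, Complex.norm_real, Real.norm_of_nonneg h0,
    Real.norm_eq_abs, abs_mul, abs_mul, abs_neg, abs_of_pos hp, abs_of_nonneg h0]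
  calc _ ≤ p * |x| * (1 + x ^ 2) ^ (-p / 2 - 1) * M + (1 + x ^ 2) ^ (-p / 2 - 1) * N := by
        gcongr; exacts [hM _, hN _]
    _ = p * M * (|x| * (1 + x ^ 2) ^ (-p / 2 - 1)) + N * (1 + x ^ 2) ^ (-p / 2 - 1) := by ring
    _ ≤ p * M * (1 + x ^ 2) ^ (-(p + 1) / 2) + N * (1 + x ^ 2) ^ (-(p + 1) / 2) := by gcongr
    _ = _ := by ring

theorem tendsto_prof {p : ℝ} (hp : 0 < p) {g : ℝ → ℂ} (hg : Continuous g)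
    (hper : Function.Periodic g π) {l : Filter ℝ} (hl : Tendsto (fun x : ℝ => |x|) l atTop) :
    Tendsto (prof p g) l (𝓝 0) := by
  obtain ⟨M, hM0, hM⟩ := exists_bound_of_periodic hg hper
  have h1 : Tendsto (fun x : ℝ => 1 + x ^ 2) l atTop := by
    have := tendsto_atTop_add_const_left l 1 ((tendsto_pow_atTop two_ne_zero).comp hl)
    simpa using this
  have h2 := ((tendsto_rpow_neg_atTop (show 0 < p / 2 by linarith)).comp h1).const_mul M
  rw [mul_zero] at h2
  refine squeeze_zero_norm (fun x => norm_prof_le hM x) (h2.congr fun x => ?_)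
  simp only [Function.comp_apply]; congr 2; ring

theorem IsImpFT.congr_ae {f h : ℝ → ℂ} {ξ : ℝ} {z : ℂ} (hf : IsImpFT f ξ z) (hfh : f =ᵐ[volume] h) :
    IsImpFT h ξ z := by
  unfold IsImpFT at hf ⊢
  refine hf.congr fun R => integral_congr_ae (ae_restrict_of_ae ?_)
  filter_upwards [hfh] with x hx
  rw [hx]

theorem isImpFT_prof {p : ℝ} (hp : 0 < p) {g : ℝ → ℂ} (hg : ContDiff ℝ 1 g)
    (hper : Function.Periodic g π) {ξ : ℝ} (hξ : ξ ≠ 0) :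
    IsImpFT (prof p g) ξ (derivFT (deriv (prof p g)) ξ) :=
  isImpFT_derivFT (hasDerivAt_prof_deriv p hg) (integrable_deriv_prof hp hg hper)
    (tendsto_prof hp hg.continuous hper tendsto_abs_atTop_atTop)
    (tendsto_prof hp hg.continuous hper tendsto_abs_atBot_atTop) hξ

theorem ofReal_one_add_sq_cpow (x r : ℝ) :
    ((1 + x ^ 2 : ℝ) : ℂ) ^ (r : ℂ) = (((1 + x ^ 2) ^ r : ℝ) : ℂ) :=
  (Complex.ofReal_cpow (one_add_sq_pos x).le r).symm

theorem Function.Periodic.comp_arccot_cot {g : ℝ → ℂ} (hper : Function.Periodic g π) {φ : ℝ}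
    (hφ : Real.sin φ ≠ 0) : g (arccot (Real.cos φ / Real.sin φ)) = g φ := by
  set y := Real.cos φ / Real.sin φ with hy
  have h : Real.sin (φ - arccot y) = 0 := by
    rw [Real.sin_sub, cos_arccot, hy]; field_simp; ring
  obtain ⟨n, hn⟩ := Real.sin_eq_zero_iff.1 h
  rw [show φ = arccot y + n * π by linarith]
  exact (hper.int_mul n _).symm

theorem piPlus_eq_prof {u θ : ℝ} {g v : ℝ → ℂ} (hper : Function.Periodic g π)
    (hv : v = fun x : ℝ => ((1 + x ^ 2 : ℝ) : ℂ) ^ (-(1 + (u : ℂ)) / 2) * g (arccot x)) {x : ℝ}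
    (hx : Real.cos θ - x * Real.sin θ ≠ 0) :
    piPlus u θ v x = prof (1 + u) (fun t => g (t - θ)) x := by
  have hs := sin_arccot_pos x
  set t := arccot x with ht
  have hxc : x = Real.cos t / Real.sin t := by
    rw [ht, cos_arccot, ← ht]; field_simp
  have e1 : Real.cos θ - x * Real.sin θ = Real.sin (t - θ) / Real.sin t := by
    rw [hxc, Real.sin_sub]; field_simp
  have hsφ : Real.sin (t - θ) ≠ 0 := fun h => hx (by rw [e1, h, zero_div])
  have e2 : (x * Real.cos θ + Real.sin θ) / (Real.cos θ - x * Real.sin θ)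
      = Real.cos (t - θ) / Real.sin (t - θ) := by
    rw [e1, Real.cos_sub, hxc]; field_simp
  have e3 : (-(1 + (u : ℂ)) / 2) = ((-(1 + u) / 2 : ℝ) : ℂ) := by push_cast; ring
  have e4 : (-1 - (u : ℂ)) = ((-1 - u : ℝ) : ℂ) := by push_cast; ring
  rw [piPlus, hv, prof_eq]
  simp only
  rw [e2, hper.comp_arccot_cot hsφ, e3, ofReal_one_add_sq_cpow, e4, e1,
    ← Complex.ofReal_cpow (abs_nonneg _), ← mul_assoc, ← Complex.ofReal_mul]
  congr 2
  have hab : 0 < |Real.sin (t - θ)| := abs_pos.2 hsφ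
  have e5 : 1 + (Real.cos (t - θ) / Real.sin (t - θ)) ^ 2 = |Real.sin (t - θ)| ^ (-2 : ℝ) := by
    rw [Real.rpow_neg hab.le, Real.rpow_two, sq_abs]
    field_simp
    linarith [Real.sin_sq_add_cos_sq (t - θ)]
  rw [e5, ← Real.rpow_mul hab.le, abs_div, abs_of_pos hs, Real.div_rpow hab.le hs.le,
    div_mul_eq_mul_div, ← Real.rpow_add hab, ← ht]
  rw [show -1 - u + -2 * (-(1 + u) / 2) = 0 by ring, Real.rpow_zero, one_div,
    ← Real.rpow_neg hs.le]
  congr 1; ring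

theorem ae_cos_sub_mul_sin_ne_zero (θ : ℝ) :
    ∀ᵐ x : ℝ, Real.cos θ - x * Real.sin θ ≠ 0 := by
  by_cases h : Real.sin θ = 0
  · refine ae_of_all _ fun x => ?_
    have := Real.sin_sq_add_cos_sq θ
    rw [h] at this
    simp only [h, mul_zero, sub_zero]
    intro h0; rw [h0] at this; norm_num at this
  · filter_upwards [Measure.ae_ne volume (Real.cos θ / Real.sin θ)] with x hx h0
    exact hx (by field_simp; linarith)

/-- The squared complementary-series norm of the function with profile `g` and decay `p`. -/
def csNormSq (s p : ℝ) (g : ℝ → ℂ) : ℝ≥0∞ :=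
  ∫⁻ ξ : ℝ, ENNReal.ofReal (|ξ| ^ (-s)) * ‖derivFT (deriv (prof p g)) ξ‖ₑ ^ 2

/-- Rotation averages of the complementary-series norm are dominated by the norm of the image. -/
def AverageBound (s u : ℝ) : Prop :=
  ∃ C : ℝ≥0∞, C ≠ ∞ ∧ ∀ g : ℝ → ℂ, ContDiff ℝ 1 g → Function.Periodic g π →
    ∫⁻ θ in Ioc (0 : ℝ) (2 * π), csNormSq s (1 + u) (fun t => g (t - θ)) ≤ C * csNormSq s (1 + s) g

theorem exists_bound_of_averageBound (u μ : ℝ) (hu : u ∈ Set.Ioo (-1 : ℝ) 1) (hμ₁ : -1 - u < μ)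
    (h : AverageBound (u + μ) u) :
    ∃ c : ℝ, 0 < c ∧
      ∀ g : ℝ → ℂ, ContDiff ℝ (⊤ : ℕ∞) g → (∀ θ : ℝ, g (θ + Real.pi) = g θ) →
        ∀ v : ℝ → ℂ,
          (v = fun x : ℝ =>
            ((1 + x ^ 2 : ℝ) : ℂ) ^ (-(1 + (u : ℂ)) / 2) * g (arccot x)) →
        ∃ F : ℝ → ℝ → ℂ, ∃ G : ℝ → ℂ,
          (∀ θ : ℝ, ∀ ξ : ℝ, ξ ≠ 0 → IsImpFT (piPlus (u : ℂ) θ v) ξ (F θ ξ)) ∧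
          (∀ ξ : ℝ, ξ ≠ 0 →
            IsImpFT (fun x : ℝ =>
              ((1 + x ^ 2 : ℝ) : ℂ) ^ (-(μ : ℂ) / 2) * v x) ξ (G ξ)) ∧
          (∫⁻ θ in Ioc (0:ℝ) (2 * π),
              ∫⁻ ξ : ℝ, ENNReal.ofReal (|ξ| ^ (-u - μ)) * (‖F θ ξ‖₊ : ℝ≥0∞) ^ 2)
            ≤ ENNReal.ofReal c *
                (∫⁻ ξ : ℝ, ENNReal.ofReal (|ξ| ^ (-u - μ)) * (‖G ξ‖₊ : ℝ≥0∞) ^ 2) := by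
  obtain ⟨C, hC, h⟩ := h
  refine ⟨C.toReal + 1, by positivity, fun g hg hper v hv => ?_⟩
  have hper' : Function.Periodic g π := hper
  have hg1 : ContDiff ℝ 1 g := hg.of_le (by simp)
  have hgθ : ∀ θ, ContDiff ℝ 1 (fun t => g (t - θ)) := fun θ => hg1.comp (by fun_prop)
  have hpθ : ∀ θ, Function.Periodic (fun t => g (t - θ)) π := fun θ t => by
    simp only; rw [← hper (t - θ)]; congr 1; ring
  refine ⟨fun θ => derivFT (deriv (prof (1 + u) (fun t => g (t - θ)))),
    derivFT (deriv (prof (1 + (u + μ)) g)), fun θ ξ hξ => ?_, fun ξ hξ => ?_, ?_⟩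
  · refine (isImpFT_prof (by linarith [hu.1]) (hgθ θ) (hpθ θ) hξ).congr_ae ?_
    filter_upwards [ae_cos_sub_mul_sin_ne_zero θ] with x hx
    exact (piPlus_eq_prof hper' hv hx).symm
  · refine (isImpFT_prof (by linarith) hg1 hper' hξ).congr_ae (ae_of_all _ fun x => ?_)
    rw [hv]
    simp only
    rw [show (-(1 + (u : ℂ)) / 2) = ((-(1 + u) / 2 : ℝ) : ℂ) by push_cast; ring,
      show (-(μ : ℂ) / 2) = ((-μ / 2 : ℝ) : ℂ) by push_cast; ring, ofReal_one_add_sq_cpow,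
      ofReal_one_add_sq_cpow, ← mul_assoc, ← Complex.ofReal_mul,
      ← Real.rpow_add (one_add_sq_pos x), prof]
    congr 3; ring
  · have hle : C ≤ ENNReal.ofReal (C.toReal + 1) := by
      rw [ENNReal.le_ofReal_iff_toReal_le hC (by positivity)]; linarith
    have := (h g hg1 hper').trans (mul_le_mul_left hle _)
    simpa only [csNormSq, neg_add', enorm_eq_nnnorm] using this

theorem arccot_injective : Function.Injective arccot := fun x y h =>
  Real.arctan_injective (by unfold arccot at h; linarith)

theorem range_arccot : range arccot = Ioo 0 π := by
  ext t
  refine ⟨fun ⟨x, hx⟩ => hx ▸ arccot_mem_Ioo x, fun ht => ⟨Real.tan (π / 2 - t), ?_⟩⟩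
  rw [arccot, Real.arctan_tan (by linarith [ht.2]) (by linarith [ht.1])]; ring

theorem setLIntegral_Ioo_eq_lintegral_arccot (F : ℝ → ℝ≥0∞) :
    ∫⁻ t in Ioo 0 π, F t = ∫⁻ x, ENNReal.ofReal (Real.sin (arccot x) ^ 2) * F (arccot x) := by
  have h := lintegral_image_eq_lintegral_abs_deriv_mul (s := univ) MeasurableSet.univ
    (fun x _ => (hasDerivAt_arccot x).hasDerivWithinAt) (arccot_injective.injOn) F
  rw [image_univ, range_arccot, Measure.restrict_univ] at h
  rw [h]
  refine lintegral_congr fun x => ?_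
  congr 2
  rw [abs_neg, abs_of_pos (inv_pos.2 (one_add_sq_pos x)), ← Real.rpow_two (Real.sin (arccot x)),
    sin_arccot_rpow, neg_div_self two_ne_zero, Real.rpow_neg_one]

theorem Function.Periodic.setLIntegral_sub_eq {F : ℝ → ℝ≥0∞} (hF : Function.Periodic F π) (θ : ℝ) :
    ∫⁻ t in Ioo 0 π, F (t - θ) = ∫⁻ t in Ioo 0 π, F t := by
  rw [setLIntegral_congr Ioo_ae_eq_Ioc, setLIntegral_congr Ioo_ae_eq_Ioc]
  have h1 : ∫⁻ t in Ioc 0 π, F (t - θ) = ∫⁻ t in Ioc (-θ) (-θ + π), F t := by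
    have := (measurePreserving_sub_right (volume : Measure ℝ) θ).setLIntegral_comp_preimage_emb
      (MeasurableEquiv.subRight θ).measurableEmbedding F (Ioc (-θ) (-θ + π))
    rw [← this]
    congr 2
    ext; simp [sub_eq_add_neg]
  rw [h1]
  have : VAddInvariantMeasure (AddSubgroup.zmultiples π) ℝ volume :=
    ⟨fun c s _ => measure_preimage_add _ _ _⟩
  have := (isAddFundamentalDomain_Ioc Real.pi_pos (-θ) volume).setLIntegral_eq
    (isAddFundamentalDomain_Ioc Real.pi_pos 0 volume) F (fun g x => by
      obtain ⟨n, hn⟩ := AddSubgroup.mem_zmultiples_iff.1 g.2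
      rw [AddSubgroup.vadd_def, vadd_eq_add, ← hn, add_comm]
      exact hF.zsmul n x)
  simpa using this

theorem enorm_prof_sq (p : ℝ) (g : ℝ → ℂ) (x : ℝ) :
    ‖prof p g x‖ₑ ^ 2 = ENNReal.ofReal (Real.sin (arccot x) ^ (2 * p)) * ‖g (arccot x)‖ₑ ^ 2 := by
  have hs := (sin_arccot_pos x).le
  rw [prof_eq, enorm_mul, mul_pow]
  congr 1
  rw [← ofReal_norm, Complex.norm_real, Real.norm_of_nonneg (Real.rpow_nonneg hs _),
    ← ENNReal.ofReal_pow (Real.rpow_nonneg hs _), ← Real.rpow_mul_natCast hs]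
  congr 2; push_cast; ring

theorem ofReal_sin_arccot_rpow_mul (x p q : ℝ) :
    ENNReal.ofReal (Real.sin (arccot x) ^ p) * ENNReal.ofReal (Real.sin (arccot x) ^ q)
      = ENNReal.ofReal (Real.sin (arccot x) ^ (p + q)) := by
  have hs := sin_arccot_pos x
  rw [← ENNReal.ofReal_mul (Real.rpow_nonneg hs.le _), ← Real.rpow_add hs]

/-- The squared `L²` norm over one period. -/
def periodNormSq (g : ℝ → ℂ) : ℝ≥0∞ := ∫⁻ t in Ioo 0 π, ‖g t‖ₑ ^ 2

theorem lintegral_enorm_prof_sq (p : ℝ) (g : ℝ → ℂ) :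
    ∫⁻ x, ‖prof p g x‖ₑ ^ 2
      = ∫⁻ t in Ioo 0 π, ENNReal.ofReal (Real.sin t ^ (2 * p - 2)) * ‖g t‖ₑ ^ 2 := by
  rw [setLIntegral_Ioo_eq_lintegral_arccot]
  refine lintegral_congr fun x => ?_
  rw [enorm_prof_sq, ← mul_assoc, ← Real.rpow_two, ofReal_sin_arccot_rpow_mul]
  congr 3; ring

theorem periodNormSq_eq (g : ℝ → ℂ) : periodNormSq g = ∫⁻ x, ‖prof 1 g x‖ₑ ^ 2 := by
  rw [lintegral_enorm_prof_sq]; simp [periodNormSq]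

theorem lintegral_enorm_prof_sq_le {p : ℝ} (hp : 1 ≤ p) (g : ℝ → ℂ) :
    ∫⁻ x, ‖prof p g x‖ₑ ^ 2 ≤ periodNormSq g := by
  rw [lintegral_enorm_prof_sq, periodNormSq]
  refine setLIntegral_mono' measurableSet_Ioo fun t ht => ?_
  refine mul_le_of_le_one_left' (ENNReal.ofReal_le_one.2 ?_)
  exact Real.rpow_le_one (Real.sin_pos_of_mem_Ioo ht).le (Real.sin_le_one _) (by linarith)

theorem periodNormSq_sub {g : ℝ → ℂ} (hper : Function.Periodic g π) (θ : ℝ) :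
    periodNormSq (fun t => g (t - θ)) = periodNormSq g := by
  have hF : Function.Periodic (fun t => ‖g t‖ₑ ^ 2) π := fun t => by simp only [hper t]
  exact hF.setLIntegral_sub_eq θ

theorem derivFT_deriv_eq_fourier {f : ℝ → ℂ} (hf : Integrable f) (hd : Differentiable ℝ f)
    (hf' : Integrable (deriv f)) {ξ : ℝ} (hξ : ξ ≠ 0) : derivFT (deriv f) ξ = 𝓕 f ξ := by
  have hc : (2 * π * I * ξ : ℂ) ≠ 0 := by simp [hξ, Real.pi_ne_zero]
  rw [derivFT, Real.fourier_deriv hf hd hf']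
  simp only [smul_eq_mul]
  rw [inv_mul_cancel_left₀ hc]

theorem integrable_prof {p : ℝ} (hp : 1 < p) {g : ℝ → ℂ} (hg : Continuous g)
    (hper : Function.Periodic g π) : Integrable (prof p g) := by
  obtain ⟨M, hM0, hM⟩ := exists_bound_of_periodic hg hper
  exact ((integrable_one_add_sq_rpow hp).const_mul M).mono'
    (continuous_prof p hg).aestronglyMeasurable (ae_of_all _ fun x => norm_prof_le hM x)

theorem memLp_two_prof {p : ℝ} (hp : 1 < p) {g : ℝ → ℂ} (hg : Continuous g)
    (hper : Function.Periodic g π) : MemLp (prof p g) 2 := by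
  obtain ⟨M, hM⟩ := exists_norm_prof_le (by linarith : 0 ≤ p) hg hper
  have hi := integrable_prof hp hg hper
  rw [memLp_two_iff_integrable_sq_norm hi.aestronglyMeasurable]
  have := hi.norm.mul_bdd (g := fun x => ‖prof p g x‖) (c := M)
    hi.norm.aestronglyMeasurable (ae_of_all _ fun x => by rw [norm_norm]; exact hM x)
  simpa [sq] using this

theorem csNormSq_eq_fourier {s p : ℝ} (hp : 1 < p) {g : ℝ → ℂ} (hg : ContDiff ℝ 1 g)
    (hper : Function.Periodic g π) :
    csNormSq s p g = ∫⁻ ξ : ℝ, ENNReal.ofReal (|ξ| ^ (-s)) * ‖𝓕 (prof p g) ξ‖ₑ ^ 2 := by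
  refine lintegral_congr_ae ?_
  filter_upwards [Measure.ae_ne volume (0 : ℝ)] with ξ hξ
  rw [derivFT_deriv_eq_fourier (integrable_prof hp hg.continuous hper)
    (fun x => (hasDerivAt_prof p hg x).differentiableAt)
    (integrable_deriv_prof (by linarith) hg hper) hξ]

theorem periodNormSq_le_csNormSq {g : ℝ → ℂ} (hg : ContDiff ℝ 1 g)
    (hper : Function.Periodic g π) : periodNormSq g ≤ 4 * csNormSq 0 1 g := by
  set w := prof 1 g with hw
  have hwc : Continuous w := continuous_prof 1 hg.continuous
  obtain ⟨M, hM⟩ := exists_norm_prof_le zero_le_one hg.continuous hper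
  have hn : ∀ n : ℕ, ∫⁻ x, ‖w (x + n) - w x‖ₑ ^ 2 ≤ 4 * csNormSq 0 1 g := fun n => by
    rw [lintegral_enorm_translate_sub_sq (hasDerivAt_prof_deriv 1 hg)
      (integrable_deriv_prof one_pos hg hper) hM, csNormSq, ← lintegral_const_mul' _ _ (by simp)]
    refine lintegral_mono fun ξ => ?_
    simp only [neg_zero, Real.rpow_zero, ENNReal.ofReal_one, one_mul]
    gcongr
    calc ‖cexp (2 * π * I * (n : ℝ) * ξ) - 1‖ₑ ^ 2 ≤ 2 ^ 2 := by
          gcongr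
          refine (enorm_sub_le).trans ?_
          rw [← ofReal_norm, Complex.norm_exp]
          norm_num
      _ = 4 := by norm_num
  have hlim : ∀ x, Tendsto (fun n : ℕ => ‖w (x + n) - w x‖ₑ ^ 2) atTop (𝓝 (‖w x‖ₑ ^ 2)) := fun x => by
    have h0 : Tendsto (fun n : ℕ => w (x + n)) atTop (𝓝 0) :=
      (tendsto_prof one_pos hg.continuous hper tendsto_abs_atTop_atTop).comp
        (tendsto_atTop_add_const_left _ x tendsto_natCast_atTop_atTop)
    have h1 := (h0.sub_const (w x)).enorm
    rw [zero_sub, enorm_neg] at h1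
    exact ((ENNReal.continuous_pow 2).tendsto _).comp h1
  rw [periodNormSq_eq]
  calc ∫⁻ x, ‖w x‖ₑ ^ 2 = ∫⁻ x, liminf (fun n : ℕ => ‖w (x + n) - w x‖ₑ ^ 2) atTop := by
        refine lintegral_congr fun x => (hlim x).liminf_eq.symm
    _ ≤ liminf (fun n : ℕ => ∫⁻ x, ‖w (x + n) - w x‖ₑ ^ 2) atTop :=
        lintegral_liminf_le fun n => by
          have : Continuous fun x => w (x + n) - w x := by fun_prop
          exact this.measurable.enorm.pow_const 2
    _ ≤ liminf (fun _ : ℕ => 4 * csNormSq 0 1 g) atTop :=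
        liminf_le_liminf (Eventually.of_forall hn)
    _ = _ := liminf_const _

theorem averageBound_of_forall {s u : ℝ} {C : ℝ≥0∞} (hC : C ≠ ∞)
    (h : ∀ g : ℝ → ℂ, ContDiff ℝ 1 g → Function.Periodic g π → ∀ θ : ℝ,
      csNormSq s (1 + u) (fun t => g (t - θ)) ≤ C * csNormSq s (1 + s) g) : AverageBound s u := by
  refine ⟨C * ENNReal.ofReal (2 * π), ENNReal.mul_ne_top hC ENNReal.ofReal_ne_top,
    fun g hg hper => ?_⟩
  refine (lintegral_mono fun θ => h g hg hper θ).trans ?_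
  rw [lintegral_const, Measure.restrict_apply_univ, Real.volume_Ioc, sub_zero]
  exact le_of_eq (by ring)

theorem ContDiff.comp_sub_const {g : ℝ → ℂ} (hg : ContDiff ℝ 1 g) (θ : ℝ) :
    ContDiff ℝ 1 (fun t => g (t - θ)) := hg.comp (by fun_prop)

theorem averageBound_zero {u : ℝ} (hu : 0 < u) : AverageBound 0 u := by
  refine averageBound_of_forall (C := 4) (by simp) fun g hg hper θ => ?_
  have hpθ := hper.sub_const θ
  have hgθ := hg.comp_sub_const θ
  rw [csNormSq_eq_fourier (by linarith) hgθ hpθ]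
  simp only [neg_zero, Real.rpow_zero, ENNReal.ofReal_one, one_mul, add_zero]
  rw [lintegral_enorm_fourier_sq (integrable_prof (by linarith) hgθ.continuous hpθ)
    (memLp_two_prof (by linarith) hgθ.continuous hpθ)]
  refine (lintegral_enorm_prof_sq_le (by linarith) _).trans ?_
  rw [periodNormSq_sub hper]
  exact periodNormSq_le_csNormSq hg hper

theorem norm_add_sq_le_two_mul (a b : ℂ) : ‖a + b‖ ^ 2 ≤ 2 * ‖a‖ ^ 2 + 2 * ‖b‖ ^ 2 := by
  have := norm_add_le a b
  nlinarith [norm_nonneg (a + b), sq_nonneg (‖a‖ - ‖b‖), norm_nonneg a, norm_nonneg b]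

theorem one_sub_div_sq_mul_rpow_le {σ S T d : ℝ} (h0 : 0 < σ) (h1 : σ < 1) (hT : 0 < T)
    (hTS : T ≤ S) (hd : 0 < d) (hST : S - T ≤ d) :
    (1 - T / S) ^ 2 * d ^ (-1 - σ) ≤ S ^ (-1 - σ) := by
  have hS : 0 < S := hT.trans_le hTS
  have hr0 : 0 ≤ 1 - T / S := by rw [sub_nonneg, div_le_one hS]; exact hTS
  have hr1 : 1 - T / S ≤ 1 := by linarith [div_pos hT hS]
  have e1 : (1 - T / S) ^ 2 ≤ (1 - T / S) ^ (1 + σ) := by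
    rw [← Real.rpow_two]
    exact Real.rpow_le_rpow_of_exponent_ge' hr0 hr1 (by linarith) (by linarith)
  have e2 : (1 - T / S) ^ (1 + σ) ≤ (d / S) ^ (1 + σ) := by
    refine Real.rpow_le_rpow hr0 ?_ (by linarith)
    rw [le_div_iff₀ hS, sub_mul, div_mul_cancel₀ _ hS.ne']; linarith
  calc (1 - T / S) ^ 2 * d ^ (-1 - σ) ≤ (d / S) ^ (1 + σ) * d ^ (-1 - σ) := by
        gcongr; exact e1.trans e2
    _ = S ^ (-1 - σ) := by
        rw [Real.div_rpow hd.le hS.le, div_mul_eq_mul_div, ← Real.rpow_add hd,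
          show 1 + σ + (-1 - σ) = 0 by ring, Real.rpow_zero, one_div, ← Real.rpow_neg hS.le]
        congr 1; ring

theorem norm_rpow_mul_sub_sq_le_of_le {σ p S T d : ℝ} (h0 : 0 < σ) (h1 : σ < 1) (hp : 1 - σ ≤ p)
    (hp2 : p ≤ 2) (hT : 0 < T) (hTS : T ≤ S) (hS1 : S ≤ 1) (hST : S - T ≤ d) (hd : 0 < d) (z w : ℂ) :
    ‖((S ^ p : ℝ) : ℂ) * z - ((T ^ p : ℝ) : ℂ) * w‖ ^ 2 * (d ^ (-1 - σ) * (S * T) ^ (σ - 1))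
      ≤ 2 * (‖z - w‖ ^ 2 * d ^ (-1 - σ))
        + 8 * (‖z‖ ^ 2 * (S ^ (-(σ * (2 - σ))) * T ^ (-(1 - σ + σ ^ 2)))) := by
  have hS : 0 < S := hT.trans_le hTS
  have hp0 : 0 < p := by linarith
  have hr0 : 0 < T / S := div_pos hT hS
  have hr1 : T / S ≤ 1 := (div_le_one hS).2 hTS
  have hsplit : ((S ^ p : ℝ) : ℂ) * z - ((T ^ p : ℝ) : ℂ) * w
      = ((T ^ p : ℝ) : ℂ) * (z - w) + ((S ^ p - T ^ p : ℝ) : ℂ) * z := by push_cast; ring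
  have hW : 0 ≤ d ^ (-1 - σ) * (S * T) ^ (σ - 1) := by positivity
  have hTp : 0 ≤ T ^ p := by positivity
  have hdiff0 : 0 ≤ S ^ p - T ^ p := by
    rw [sub_nonneg]; exact Real.rpow_le_rpow hT.le hTS hp0.le
  have hdiff : S ^ p - T ^ p ≤ 2 * (1 - T / S) * S ^ p := by
    have e : T ^ p = (T / S) ^ p * S ^ p := by
      rw [Real.div_rpow hT.le hS.le, div_mul_cancel₀ _ (by positivity)]
    have e2 : (T / S) ^ 2 ≤ (T / S) ^ p := by
      rw [← Real.rpow_two]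
      exact Real.rpow_le_rpow_of_exponent_ge' hr0.le hr1 hp0.le hp2
    have e3 : 1 - (T / S) ^ p ≤ 2 * (1 - T / S) := by nlinarith
    calc S ^ p - T ^ p = (1 - (T / S) ^ p) * S ^ p := by rw [e]; ring
      _ ≤ _ := by gcongr
  have b1 : (T ^ p) ^ 2 * (S * T) ^ (σ - 1) ≤ 1 := by
    calc (T ^ p) ^ 2 * (S * T) ^ (σ - 1) ≤ (T ^ p) ^ 2 * (T * T) ^ (σ - 1) := by
          gcongr ?_ * ?_
          exact Real.rpow_le_rpow_of_nonpos (by positivity) (by gcongr) (by linarith)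
      _ = T ^ (2 * p + 2 * (σ - 1)) := by
          rw [← Real.rpow_mul_natCast hT.le, ← sq, ← Real.rpow_natCast T 2, ← Real.rpow_mul hT.le,
            ← Real.rpow_add hT]
          congr 1; push_cast; ring
      _ ≤ 1 := Real.rpow_le_one hT.le (hTS.trans hS1) (by linarith)
  have b2 : (S ^ p - T ^ p) ^ 2 * (d ^ (-1 - σ) * (S * T) ^ (σ - 1))
      ≤ 4 * (S ^ (-(σ * (2 - σ))) * T ^ (-(1 - σ + σ ^ 2))) := by
    calc (S ^ p - T ^ p) ^ 2 * (d ^ (-1 - σ) * (S * T) ^ (σ - 1))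
        ≤ (2 * (1 - T / S) * S ^ p) ^ 2 * (d ^ (-1 - σ) * (S * T) ^ (σ - 1)) := by gcongr
      _ = 4 * ((1 - T / S) ^ 2 * d ^ (-1 - σ)) * ((S ^ p) ^ 2 * (S * T) ^ (σ - 1)) := by ring
      _ ≤ 4 * S ^ (-1 - σ) * ((S ^ p) ^ 2 * (S * T) ^ (σ - 1)) := by
          gcongr; exact one_sub_div_sq_mul_rpow_le h0 h1 hT hTS hd hST
      _ = 4 * (S ^ (2 * p - 2) * T ^ (σ - 1)) := by
          rw [← Real.rpow_mul_natCast hS.le, Real.mul_rpow hS.le hT.le,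
            show 2 * p - 2 = (-1 - σ) + p * (2 : ℕ) + (σ - 1) by push_cast; ring, Real.rpow_add hS,
            Real.rpow_add hS]
          ring
      _ ≤ 4 * (S ^ (-(2 * σ)) * T ^ (σ - 1)) := by
          gcongr 4 * (?_ * _)
          exact Real.rpow_le_rpow_of_exponent_ge hS hS1 (by linarith)
      _ = 4 * (S ^ (-(2 * σ)) * (T ^ (σ ^ 2) * T ^ (-(1 - σ + σ ^ 2)))) := by
          rw [← Real.rpow_add hT]; congr 3; ring
      _ ≤ 4 * (S ^ (-(2 * σ)) * (S ^ (σ ^ 2) * T ^ (-(1 - σ + σ ^ 2)))) := by gcongr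
      _ = _ := by
          rw [← mul_assoc (S ^ _), ← Real.rpow_add hS]; congr 3; ring
  calc _ ≤ (2 * ‖((T ^ p : ℝ) : ℂ) * (z - w)‖ ^ 2 + 2 * ‖((S ^ p - T ^ p : ℝ) : ℂ) * z‖ ^ 2)
        * (d ^ (-1 - σ) * (S * T) ^ (σ - 1)) := by
        rw [hsplit]; gcongr; exact norm_add_sq_le_two_mul _ _
    _ = 2 * (‖z - w‖ ^ 2 * d ^ (-1 - σ)) * ((T ^ p) ^ 2 * (S * T) ^ (σ - 1))
        + 2 * ‖z‖ ^ 2 * ((S ^ p - T ^ p) ^ 2 * (d ^ (-1 - σ) * (S * T) ^ (σ - 1))) := by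
        rw [norm_mul, norm_mul, Complex.norm_real, Complex.norm_real, Real.norm_of_nonneg hTp,
          Real.norm_of_nonneg hdiff0]
        ring
    _ ≤ 2 * (‖z - w‖ ^ 2 * d ^ (-1 - σ)) * 1
        + 2 * ‖z‖ ^ 2 * (4 * (S ^ (-(σ * (2 - σ))) * T ^ (-(1 - σ + σ ^ 2)))) := by gcongr
    _ = _ := by ring

theorem norm_rpow_mul_sub_sq_le {σ p S T d : ℝ} (h0 : 0 < σ) (h1 : σ < 1) (hp : 1 - σ ≤ p)
    (hp2 : p ≤ 2) (hS : 0 < S) (hT : 0 < T) (hS1 : S ≤ 1) (hT1 : T ≤ 1) (hST : |S - T| ≤ d)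
    (z w : ℂ) :
    ‖((S ^ p : ℝ) : ℂ) * z - ((T ^ p : ℝ) : ℂ) * w‖ ^ 2 * (d ^ (-1 - σ) * (S * T) ^ (σ - 1))
      ≤ 2 * (‖z - w‖ ^ 2 * d ^ (-1 - σ))
        + 8 * ((‖z‖ ^ 2 + ‖w‖ ^ 2) * (S ^ (-(σ * (2 - σ))) * T ^ (-(1 - σ + σ ^ 2))
          + T ^ (-(σ * (2 - σ))) * S ^ (-(1 - σ + σ ^ 2)))) := by
  obtain hd | hd := (le_trans (abs_nonneg _) hST).eq_or_lt
  · rw [← hd, Real.zero_rpow (by linarith), zero_mul, mul_zero]; positivity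
  · have hA : 0 ≤ S ^ (-(σ * (2 - σ))) * T ^ (-(1 - σ + σ ^ 2)) := by positivity
    have hB : 0 ≤ T ^ (-(σ * (2 - σ))) * S ^ (-(1 - σ + σ ^ 2)) := by positivity
    obtain h | h := le_total T S
    · refine (norm_rpow_mul_sub_sq_le_of_le h0 h1 hp hp2 hT h hS1
        ((le_abs_self _).trans hST) hd z w).trans ?_
      gcongr
      · nlinarith [sq_nonneg ‖w‖]
      · linarith
    · have := norm_rpow_mul_sub_sq_le_of_le h0 h1 hp hp2 hS h hT1
        ((neg_sub S T ▸ neg_le_abs (S - T)).trans hST) hd w z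
      rw [norm_sub_rev, mul_comm T S, norm_sub_rev w z] at this
      refine this.trans ?_
      gcongr
      · nlinarith [sq_nonneg ‖z‖]
      · linarith

theorem norm_sub_sq_le_of_le {σ S T d : ℝ} (h0 : 0 < σ) (h1 : σ < 1) (hT : 0 < T) (hTS : T ≤ S)
    (hST : S - T ≤ d) (hd : 0 < d) (z w : ℂ) :
    ‖z - w‖ ^ 2 * d ^ (-1 - σ)
      ≤ 2 * (‖((S ^ (1 - σ) : ℝ) : ℂ) * z - ((T ^ (1 - σ) : ℝ) : ℂ) * w‖ ^ 2
          * (d ^ (-1 - σ) * (S * T) ^ (σ - 1))) + 2 * (‖w‖ ^ 2 * S ^ (-1 - σ)) := by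
  have hS : 0 < S := hT.trans_le hTS
  set q := 1 - σ with hq
  have hq0 : 0 < q := by linarith
  have hr0 : 0 < T / S := div_pos hT hS
  have hr1 : T / S ≤ 1 := (div_le_one hS).2 hTS
  have hSq : 0 < S ^ q := by positivity
  have hTq : T ^ q = (T / S) ^ q * S ^ q := by
    rw [Real.div_rpow hT.le hS.le, div_mul_cancel₀ _ (by positivity)]
  set D := ((S ^ q : ℝ) : ℂ) * z - ((T ^ q : ℝ) : ℂ) * w with hD
  have hsplit : z - w = (((S ^ q)⁻¹ : ℝ) : ℂ) * D + (((T / S) ^ q - 1 : ℝ) : ℂ) * w := by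
    rw [hD, hTq]
    have : ((S ^ q : ℝ) : ℂ) ≠ 0 := by exact_mod_cast hSq.ne'
    push_cast at this ⊢
    field_simp
    ring
  have e1 : ((S ^ q)⁻¹) ^ 2 ≤ (S * T) ^ (σ - 1) := by
    rw [← Real.rpow_neg hS.le, Real.mul_rpow hS.le hT.le, sq, show -q = σ - 1 by rw [hq]; ring]
    gcongr _ * ?_
    exact Real.rpow_le_rpow_of_nonpos hT hTS (by linarith)
  have e2 : ((T / S) ^ q - 1) ^ 2 ≤ (1 - T / S) ^ 2 := by
    have : T / S ≤ (T / S) ^ q := by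
      simpa using Real.rpow_le_rpow_of_exponent_ge hr0 hr1 (show q ≤ 1 by linarith)
    have h2 : (T / S) ^ q ≤ 1 := Real.rpow_le_one hr0.le hr1 hq0.le
    nlinarith
  calc _ ≤ (2 * ‖(((S ^ q)⁻¹ : ℝ) : ℂ) * D‖ ^ 2 + 2 * ‖(((T / S) ^ q - 1 : ℝ) : ℂ) * w‖ ^ 2)
        * d ^ (-1 - σ) := by
        rw [hsplit]; gcongr; exact norm_add_sq_le_two_mul _ _
    _ = 2 * (‖D‖ ^ 2 * (d ^ (-1 - σ) * ((S ^ q)⁻¹) ^ 2))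
        + 2 * (‖w‖ ^ 2 * (((T / S) ^ q - 1) ^ 2 * d ^ (-1 - σ))) := by
        rw [norm_mul, norm_mul, Complex.norm_real, Complex.norm_real, mul_pow, mul_pow,
          Real.norm_eq_abs, Real.norm_eq_abs, sq_abs, sq_abs]
        ring
    _ ≤ 2 * (‖D‖ ^ 2 * (d ^ (-1 - σ) * (S * T) ^ (σ - 1)))
        + 2 * (‖w‖ ^ 2 * ((1 - T / S) ^ 2 * d ^ (-1 - σ))) := by gcongr
    _ ≤ _ := by gcongr; exact one_sub_div_sq_mul_rpow_le h0 h1 hT hTS hd hST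

theorem norm_sub_sq_le {σ S T d : ℝ} (h0 : 0 < σ) (h1 : σ < 1) (hS : 0 < S) (hT : 0 < T)
    (hST : |S - T| ≤ d) (z w : ℂ) :
    ‖z - w‖ ^ 2 * d ^ (-1 - σ)
      ≤ 2 * (‖((S ^ (1 - σ) : ℝ) : ℂ) * z - ((T ^ (1 - σ) : ℝ) : ℂ) * w‖ ^ 2
          * (d ^ (-1 - σ) * (S * T) ^ (σ - 1)))
        + 2 * (‖w‖ ^ 2 * (if T ≤ S then S ^ (-1 - σ) else 0))
        + 2 * (‖z‖ ^ 2 * (if S ≤ T then T ^ (-1 - σ) else 0)) := by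
  have hA : 0 ≤ if T ≤ S then S ^ (-1 - σ) else 0 := by split_ifs <;> positivity
  have hB : 0 ≤ if S ≤ T then T ^ (-1 - σ) else 0 := by split_ifs <;> positivity
  obtain hd | hd := (le_trans (abs_nonneg _) hST).eq_or_lt
  · rw [← hd, Real.zero_rpow (by linarith), zero_mul, mul_zero]; positivity
  · obtain h | h := le_total T S
    · have := norm_sub_sq_le_of_le h0 h1 hT h ((le_abs_self _).trans hST) hd z w
      rw [if_pos h]
      have h3 := mul_nonneg (sq_nonneg ‖z‖) hB
      linarith
    · have := norm_sub_sq_le_of_le h0 h1 hS h ((neg_sub S T ▸ neg_le_abs (S - T)).trans hST) hd w z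
      rw [norm_sub_rev, mul_comm T S, norm_sub_rev (((T ^ (1 - σ) : ℝ) : ℂ) * w)] at this
      rw [if_pos h]
      have h3 := mul_nonneg (sq_nonneg ‖w‖) hA
      linarith

/-- The Gagliardo form of order `σ / 2` on the line. -/
def gagliardo (σ : ℝ) (f : ℝ → ℂ) : ℝ≥0∞ :=
  ∫⁻ x, ∫⁻ y, ‖f x - f y‖ₑ ^ 2 * ENNReal.ofReal (|x - y| ^ (-1 - σ))

/-- The rotation-invariant analogue of the Gagliardo form on the circle `ℝ / πℤ`. -/
def angularForm (σ : ℝ) (g : ℝ → ℂ) : ℝ≥0∞ :=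
  ∫⁻ θ in Ioo 0 π, ∫⁻ φ in Ioo 0 π,
    ‖g θ - g φ‖ₑ ^ 2 * ENNReal.ofReal (|Real.sin (θ - φ)| ^ (-1 - σ))

theorem enorm_sq_eq_ofReal (z : ℂ) : ‖z‖ₑ ^ 2 = ENNReal.ofReal (‖z‖ ^ 2) := by
  rw [ENNReal.ofReal_pow (norm_nonneg z), ofReal_norm]

theorem Function.Periodic.setLIntegral_sub_left_eq {F : ℝ → ℝ≥0∞} (hF : Function.Periodic F π)
    (θ : ℝ) : ∫⁻ t in Ioo 0 π, F (θ - t) = ∫⁻ t in Ioo 0 π, F t := by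
  have h := (Measure.measurePreserving_sub_left (volume : Measure ℝ) π).setLIntegral_comp_preimage_emb
    (MeasurableEquiv.subLeft π).measurableEmbedding (fun t => F (t - (π - θ))) (Ioo 0 π)
  rw [hF.setLIntegral_sub_eq] at h
  rw [← h]
  rw [show (fun t => π - t) ⁻¹' Ioo 0 π = Ioo 0 π by
    ext t; simp only [mem_preimage, mem_Ioo]; constructor <;> rintro ⟨h1, h2⟩ <;> constructor <;> linarith]
  refine lintegral_congr fun t => ?_
  congr 1; ring

theorem angularForm_sub {σ : ℝ} {g : ℝ → ℂ} (hper : Function.Periodic g π) (θ₀ : ℝ) :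
    angularForm σ (fun t => g (t - θ₀)) = angularForm σ g := by
  have hk : ∀ x : ℝ, |Real.sin (x + π)| = |Real.sin x| := fun x => by
    rw [Real.sin_add_pi, abs_neg]
  have hk' : ∀ x : ℝ, |Real.sin (x - π)| = |Real.sin x| := fun x => by
    rw [Real.sin_sub_pi, abs_neg]
  have h1 : ∀ θ : ℝ, ∫⁻ φ in Ioo 0 π,
      ‖g (θ - θ₀) - g (φ - θ₀)‖ₑ ^ 2 * ENNReal.ofReal (|Real.sin (θ - φ)| ^ (-1 - σ))
      = ∫⁻ φ in Ioo 0 π,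
      ‖g (θ - θ₀) - g φ‖ₑ ^ 2 * ENNReal.ofReal (|Real.sin (θ - θ₀ - φ)| ^ (-1 - σ)) := fun θ => by
    have hF : Function.Periodic (fun φ => ‖g (θ - θ₀) - g φ‖ₑ ^ 2 *
        ENNReal.ofReal (|Real.sin (θ - θ₀ - φ)| ^ (-1 - σ))) π := fun φ => by
      simp only [hper φ]; rw [← sub_sub, hk']
    rw [← hF.setLIntegral_sub_eq θ₀]
    refine lintegral_congr fun φ => ?_
    congr 5; ring
  have hG : Function.Periodic (fun θ => ∫⁻ φ in Ioo 0 π,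
      ‖g θ - g φ‖ₑ ^ 2 * ENNReal.ofReal (|Real.sin (θ - φ)| ^ (-1 - σ))) π := fun θ => by
    simp only [hper θ]
    refine lintegral_congr fun φ => ?_
    rw [show θ + π - φ = θ - φ + π by ring, hk]
  unfold angularForm
  simp only [h1]
  exact hG.setLIntegral_sub_eq θ₀

theorem gagliardo_prof (σ p : ℝ) (g : ℝ → ℂ) :
    gagliardo σ (prof p g) = ∫⁻ θ in Ioo 0 π, ∫⁻ φ in Ioo 0 π,
      ENNReal.ofReal (‖((Real.sin θ ^ p : ℝ) : ℂ) * g θ - ((Real.sin φ ^ p : ℝ) : ℂ) * g φ‖ ^ 2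
        * (|Real.sin (θ - φ)| ^ (-1 - σ) * (Real.sin θ * Real.sin φ) ^ (σ - 1))) := by
  rw [setLIntegral_Ioo_eq_lintegral_arccot, gagliardo]
  refine lintegral_congr fun x => ?_
  rw [setLIntegral_Ioo_eq_lintegral_arccot, ← lintegral_const_mul' _ _ ENNReal.ofReal_ne_top]
  refine lintegral_congr fun y => ?_
  have hx := sin_arccot_pos x
  have hy := sin_arccot_pos y
  rw [← prof_eq, ← prof_eq, enorm_sq_eq_ofReal, ← ENNReal.ofReal_mul (by positivity),
    ← ENNReal.ofReal_mul (by positivity), ← ENNReal.ofReal_mul (by positivity),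
    sin_arccot_sub_arccot, abs_mul, abs_of_pos (mul_pos hx hy), abs_sub_comm y x,
    Real.mul_rpow (abs_nonneg _) (mul_pos hx hy).le]
  congr 1
  have e : (Real.sin (arccot x) * Real.sin (arccot y)) ^ (-1 - σ)
      * (Real.sin (arccot x) * Real.sin (arccot y)) ^ (σ - 1)
      * (Real.sin (arccot x) ^ 2 * Real.sin (arccot y) ^ 2) = 1 := by
    rw [← mul_pow, ← Real.rpow_two, ← Real.rpow_add (mul_pos hx hy), ← Real.rpow_add (mul_pos hx hy)]
    norm_num
  linear_combination (-‖prof p g x - prof p g y‖ ^ 2 * |x - y| ^ (-1 - σ)) * e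

theorem abs_sin_sub_sin_le {θ φ : ℝ} (hθ : θ ∈ Ioo 0 π) (hφ : φ ∈ Ioo 0 π) :
    |Real.sin θ - Real.sin φ| ≤ |Real.sin (θ - φ)| := by
  have h1 := Real.sin_pos_of_mem_Ioo hθ
  have h2 := Real.sin_pos_of_mem_Ioo hφ
  rw [← sq_le_sq, Real.sin_sub]
  have c1 := Real.sin_sq_add_cos_sq θ
  have c2 := Real.sin_sq_add_cos_sq φ
  set a := Real.sin θ
  set b := Real.sin φ
  set c := Real.cos θ
  set d := Real.cos φ
  have hcd : c * d ≤ 1 - a * b := by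
    nlinarith [sq_nonneg (c - d), sq_nonneg (a - b), Real.cos_sub θ φ, Real.cos_le_one (θ - φ)]
  nlinarith [mul_le_mul_of_nonneg_left hcd (mul_pos h1 h2).le]

/-- The integral of a power of the sine over a half period. -/
def sinPowInt (r : ℝ) : ℝ≥0∞ := ∫⁻ t in Ioo 0 π, ENNReal.ofReal (Real.sin t ^ r)

theorem sinPowInt_ne_top {r : ℝ} (hr : -1 < r) : sinPowInt r ≠ ∞ := by
  rw [sinPowInt, setLIntegral_Ioo_eq_lintegral_arccot]
  have h := (integrable_one_add_sq_rpow (show 1 < r + 2 by linarith)).lintegral_lt_top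
  refine ne_of_lt (lt_of_eq_of_lt (lintegral_congr fun x => ?_) h)
  rw [← Real.rpow_two, ofReal_sin_arccot_rpow_mul, sin_arccot_rpow, add_comm 2]

theorem gagliardo_prof_le {σ p : ℝ} (h0 : 0 < σ) (h1 : σ < 1) (hp : 1 - σ ≤ p) (hp2 : p ≤ 2)
    {g : ℝ → ℂ} (hg : Continuous g) :
    gagliardo σ (prof p g) ≤ 2 * angularForm σ g + 16 *
      ((∫⁻ t in Ioo 0 π, ‖g t‖ₑ ^ 2 * ENNReal.ofReal (Real.sin t ^ (-(σ * (2 - σ)))))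
          * sinPowInt (-(1 - σ + σ ^ 2))
        + (∫⁻ t in Ioo 0 π, ‖g t‖ₑ ^ 2 * ENNReal.ofReal (Real.sin t ^ (-(1 - σ + σ ^ 2))))
          * sinPowInt (-(σ * (2 - σ)))) := by
  rw [gagliardo_prof]
  set b := -(σ * (2 - σ))
  set c := -(1 - σ + σ ^ 2)
  have hgm : Measurable g := hg.measurable
  have key : ∀ θ ∈ Ioo 0 π, ∀ φ ∈ Ioo 0 π,
      ENNReal.ofReal (‖((Real.sin θ ^ p : ℝ) : ℂ) * g θ - ((Real.sin φ ^ p : ℝ) : ℂ) * g φ‖ ^ 2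
        * (|Real.sin (θ - φ)| ^ (-1 - σ) * (Real.sin θ * Real.sin φ) ^ (σ - 1)))
      ≤ 2 * (‖g θ - g φ‖ₑ ^ 2 * ENNReal.ofReal (|Real.sin (θ - φ)| ^ (-1 - σ)))
        + 8 * ((‖g θ‖ₑ ^ 2 + ‖g φ‖ₑ ^ 2) *
          (ENNReal.ofReal (Real.sin θ ^ b) * ENNReal.ofReal (Real.sin φ ^ c)
          + ENNReal.ofReal (Real.sin φ ^ b) * ENNReal.ofReal (Real.sin θ ^ c))) := by
    intro θ hθ φ hφ
    have hS := Real.sin_pos_of_mem_Ioo hθ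
    have hT := Real.sin_pos_of_mem_Ioo hφ
    have h := norm_rpow_mul_sub_sq_le h0 h1 hp hp2 hS hT (Real.sin_le_one _) (Real.sin_le_one _)
      (abs_sin_sub_sin_le hθ hφ) (g θ) (g φ)
    refine (ENNReal.ofReal_le_ofReal h).trans (le_of_eq ?_)
    rw [ENNReal.ofReal_add (by positivity) (by positivity),
      ENNReal.ofReal_mul (by positivity), ENNReal.ofReal_mul (by positivity),
      ENNReal.ofReal_mul (by positivity), ENNReal.ofReal_mul (by positivity),
      ENNReal.ofReal_add (by positivity) (by positivity),
      ENNReal.ofReal_add (by positivity) (by positivity),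
      ENNReal.ofReal_mul (by positivity), ENNReal.ofReal_mul (by positivity),
      enorm_sq_eq_ofReal, enorm_sq_eq_ofReal, enorm_sq_eq_ofReal]
    simp only [ENNReal.ofReal_ofNat, b, c]
  calc _ ≤ ∫⁻ θ in Ioo 0 π, ∫⁻ φ in Ioo 0 π,
        (2 * (‖g θ - g φ‖ₑ ^ 2 * ENNReal.ofReal (|Real.sin (θ - φ)| ^ (-1 - σ)))
        + 8 * ((‖g θ‖ₑ ^ 2 + ‖g φ‖ₑ ^ 2) *
          (ENNReal.ofReal (Real.sin θ ^ b) * ENNReal.ofReal (Real.sin φ ^ c)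
          + ENNReal.ofReal (Real.sin φ ^ b) * ENNReal.ofReal (Real.sin θ ^ c)))) :=
        setLIntegral_mono' measurableSet_Ioo fun θ hθ =>
          setLIntegral_mono' measurableSet_Ioo fun φ hφ => key θ hθ φ hφ
    _ = ∫⁻ θ in Ioo 0 π, (2 * (∫⁻ φ in Ioo 0 π,
          ‖g θ - g φ‖ₑ ^ 2 * ENNReal.ofReal (|Real.sin (θ - φ)| ^ (-1 - σ)))
        + 8 * (‖g θ‖ₑ ^ 2 * ENNReal.ofReal (Real.sin θ ^ b) * sinPowInt c
          + ‖g θ‖ₑ ^ 2 * ENNReal.ofReal (Real.sin θ ^ c) * sinPowInt b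
          + (∫⁻ φ in Ioo 0 π, ‖g φ‖ₑ ^ 2 * ENNReal.ofReal (Real.sin φ ^ c))
              * ENNReal.ofReal (Real.sin θ ^ b)
          + (∫⁻ φ in Ioo 0 π, ‖g φ‖ₑ ^ 2 * ENNReal.ofReal (Real.sin φ ^ b))
              * ENNReal.ofReal (Real.sin θ ^ c))) := by
        refine lintegral_congr fun θ => ?_
        rw [lintegral_add_left (by fun_prop), lintegral_const_mul _ (by fun_prop),
          lintegral_const_mul _ (by fun_prop)]
        congr 2
        rw [sinPowInt, sinPowInt, ← lintegral_const_mul _ (by fun_prop),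
          ← lintegral_const_mul _ (by fun_prop), ← lintegral_mul_const _ (by fun_prop),
          ← lintegral_mul_const _ (by fun_prop), ← lintegral_add_left (by fun_prop),
          ← lintegral_add_left (by fun_prop), ← lintegral_add_left (by fun_prop)]
        refine lintegral_congr fun φ => ?_
        ring
    _ = _ := by
        have hm : Measurable fun θ => ∫⁻ φ in Ioo 0 π,
            ‖g θ - g φ‖ₑ ^ 2 * ENNReal.ofReal (|Real.sin (θ - φ)| ^ (-1 - σ)) :=
          Measurable.lintegral_prod_right' (f := fun q : ℝ × ℝ => ‖g q.1 - g q.2‖ₑ ^ 2 *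
            ENNReal.ofReal (|Real.sin (q.1 - q.2)| ^ (-1 - σ))) (by fun_prop)
        rw [lintegral_add_left (by fun_prop), lintegral_const_mul _ (by fun_prop),
          lintegral_const_mul _ (by fun_prop), lintegral_add_left (by fun_prop),
          lintegral_add_left (by fun_prop), lintegral_add_left (by fun_prop),
          lintegral_mul_const _ (by fun_prop), lintegral_mul_const _ (by fun_prop),
          lintegral_const_mul _ (by fun_prop), lintegral_const_mul _ (by fun_prop)]
        rw [← sinPowInt, ← sinPowInt, ← angularForm]
        ring

theorem lintegral_periodNormSq_weight {g : ℝ → ℂ} (hg : Continuous g)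
    (hper : Function.Periodic g π) (r : ℝ) :
    ∫⁻ θ in Ioo 0 π, ∫⁻ t in Ioo 0 π, ‖g (t - θ)‖ₑ ^ 2 * ENNReal.ofReal (Real.sin t ^ r)
      = periodNormSq g * sinPowInt r := by
  have hgm : Measurable g := hg.measurable
  have hF : Function.Periodic (fun t => ‖g t‖ₑ ^ 2) π := fun t => by simp only [hper t]
  rw [lintegral_lintegral_swap (by fun_prop), sinPowInt, ← lintegral_const_mul _ (by fun_prop)]
  refine lintegral_congr fun t => ?_
  rw [lintegral_mul_const _ (by fun_prop), hF.setLIntegral_sub_left_eq t]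
  rfl

theorem lintegral_gagliardo_prof_le {σ p : ℝ} (h0 : 0 < σ) (h1 : σ < 1) (hp : 1 - σ ≤ p)
    (hp2 : p ≤ 2) {g : ℝ → ℂ} (hg : Continuous g) (hper : Function.Periodic g π) :
    ∫⁻ θ in Ioo 0 π, gagliardo σ (prof p (fun t => g (t - θ)))
      ≤ 2 * ENNReal.ofReal π * angularForm σ g
        + 32 * (sinPowInt (-(σ * (2 - σ))) * sinPowInt (-(1 - σ + σ ^ 2))) * periodNormSq g := by
  have hgm : Measurable g := hg.measurable
  have hm : ∀ r : ℝ, Measurable fun θ => ∫⁻ t in Ioo 0 π,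
      ‖g (t - θ)‖ₑ ^ 2 * ENNReal.ofReal (Real.sin t ^ r) := fun r =>
    Measurable.lintegral_prod_right' (f := fun q : ℝ × ℝ => ‖g (q.2 - q.1)‖ₑ ^ 2 *
      ENNReal.ofReal (Real.sin q.2 ^ r)) (by fun_prop)
  have hm1 := hm (-(σ * (2 - σ)))
  have hm2 := hm (-(1 - σ + σ ^ 2))
  have hle := fun θ : ℝ => gagliardo_prof_le h0 h1 hp hp2 (g := fun t => g (t - θ)) (by fun_prop)
  simp only [angularForm_sub hper] at hle
  refine (lintegral_mono hle).trans (le_of_eq ?_)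
  rw [lintegral_add_left (by fun_prop), lintegral_const, Measure.restrict_apply_univ,
    Real.volume_Ioo, sub_zero, lintegral_const_mul _ (by fun_prop),
    lintegral_add_left (by fun_prop), lintegral_mul_const _ (by fun_prop),
    lintegral_mul_const _ (by fun_prop), lintegral_periodNormSq_weight hg hper,
    lintegral_periodNormSq_weight hg hper]
  ring

/-- The weighted `L²` norm in the Hardy inequality of order `σ / 2`. -/
def hardyInt (σ : ℝ) (f : ℝ → ℂ) : ℝ≥0∞ := ∫⁻ x, ‖f x‖ₑ ^ 2 * ENNReal.ofReal (|x| ^ (-σ))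

theorem setLIntegral_Ioc_rpow_sub_one {σ R : ℝ} (h0 : 0 < σ) (hR : 0 ≤ R) :
    ∫⁻ t in Ioc (0:ℝ) R, ENNReal.ofReal (t ^ (σ - 1)) = ENNReal.ofReal (R ^ σ / σ) := by
  have hi := (intervalIntegral.intervalIntegrable_rpow' (show -1 < σ - 1 by linarith)
    (a := 0) (b := R))
  rw [intervalIntegrable_iff_integrableOn_Ioc_of_le hR] at hi
  rw [← ofReal_integral_eq_lintegral_ofReal hi, ← intervalIntegral.integral_of_le hR,
    integral_rpow (Or.inl (by linarith))]
  · rw [sub_add_cancel, Real.zero_rpow h0.ne', sub_zero]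
  · filter_upwards [self_mem_ae_restrict measurableSet_Ioc] with t ht
    exact Real.rpow_nonneg ht.1.le _

theorem hardyInt_prof_lt_top {σ : ℝ} (h0 : 0 < σ) (h1 : σ < 1) {g : ℝ → ℂ} (hg : Continuous g)
    (hper : Function.Periodic g π) : hardyInt σ (prof (1 - σ) g) < ∞ := by
  obtain ⟨M, hM0, hM⟩ := exists_bound_of_periodic hg hper
  set F : ℝ → ℝ≥0∞ := fun t => ENNReal.ofReal ((1 + t ^ 2) ^ (-(1 - σ)) * t ^ (-σ)) with hF
  have hle : hardyInt σ (prof (1 - σ) g) ≤ ∫⁻ x, ENNReal.ofReal (M ^ 2) * F |x| := by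
    refine lintegral_mono fun x => ?_
    simp only [hF]
    rw [enorm_sq_eq_ofReal, ← ENNReal.ofReal_mul (by positivity),
      ← ENNReal.ofReal_mul (by positivity), sq_abs, ← mul_assoc]
    refine ENNReal.ofReal_le_ofReal ?_
    gcongr
    calc ‖prof (1 - σ) g x‖ ^ 2 ≤ (M * (1 + x ^ 2) ^ (-(1 - σ) / 2)) ^ 2 := by
          gcongr; exact norm_prof_le hM x
      _ = _ := by
          rw [mul_pow, ← Real.rpow_mul_natCast (one_add_sq_pos x).le]; congr 2; push_cast; ring
  refine hle.trans_lt ?_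
  rw [lintegral_const_mul' _ _ ENNReal.ofReal_ne_top]
  refine ENNReal.mul_lt_top ENNReal.ofReal_lt_top ?_
  rw [lintegral_comp_abs_eq_two_mul]
  refine ENNReal.mul_lt_top (by simp) ?_
  rw [← Ioc_union_Ioi_eq_Ioi (zero_le_one' ℝ)]
  refine (lintegral_union_le _ _ _).trans_lt (ENNReal.add_lt_top.2 ⟨?_, ?_⟩)
  · refine (setLIntegral_mono' measurableSet_Ioc fun t ht => ENNReal.ofReal_le_ofReal ?_).trans_lt
      (setLIntegral_rpow_Ioc_lt_top (show -1 < -σ by linarith) zero_le_one)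
    refine mul_le_of_le_one_left (Real.rpow_nonneg ht.1.le _) ?_
    exact Real.rpow_le_one_of_one_le_of_nonpos (by nlinarith [sq_nonneg t]) (by linarith)
  · refine (setLIntegral_mono' measurableSet_Ioi fun t ht => ENNReal.ofReal_le_ofReal ?_).trans_lt
      (setLIntegral_rpow_Ioi_lt_top (show -2 + σ < -1 by linarith) zero_lt_one)
    have ht0 : 0 < t := zero_lt_one.trans ht
    calc (1 + t ^ 2) ^ (-(1 - σ)) * t ^ (-σ) ≤ (t ^ 2) ^ (-(1 - σ)) * t ^ (-σ) := by
          gcongr ?_ * _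
          exact Real.rpow_le_rpow_of_nonpos (by positivity) (by linarith) (by linarith)
      _ = t ^ (-2 + σ) := by
          rw [← Real.rpow_natCast t 2, ← Real.rpow_mul ht0.le, ← Real.rpow_add ht0]
          congr 1; push_cast; ring

theorem hardyInt_comp_mul_left (σ : ℝ) (f : ℝ → ℂ) {r : ℝ} (hr : 0 < r) :
    ∫⁻ x, ‖f (r * x)‖ₑ ^ 2 * ENNReal.ofReal (|x| ^ (-σ))
      = ENNReal.ofReal (r ^ (σ - 1)) * hardyInt σ f := by
  have h := lintegral_comp_mul_left_eq (fun x => ‖f x‖ₑ ^ 2 * ENNReal.ofReal (|x| ^ (-σ))) hr.ne'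
  rw [hardyInt, Real.rpow_sub_one hr.ne', div_eq_mul_inv, ENNReal.ofReal_mul (by positivity),
    mul_assoc, ← abs_of_pos (inv_pos.2 hr), ← h, ← lintegral_const_mul' _ _ ENNReal.ofReal_ne_top]
  refine lintegral_congr fun x => ?_
  rw [abs_mul, abs_of_pos hr, Real.mul_rpow hr.le (abs_nonneg _),
    ENNReal.ofReal_mul (by positivity)]
  have : ENNReal.ofReal (r ^ σ) * ENNReal.ofReal (r ^ (-σ)) = 1 := by
    rw [← ENNReal.ofReal_mul (by positivity), ← Real.rpow_add hr]; simp
  calc ‖f (r * x)‖ₑ ^ 2 * ENNReal.ofReal (|x| ^ (-σ))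
      = ENNReal.ofReal (r ^ σ) * ENNReal.ofReal (r ^ (-σ))
        * (‖f (r * x)‖ₑ ^ 2 * ENNReal.ofReal (|x| ^ (-σ))) := by rw [this, one_mul]
    _ = _ := by ring

theorem enorm_sq_le_two_mul_sub (a b : ℂ) : ‖a‖ₑ ^ 2 ≤ 2 * ‖a - b‖ₑ ^ 2 + 2 * ‖b‖ₑ ^ 2 := by
  have h := norm_add_sq_le_two_mul (a - b) b
  rw [sub_add_cancel] at h
  simp only [enorm_sq_eq_ofReal]
  refine (ENNReal.ofReal_le_ofReal h).trans (le_of_eq ?_)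
  rw [ENNReal.ofReal_add (by positivity) (by positivity), ENNReal.ofReal_mul (by positivity),
    ENNReal.ofReal_mul (by positivity), ENNReal.ofReal_ofNat]

/-- The fractional Hardy inequality, for functions whose weighted norm is known to be finite. -/
theorem exists_hardyInt_le_gagliardo {σ : ℝ} (h0 : 0 < σ) (h1 : σ < 1) :
    ∃ C : ℝ≥0∞, C ≠ ∞ ∧ ∀ f : ℝ → ℂ, Continuous f → hardyInt σ f < ∞ →
      hardyInt σ f ≤ C * gagliardo σ f := by
  set L : ℝ := 4 ^ (1 / (1 - σ)) with hL
  have hL0 : 0 < L := by positivity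
  have hL1 : 1 < L := Real.one_lt_rpow (by norm_num) (by apply one_div_pos.2; linarith)
  have hLσ : ∀ r ∈ Ioc L (2 * L), 4 * r ^ (σ - 1) ≤ 1 := fun r hr => by
    have : r ^ (σ - 1) ≤ L ^ (σ - 1) :=
      Real.rpow_le_rpow_of_nonpos hL0 hr.1.le (by linarith)
    have e : L ^ (σ - 1) = 1 / 4 := by
      rw [hL, ← Real.rpow_mul (by norm_num), show 1 / (1 - σ) * (σ - 1) = -1 by
        have : 1 - σ ≠ 0 := by linarith
        field_simp; ring, Real.rpow_neg_one]
      norm_num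
    linarith
  refine ⟨4 * (ENNReal.ofReal L)⁻¹ * ENNReal.ofReal ((2 * L) ^ (1 + σ)), ?_, fun f hf hfin => ?_⟩
  · refine ENNReal.mul_ne_top (ENNReal.mul_ne_top (by simp) ?_) ENNReal.ofReal_ne_top
    simpa using hL0
  have hfm := hf.measurable
  have hr : ∀ r ∈ Ioc L (2 * L), hardyInt σ f
      ≤ 4 * ∫⁻ x, ‖f x - f (r * x)‖ₑ ^ 2 * ENNReal.ofReal (|x| ^ (-σ)) := by
    intro r hr
    have hr0 : 0 < r := hL0.trans hr.1
    have key : 2 * hardyInt σ f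
        ≤ 4 * (∫⁻ x, ‖f x - f (r * x)‖ₑ ^ 2 * ENNReal.ofReal (|x| ^ (-σ))) + hardyInt σ f := by
      calc 2 * hardyInt σ f ≤ ∫⁻ x, (4 * (‖f x - f (r * x)‖ₑ ^ 2 * ENNReal.ofReal (|x| ^ (-σ)))
            + 4 * (‖f (r * x)‖ₑ ^ 2 * ENNReal.ofReal (|x| ^ (-σ)))) := by
            rw [hardyInt, ← lintegral_const_mul' _ _ (by simp)]
            refine lintegral_mono fun x => ?_
            have := mul_le_mul_right (mul_le_mul_left (enorm_sq_le_two_mul_sub (f x) (f (r * x)))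
              (ENNReal.ofReal (|x| ^ (-σ)))) 2
            refine this.trans (le_of_eq ?_)
            ring
        _ = 4 * (∫⁻ x, ‖f x - f (r * x)‖ₑ ^ 2 * ENNReal.ofReal (|x| ^ (-σ)))
            + 4 * (ENNReal.ofReal (r ^ (σ - 1)) * hardyInt σ f) := by
            rw [lintegral_add_left (by fun_prop), lintegral_const_mul _ (by fun_prop),
              lintegral_const_mul _ (by fun_prop), hardyInt_comp_mul_left σ f hr0]
        _ ≤ _ := by
            gcongr
            rw [← mul_assoc]
            refine mul_le_of_le_one_left' ?_
            rw [← ENNReal.ofReal_ofNat, ← ENNReal.ofReal_mul (by norm_num)]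
            exact ENNReal.ofReal_le_one.2 (hLσ r hr)
    rw [two_mul] at key
    exact (ENNReal.add_le_add_iff_right hfin.ne).1 key
  have hint : ENNReal.ofReal L * hardyInt σ f ≤ 4 * (ENNReal.ofReal ((2 * L) ^ (1 + σ)) * gagliardo σ f) := by
    calc ENNReal.ofReal L * hardyInt σ f = ∫⁻ _ in Ioc L (2 * L), hardyInt σ f := by
          rw [lintegral_const, Measure.restrict_apply_univ, Real.volume_Ioc, mul_comm]
          congr 2; ring
      _ ≤ ∫⁻ r in Ioc L (2 * L), 4 * ∫⁻ x, ‖f x - f (r * x)‖ₑ ^ 2 * ENNReal.ofReal (|x| ^ (-σ)) :=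
          setLIntegral_mono' measurableSet_Ioc hr
      _ = 4 * ∫⁻ x, ∫⁻ r in Ioc L (2 * L), ‖f x - f (r * x)‖ₑ ^ 2 * ENNReal.ofReal (|x| ^ (-σ)) := by
          rw [lintegral_const_mul' _ _ (by simp), lintegral_lintegral_swap (by fun_prop)]
      _ ≤ _ := by
          gcongr
          rw [gagliardo, ← lintegral_const_mul' _ _ ENNReal.ofReal_ne_top]
          refine lintegral_mono_ae ?_
          filter_upwards [Measure.ae_ne volume (0 : ℝ)] with x hx
          have hx0 : 0 < |x| := abs_pos.2 hx
          calc ∫⁻ r in Ioc L (2 * L), ‖f x - f (r * x)‖ₑ ^ 2 * ENNReal.ofReal (|x| ^ (-σ))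
              ≤ ∫⁻ r in Ioc L (2 * L), ENNReal.ofReal ((2 * L) ^ (1 + σ)) * (ENNReal.ofReal |x| *
                (‖f x - f (x * r)‖ₑ ^ 2 * ENNReal.ofReal (|x - x * r| ^ (-1 - σ)))) := by
                refine setLIntegral_mono' measurableSet_Ioc fun r hr => ?_
                have hr1 : 0 < r - 1 := by linarith [hr.1]
                have e : |x - x * r| = |x| * (r - 1) := by
                  rw [show x - x * r = -(x * (r - 1)) by ring, abs_neg, abs_mul, abs_of_pos hr1]
                have hk : |x| ^ (-σ) ≤ (2 * L) ^ (1 + σ) * (|x| * |x - x * r| ^ (-1 - σ)) := by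
                  rw [e, Real.mul_rpow hx0.le hr1.le]
                  have e1 : |x| ^ (-σ) = |x| * |x| ^ (-1 - σ) := by
                    rw [show -σ = 1 + (-1 - σ) by ring, Real.rpow_add hx0, Real.rpow_one]
                  have e2 : 1 ≤ (2 * L) ^ (1 + σ) * (r - 1) ^ (-1 - σ) := by
                    calc 1 = (2 * L) ^ (1 + σ) * (2 * L) ^ (-1 - σ) := by
                          rw [← Real.rpow_add (by positivity)]; simp
                      _ ≤ _ := by
                          gcongr _ * ?_
                          exact Real.rpow_le_rpow_of_nonpos hr1 (by linarith [hr.2]) (by linarith)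
                  rw [e1]
                  calc |x| * |x| ^ (-1 - σ) = |x| * |x| ^ (-1 - σ) * 1 := by ring
                    _ ≤ |x| * |x| ^ (-1 - σ) * ((2 * L) ^ (1 + σ) * (r - 1) ^ (-1 - σ)) := by gcongr
                    _ = _ := by ring
                rw [mul_comm r x]
                have hk2 := ENNReal.ofReal_le_ofReal hk
                rw [ENNReal.ofReal_mul (by positivity), ENNReal.ofReal_mul (by positivity)] at hk2
                refine (mul_le_mul_right hk2 _).trans (le_of_eq ?_)
                ring
            _ ≤ ∫⁻ r, ENNReal.ofReal ((2 * L) ^ (1 + σ)) * (ENNReal.ofReal |x| *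
                (‖f x - f (x * r)‖ₑ ^ 2 * ENNReal.ofReal (|x - x * r| ^ (-1 - σ)))) :=
                setLIntegral_le_lintegral _ _
            _ = _ := by
                rw [lintegral_const_mul' _ _ ENNReal.ofReal_ne_top,
                  lintegral_const_mul' _ _ ENNReal.ofReal_ne_top,
                  lintegral_comp_mul_left_eq
                    (fun y => ‖f x - f y‖ₑ ^ 2 * ENNReal.ofReal (|x - y| ^ (-1 - σ))) hx,
                  ← mul_assoc (ENNReal.ofReal |x|), ← ENNReal.ofReal_mul hx0.le, ← abs_mul,
                  mul_inv_cancel₀ hx, abs_one, ENNReal.ofReal_one, one_mul]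
  have hLne : ENNReal.ofReal L ≠ 0 := by simpa using hL0
  calc hardyInt σ f = (ENNReal.ofReal L)⁻¹ * (ENNReal.ofReal L * hardyInt σ f) := by
        rw [← mul_assoc, ENNReal.inv_mul_cancel hLne ENNReal.ofReal_ne_top, one_mul]
    _ ≤ (ENNReal.ofReal L)⁻¹ * (4 * (ENNReal.ofReal ((2 * L) ^ (1 + σ)) * gagliardo σ f)) := by gcongr
    _ = _ := by ring

theorem rpow_sin_arccot_mul_le {σ y : ℝ} (h0 : 0 < σ) (hy : y ≠ 0) :
    Real.sin (arccot y) ^ (2 * σ) * |y| ^ σ ≤ |y| ^ (-σ) := by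
  have hy' : 0 < |y| := abs_pos.2 hy
  have e : Real.sin (arccot y) ^ (2 * σ) ≤ |y| ^ (-(2 * σ)) := by
    rw [sin_arccot_rpow]
    calc (1 + y ^ 2) ^ (-(2 * σ) / 2) ≤ (|y| ^ 2) ^ (-(2 * σ) / 2) := by
          rw [sq_abs]
          exact Real.rpow_le_rpow_of_nonpos (by positivity) (by linarith) (by linarith)
      _ = _ := by
          rw [← Real.rpow_natCast, ← Real.rpow_mul hy'.le]; congr 1; push_cast; ring
  calc _ ≤ |y| ^ (-(2 * σ)) * |y| ^ σ := by gcongr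
    _ = _ := by rw [← Real.rpow_add hy']; congr 1; ring

theorem enorm_sq_mul_sin_arccot {σ : ℝ} (g : ℝ → ℂ) (y : ℝ) :
    ENNReal.ofReal (Real.sin (arccot y) ^ 2) * ‖g (arccot y)‖ₑ ^ 2
      = ‖prof (1 - σ) g y‖ₑ ^ 2 * ENNReal.ofReal (Real.sin (arccot y) ^ (2 * σ)) := by
  have h : ENNReal.ofReal (Real.sin (arccot y) ^ 2)
      = ENNReal.ofReal (Real.sin (arccot y) ^ (2 * (1 - σ)))
        * ENNReal.ofReal (Real.sin (arccot y) ^ (2 * σ)) := by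
    rw [ofReal_sin_arccot_rpow_mul, ← Real.rpow_two]; congr 2; ring
  rw [enorm_prof_sq, h]; ring

theorem sin_arccot_le_one_rpow {σ y : ℝ} (h0 : 0 < σ) (hy : y ≠ 0) :
    Real.sin (arccot y) ^ (2 * σ) ≤ |y| ^ (-σ) := by
  have hy' : 0 < |y| := abs_pos.2 hy
  have h := rpow_sin_arccot_mul_le (σ := σ / 2) (by linarith) hy
  have hs := sin_arccot_pos y
  have hs1 := Real.sin_le_one (arccot y)
  calc Real.sin (arccot y) ^ (2 * σ) ≤ Real.sin (arccot y) ^ (2 * (σ / 2)) :=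
        Real.rpow_le_rpow_of_exponent_ge hs hs1 (by linarith)
    _ = (Real.sin (arccot y) ^ (2 * (σ / 2)) * |y| ^ (σ / 2)) * |y| ^ (-(σ / 2)) := by
        rw [mul_assoc, ← Real.rpow_add hy']; simp
    _ ≤ |y| ^ (-(σ / 2)) * |y| ^ (-(σ / 2)) := by gcongr
    _ = _ := by rw [← Real.rpow_add hy']; congr 1; ring

theorem periodNormSq_le_hardyInt {σ : ℝ} (h0 : 0 < σ) (g : ℝ → ℂ) :
    periodNormSq g ≤ hardyInt σ (prof (1 - σ) g) := by
  rw [periodNormSq, setLIntegral_Ioo_eq_lintegral_arccot, hardyInt]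
  refine lintegral_mono_ae ?_
  filter_upwards [Measure.ae_ne volume (0 : ℝ)] with y hy
  rw [enorm_sq_mul_sin_arccot (σ := σ)]
  gcongr
  exact sin_arccot_le_one_rpow h0 hy

theorem abs_le_abs_of_sin_arccot_le {x y : ℝ}
    (h : Real.sin (arccot y) ≤ Real.sin (arccot x)) : |x| ≤ |y| := by
  by_contra! hxy
  refine absurd h (not_le.2 ?_)
  rw [sin_arccot, sin_arccot]
  exact Real.rpow_lt_rpow_of_neg (one_add_sq_pos y) (by linarith [sq_lt_sq.2 hxy]) (by norm_num)

/-- The singular kernel of the sine, restricted to angles `φ` closer to the centre than `θ`. -/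
def innerSinKernel (σ θ φ : ℝ) : ℝ≥0∞ :=
  ENNReal.ofReal (if Real.sin θ ≤ Real.sin φ then Real.sin φ ^ (-1 - σ) else 0)

/-- The part of the singular integral of the sine over angles closer to the centre. -/
def innerSinInt (σ θ : ℝ) : ℝ≥0∞ :=
  ∫⁻ φ in Ioo 0 π, innerSinKernel σ θ φ

@[fun_prop]
theorem Measurable.innerSinKernel {α : Type*} [MeasurableSpace α] (σ : ℝ) {a b : α → ℝ}
    (ha : Measurable a) (hb : Measurable b) :
    Measurable fun x => innerSinKernel σ (a x) (b x) :=
  (Measurable.ite (measurableSet_le (by fun_prop) (by fun_prop))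
    (by fun_prop) measurable_const).ennreal_ofReal

theorem innerSinInt_arccot_le {σ : ℝ} (h0 : 0 < σ) (h1 : σ < 1) (y : ℝ) :
    innerSinInt σ (arccot y) ≤ 2 * ENNReal.ofReal (|y| ^ σ / σ) := by
  simp only [innerSinInt, innerSinKernel]
  rw [setLIntegral_Ioo_eq_lintegral_arccot]
  calc _ ≤ ∫⁻ x : ℝ, (Iic |y|).indicator (fun t : ℝ => ENNReal.ofReal (t ^ (σ - 1))) |x| := by
        refine lintegral_mono_ae ?_
        filter_upwards [Measure.ae_ne volume (0 : ℝ)] with x hx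
        have hx' : 0 < |x| := abs_pos.2 hx
        split_ifs with h
        · rw [indicator_of_mem (by exact abs_le_abs_of_sin_arccot_le h), ← Real.rpow_two,
            ofReal_sin_arccot_rpow_mul, sin_arccot_rpow]
          refine ENNReal.ofReal_le_ofReal ?_
          calc (1 + x ^ 2) ^ (-(2 + (-1 - σ)) / 2) ≤ (|x| ^ 2) ^ (-(2 + (-1 - σ)) / 2) := by
                rw [sq_abs]
                exact Real.rpow_le_rpow_of_nonpos (by positivity) (by linarith) (by linarith)
            _ = _ := by
                rw [← Real.rpow_natCast, ← Real.rpow_mul hx'.le]; congr 1; push_cast; ring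
        · simp
    _ = _ := by
        rw [lintegral_comp_abs_eq_two_mul, setLIntegral_indicator measurableSet_Iic, Iic_inter_Ioi,
          setLIntegral_Ioc_rpow_sub_one h0 (abs_nonneg y)]

theorem lintegral_innerSinInt_le {σ : ℝ} (h0 : 0 < σ) (h1 : σ < 1) (g : ℝ → ℂ) :
    ∫⁻ θ in Ioo 0 π, ‖g θ‖ₑ ^ 2 * innerSinInt σ θ
      ≤ 2 * ENNReal.ofReal σ⁻¹ * hardyInt σ (prof (1 - σ) g) := by
  rw [setLIntegral_Ioo_eq_lintegral_arccot, hardyInt,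
    ← lintegral_const_mul' _ _ (ENNReal.mul_ne_top (by simp) ENNReal.ofReal_ne_top)]
  refine lintegral_mono_ae ?_
  filter_upwards [Measure.ae_ne volume (0 : ℝ)] with y hy
  rw [← mul_assoc, enorm_sq_mul_sin_arccot (σ := σ)]
  calc _ ≤ ‖prof (1 - σ) g y‖ₑ ^ 2 * ENNReal.ofReal (Real.sin (arccot y) ^ (2 * σ))
        * (2 * ENNReal.ofReal (|y| ^ σ / σ)) := by
        gcongr; exact innerSinInt_arccot_le h0 h1 y
    _ = 2 * ENNReal.ofReal σ⁻¹ * (‖prof (1 - σ) g y‖ₑ ^ 2 *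
          ENNReal.ofReal (Real.sin (arccot y) ^ (2 * σ) * |y| ^ σ)) := by
        have hs := sin_arccot_pos y
        rw [div_eq_mul_inv, ENNReal.ofReal_mul (by positivity), ENNReal.ofReal_mul (by positivity)]
        ring
    _ ≤ _ := by
        gcongr
        exact rpow_sin_arccot_mul_le h0 hy

/-- The integrand of the singular quadratic form of `prof (1 - σ) g` in the angular variables. -/
def profKernel (σ : ℝ) (g : ℝ → ℂ) (θ φ : ℝ) : ℝ≥0∞ :=
  ENNReal.ofReal
    (‖((Real.sin θ ^ (1 - σ) : ℝ) : ℂ) * g θ - ((Real.sin φ ^ (1 - σ) : ℝ) : ℂ) * g φ‖ ^ 2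
      * (|Real.sin (θ - φ)| ^ (-1 - σ) * (Real.sin θ * Real.sin φ) ^ (σ - 1)))

theorem Measurable.profKernel {α : Type*} [MeasurableSpace α] (σ : ℝ) {g : ℝ → ℂ}
    (hg : Measurable g) {a b : α → ℝ} (ha : Measurable a) (hb : Measurable b) :
    Measurable fun x => profKernel σ g (a x) (b x) := by
  unfold _root_.profKernel
  fun_prop

theorem enorm_sub_sq_mul_le {σ : ℝ} (h0 : 0 < σ) (h1 : σ < 1) (g : ℝ → ℂ) {θ φ : ℝ}
    (hθ : θ ∈ Ioo 0 π) (hφ : φ ∈ Ioo 0 π) :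
    ‖g θ - g φ‖ₑ ^ 2 * ENNReal.ofReal (|Real.sin (θ - φ)| ^ (-1 - σ))
      ≤ 2 * profKernel σ g θ φ + 2 * (‖g φ‖ₑ ^ 2 * innerSinKernel σ φ θ)
        + 2 * (‖g θ‖ₑ ^ 2 * innerSinKernel σ θ φ) := by
  have hS := Real.sin_pos_of_mem_Ioo hθ
  have hT := Real.sin_pos_of_mem_Ioo hφ
  have h := norm_sub_sq_le h0 h1 hS hT (abs_sin_sub_sin_le hθ hφ) (g θ) (g φ)
  have hA : 0 ≤ if Real.sin φ ≤ Real.sin θ then Real.sin θ ^ (-1 - σ) else 0 := by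
    split_ifs <;> positivity
  have hB : 0 ≤ if Real.sin θ ≤ Real.sin φ then Real.sin φ ^ (-1 - σ) else 0 := by
    split_ifs <;> positivity
  rw [enorm_sq_eq_ofReal, ← ENNReal.ofReal_mul (by positivity)]
  refine (ENNReal.ofReal_le_ofReal h).trans (le_of_eq ?_)
  rw [ENNReal.ofReal_add (by positivity) (by positivity),
    ENNReal.ofReal_add (by positivity) (by positivity), ENNReal.ofReal_mul zero_le_two,
    ENNReal.ofReal_mul zero_le_two, ENNReal.ofReal_mul zero_le_two,
    ENNReal.ofReal_mul (p := ‖g φ‖ ^ 2) (by positivity),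
    ENNReal.ofReal_mul (p := ‖g θ‖ ^ 2) (by positivity)]
  simp only [ENNReal.ofReal_ofNat, profKernel, innerSinKernel, enorm_sq_eq_ofReal]

theorem lintegral_enorm_sq_mul_innerSinKernel (σ : ℝ) {g : ℝ → ℂ} (hg : Measurable g) :
    ∫⁻ θ in Ioo 0 π, ∫⁻ φ in Ioo 0 π, ‖g φ‖ₑ ^ 2 * innerSinKernel σ φ θ
      = ∫⁻ θ in Ioo 0 π, ‖g θ‖ₑ ^ 2 * innerSinInt σ θ := by
  rw [lintegral_lintegral_swap
    (f := fun θ φ => ‖g φ‖ₑ ^ 2 * innerSinKernel σ φ θ) (Measurable.aemeasurable (by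
      change Measurable fun q : ℝ × ℝ => ‖g q.2‖ₑ ^ 2 * innerSinKernel σ q.2 q.1
      fun_prop))]
  refine lintegral_congr fun φ => ?_
  rw [lintegral_const_mul _ (by fun_prop)]
  rfl

theorem lintegral_three_term {α : Type*} [MeasurableSpace α] {ν : Measure α} {a b c : α → ℝ≥0∞}
    (ha : Measurable a) (hb : Measurable b) (hc : Measurable c) :
    ∫⁻ x, (2 * a x + 2 * b x + 2 * c x) ∂ν
      = 2 * (∫⁻ x, a x ∂ν) + 2 * (∫⁻ x, b x ∂ν) + 2 * ∫⁻ x, c x ∂ν := by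
  rw [lintegral_add_left (by fun_prop), lintegral_add_left (by fun_prop),
    lintegral_const_mul _ ha, lintegral_const_mul _ hb, lintegral_const_mul _ hc]

theorem angularForm_le {σ : ℝ} (h0 : 0 < σ) (h1 : σ < 1) {g : ℝ → ℂ} (hg : Continuous g) :
    angularForm σ g ≤ 2 * gagliardo σ (prof (1 - σ) g)
      + 8 * ENNReal.ofReal σ⁻¹ * hardyInt σ (prof (1 - σ) g) := by
  have hgm := hg.measurable
  have hmκ : Measurable (innerSinInt σ) :=
    Measurable.lintegral_prod_right' (f := fun q : ℝ × ℝ => innerSinKernel σ q.1 q.2) (by fun_prop)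
  have i1 : ∀ θ, ∫⁻ φ in Ioo 0 π, (2 * profKernel σ g θ φ
      + 2 * (‖g φ‖ₑ ^ 2 * innerSinKernel σ φ θ) + 2 * (‖g θ‖ₑ ^ 2 * innerSinKernel σ θ φ))
      = 2 * (∫⁻ φ in Ioo 0 π, profKernel σ g θ φ)
        + 2 * (∫⁻ φ in Ioo 0 π, ‖g φ‖ₑ ^ 2 * innerSinKernel σ φ θ)
        + 2 * (‖g θ‖ₑ ^ 2 * innerSinInt σ θ) := fun θ => by
    have a1 : Measurable fun φ => profKernel σ g θ φ :=
      hgm.profKernel σ measurable_const measurable_id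
    rw [lintegral_three_term a1 (by fun_prop)
      (by fun_prop), lintegral_const_mul _ (by fun_prop)]
    rfl
  have m1 : Measurable fun θ => ∫⁻ φ in Ioo 0 π, profKernel σ g θ φ :=
    Measurable.lintegral_prod_right' (f := fun q : ℝ × ℝ => profKernel σ g q.1 q.2)
      (hgm.profKernel σ measurable_fst measurable_snd)
  have m2 : Measurable fun θ => ∫⁻ φ in Ioo 0 π, ‖g φ‖ₑ ^ 2 * innerSinKernel σ φ θ :=
    Measurable.lintegral_prod_right' (f := fun q : ℝ × ℝ => ‖g q.2‖ₑ ^ 2 * innerSinKernel σ q.2 q.1)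
      (by fun_prop)
  calc angularForm σ g ≤ ∫⁻ θ in Ioo 0 π, ∫⁻ φ in Ioo 0 π, (2 * profKernel σ g θ φ
        + 2 * (‖g φ‖ₑ ^ 2 * innerSinKernel σ φ θ) + 2 * (‖g θ‖ₑ ^ 2 * innerSinKernel σ θ φ)) :=
        setLIntegral_mono' measurableSet_Ioo fun θ hθ =>
          setLIntegral_mono' measurableSet_Ioo fun φ hφ => enorm_sub_sq_mul_le h0 h1 g hθ hφ
    _ = 2 * (∫⁻ θ in Ioo 0 π, ∫⁻ φ in Ioo 0 π, profKernel σ g θ φ)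
        + 2 * (∫⁻ θ in Ioo 0 π, ∫⁻ φ in Ioo 0 π, ‖g φ‖ₑ ^ 2 * innerSinKernel σ φ θ)
        + 2 * (∫⁻ θ in Ioo 0 π, ‖g θ‖ₑ ^ 2 * innerSinInt σ θ) := by
        simp only [i1]
        exact lintegral_three_term m1 m2 (by fun_prop)
    _ = 2 * gagliardo σ (prof (1 - σ) g) + 4 * (∫⁻ θ in Ioo 0 π, ‖g θ‖ₑ ^ 2 * innerSinInt σ θ) := by
        rw [lintegral_enorm_sq_mul_innerSinKernel σ hgm, gagliardo_prof]
        simp only [profKernel]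
        ring
    _ ≤ 2 * gagliardo σ (prof (1 - σ) g)
        + 4 * (2 * ENNReal.ofReal σ⁻¹ * hardyInt σ (prof (1 - σ) g)) := by
        gcongr; exact lintegral_innerSinInt_le h0 h1 g
    _ = _ := by ring

theorem gagliardo_prof_eq {σ p : ℝ} (hp : 0 < p) {g : ℝ → ℂ} (hg : ContDiff ℝ 1 g)
    (hper : Function.Periodic g π) :
    gagliardo σ (prof p g) = gagliardoConst σ * csNormSq (-σ) p g := by
  obtain ⟨M, hM⟩ := exists_norm_prof_le hp.le hg.continuous hper
  rw [gagliardo, lintegral_gagliardo_eq (hasDerivAt_prof_deriv p hg)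
    (integrable_deriv_prof hp hg hper) hM, csNormSq, neg_neg]

theorem averageBound_of_Ioo {s u : ℝ} {C : ℝ≥0∞} (hC : C ≠ ∞)
    (h : ∀ g : ℝ → ℂ, ContDiff ℝ 1 g → Function.Periodic g π →
      ∫⁻ θ in Ioo 0 π, csNormSq s (1 + u) (fun t => g (t - θ)) ≤ C * csNormSq s (1 + s) g) :
    AverageBound s u := by
  refine ⟨2 * C, ENNReal.mul_ne_top (by simp) hC, fun g hg hper => ?_⟩
  set N : ℝ → ℝ≥0∞ := fun θ => csNormSq s (1 + u) (fun t => g (t - θ)) with hN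
  have hNper : Function.Periodic N π := fun θ => by
    simp only [hN]; congr 1; ext t
    rw [← hper (t - (θ + π))]; congr 1; ring
  have hu : Ioc 0 (2 * π) = Ioc 0 π ∪ Ioc π (2 * π) :=
    (Ioc_union_Ioc_eq_Ioc Real.pi_pos.le (by linarith [Real.pi_pos])).symm
  have h2 : ∫⁻ θ in Ioc π (2 * π), N θ = ∫⁻ θ in Ioc 0 π, N θ := by
    have := (measurePreserving_add_right (volume : Measure ℝ) π).setLIntegral_comp_preimage_emb
      (MeasurableEquiv.addRight π).measurableEmbedding N (Ioc π (2 * π))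
    rw [← this]
    simp only [hNper _]
    congr 2
    ext t; simp only [mem_preimage, mem_Ioc]
    constructor <;> rintro ⟨h1, h2⟩ <;> constructor <;> linarith
  have h3 : ∫⁻ θ in Ioc 0 π, N θ = ∫⁻ θ in Ioo 0 π, N θ := setLIntegral_congr Ioo_ae_eq_Ioc.symm
  rw [hu]
  refine (lintegral_union_le _ _ _).trans ?_
  rw [h2, h3, ← two_mul, mul_assoc]
  gcongr
  exact h g hg hper

theorem averageBound_neg {s u : ℝ} (hs : s < 0) (hs1 : -1 < s) (hsu : s ≤ u) (hu : u < 1) :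
    AverageBound s u := by
  obtain ⟨σ, rfl⟩ : ∃ σ, s = -σ := ⟨-s, by ring⟩
  have h0 : 0 < σ := by linarith
  have h1 : σ < 1 := by linarith
  obtain ⟨C, hC, hH⟩ := exists_hardyInt_le_gagliardo h0 h1
  have hK0 := gagliardoConst_ne_zero σ
  have hK1 := gagliardoConst_ne_top h0 (by linarith)
  have hA := sinPowInt_ne_top (r := -(σ * (2 - σ))) (by nlinarith [sq_nonneg (1 - σ)])
  have hB := sinPowInt_ne_top (r := -(1 - σ + σ ^ 2)) (by nlinarith)
  set A := sinPowInt (-(σ * (2 - σ)))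
  set B := sinPowInt (-(1 - σ + σ ^ 2))
  set C' := 2 * ENNReal.ofReal π * (2 + 8 * ENNReal.ofReal σ⁻¹ * C) + 32 * (A * B) * C with hC'
  refine averageBound_of_Ioo (C := C') (by
    rw [hC']; finiteness) fun g hg hper => ?_
  have hgag := hH (prof (1 - σ) g) (continuous_prof _ hg.continuous)
    (hardyInt_prof_lt_top h0 h1 hg.continuous hper)
  have hmain : ∫⁻ θ in Ioo 0 π, gagliardo σ (prof (1 + u) (fun t => g (t - θ)))
      ≤ C' * gagliardo σ (prof (1 - σ) g) := by
    calc _ ≤ _ := lintegral_gagliardo_prof_le h0 h1 (by linarith) (by linarith) hg.continuous hper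
      _ ≤ 2 * ENNReal.ofReal π * (2 * gagliardo σ (prof (1 - σ) g)
            + 8 * ENNReal.ofReal σ⁻¹ * (C * gagliardo σ (prof (1 - σ) g)))
          + 32 * (A * B) * (C * gagliardo σ (prof (1 - σ) g)) := by
          gcongr
          · refine (angularForm_le h0 h1 hg.continuous).trans ?_
            gcongr
          · exact (periodNormSq_le_hardyInt h0 g).trans hgag
      _ = _ := by rw [hC']; ring
  rw [gagliardo_prof_eq (by linarith) hg hper] at hmain
  simp only [fun θ : ℝ => gagliardo_prof_eq (σ := σ) (show 0 < 1 + u by linarith)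
    (hg.comp_sub_const θ) (hper.sub_const θ)] at hmain
  rw [lintegral_const_mul' _ _ hK1, mul_left_comm] at hmain
  rw [← sub_eq_add_neg]
  exact (ENNReal.mul_le_mul_iff_right hK0 hK1).1 hmain

theorem integral_fourier_mul_eq {f g : ℝ → ℂ} (hf : Integrable f) (hg : Integrable g) :
    ∫ ξ, 𝓕 f ξ * g ξ = ∫ x, f x * 𝓕 g x := by
  have h := VectorFourier.integral_fourierIntegral_smul_eq_flip (V := ℝ) (W := ℝ) (μ := volume)
    (ν := volume) (L := innerₗ ℝ) Real.continuous_fourierChar (by exact continuous_inner) hf hg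
  rw [flip_innerₗ] at h
  exact h

theorem conj_fourier_apply (w : ℝ → ℂ) (ξ : ℝ) :
    (starRingEnd ℂ) (𝓕 w ξ) = 𝓕 (fun y => (starRingEnd ℂ) (w (-y))) ξ := by
  rw [fourier_apply_eq_integral_exp, fourier_apply_eq_integral_exp, ← integral_conj,
    ← integral_neg_eq_self]
  refine integral_congr_ae (ae_of_all _ fun y => ?_)
  simp only [map_mul, ← Complex.exp_conj, map_neg, Complex.conj_ofReal, Complex.conj_I,
    Complex.ofReal_neg, Complex.conj_ofNat]
  congr 2
  ring

theorem integrable_fourier_mul_gaussian {w g : ℝ → ℂ} (hw : Integrable w) (hg : Integrable g) :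
    Integrable fun ξ => 𝓕 w ξ * g ξ := by
  refine hg.bdd_mul (c := ∫ x, ‖w x‖) (continuous_fourier_of_integrable hw).aestronglyMeasurable
    (ae_of_all _ fun ξ => ?_)
  exact VectorFourier.norm_fourierIntegral_le_integral_norm _ _ _ w ξ

theorem integral_gaussian_mul_normSq_fourier {w : ℝ → ℂ} (hw : Integrable w) {t : ℝ} (ht : 0 < t) :
    ((∫ ξ : ℝ, rexp (-π * ξ ^ 2 / t) * ‖𝓕 w ξ‖ ^ 2 : ℝ) : ℂ)
      = ∫ x : ℝ, ∫ y : ℝ, w x * (starRingEnd ℂ) (w y) *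
          ((t ^ (1 / 2 : ℝ) * rexp (-π * t * (x - y) ^ 2) : ℝ) : ℂ) := by
  have hb : 0 < (((1 / t : ℝ) : ℂ)).re := by rw [Complex.ofReal_re]; positivity
  have hE : Integrable fun ξ : ℝ => cexp (-π * ((1 / t : ℝ) : ℂ) * ξ ^ 2) := by
    have := integrable_cexp_neg_mul_sq (b := π * ((1 / t : ℝ) : ℂ)) (by
      rw [Complex.re_ofReal_mul]; positivity)
    simpa only [neg_mul] using this
  have hcw : Integrable fun y => (starRingEnd ℂ) (w (-y)) :=
    (LinearIsometryEquiv.integrable_comp_iff Complex.conjLIE).2 hw.comp_neg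
  have hEx : ∀ x : ℝ, Integrable fun ξ : ℝ =>
      cexp (-π * ((1 / t : ℝ) : ℂ) * ξ ^ 2) * cexp (-2 * π * I * ξ * x) := fun x => by
    refine hE.mul_bdd (c := 1) (by fun_prop) (ae_of_all _ fun ξ => ?_)
    rw [show -2 * (π : ℂ) * I * ξ * x = ((-2 * π * ξ * x : ℝ) : ℂ) * I by push_cast; ring,
      Complex.norm_exp_ofReal_mul_I]
  have hfour : ∀ x y : ℝ, 𝓕 (fun ξ : ℝ =>
      cexp (-π * ((1 / t : ℝ) : ℂ) * ξ ^ 2) * cexp (-2 * π * I * ξ * x)) y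
      = ((t ^ (1 / 2 : ℝ) * rexp (-π * t * (x + y) ^ 2) : ℝ) : ℂ) := fun x y => by
    have h := congrFun (fourier_gaussian_pi' hb (-I * x)) y
    have e : (fun ξ : ℝ => cexp (-π * ((1 / t : ℝ) : ℂ) * ξ ^ 2) * cexp (-2 * π * I * ξ * x))
        = fun ξ : ℝ => cexp (-π * ((1 / t : ℝ) : ℂ) * ξ ^ 2 + 2 * π * (-I * x) * ξ) := by
      ext ξ; rw [← Complex.exp_add]; congr 1; ring
    rw [e, h, Complex.ofReal_mul, Complex.ofReal_cpow ht.le, Complex.ofReal_exp]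
    congr 1
    · rw [one_div, ← Complex.inv_cpow, one_div, Complex.ofReal_inv, inv_inv]
      · norm_num
      · rw [Complex.arg_ofReal_of_nonneg (by positivity)]; exact Real.pi_pos.ne
    · congr 1
      push_cast
      have : (t : ℂ) ≠ 0 := by exact_mod_cast ht.ne'
      have hI : (y + I * (-I * x) : ℂ) = x + y := by
        linear_combination (-(x : ℂ)) * Complex.I_sq
      rw [hI]
      field_simp
  have hinner : ∀ x : ℝ, 𝓕 (fun ξ => (starRingEnd ℂ) (𝓕 w ξ)
      * cexp (-π * ((1 / t : ℝ) : ℂ) * ξ ^ 2)) x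
      = ∫ y : ℝ, (starRingEnd ℂ) (w y) *
          ((t ^ (1 / 2 : ℝ) * rexp (-π * t * (x - y) ^ 2) : ℝ) : ℂ) := fun x => by
    rw [fourier_apply_eq_integral_exp]
    simp only [conj_fourier_apply, mul_assoc]
    have := integral_fourier_mul_eq hcw (hEx x)
    simp only [hfour] at this
    simp only [mul_assoc] at this
    rw [this, ← integral_neg_eq_self]
    simp only [neg_neg, sub_eq_add_neg]
  have hprod : Integrable fun ξ => (starRingEnd ℂ) (𝓕 w ξ)
      * cexp (-π * ((1 / t : ℝ) : ℂ) * ξ ^ 2) := by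
    simp only [conj_fourier_apply]
    exact integrable_fourier_mul_gaussian hcw hE
  have h := integral_fourier_mul_eq hw hprod
  simp only [hinner] at h
  rw [← integral_complex_ofReal]
  have e : ∀ ξ : ℝ, ((rexp (-π * ξ ^ 2 / t) * ‖𝓕 w ξ‖ ^ 2 : ℝ) : ℂ)
      = 𝓕 w ξ * ((starRingEnd ℂ) (𝓕 w ξ) * cexp (-π * ((1 / t : ℝ) : ℂ) * ξ ^ 2)) := fun ξ => by
    rw [← mul_assoc, Complex.mul_conj, Complex.normSq_eq_norm_sq, mul_comm]
    push_cast
    congr 2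
    ring
  refine (integral_congr_ae (ae_of_all _ e)).trans (h.trans ?_)
  refine integral_congr_ae (ae_of_all _ fun x => ?_)
  simp only [mul_assoc]
  rw [← integral_const_mul]

/-- The constant relating the Gaussian integral in `ξ` to the power `|ξ| ^ (-s)`. -/
def rieszWeight (s r : ℝ) : ℝ := (1 / r) ^ s * Real.Gamma s

theorem rieszWeight_pos {s r : ℝ} (hs : 0 < s) (hr : 0 < r) : 0 < rieszWeight s r :=
  mul_pos (Real.rpow_pos_of_pos (by positivity) _) (Real.Gamma_pos_of_pos hs)

theorem integral_rpow_neg_mul_exp_neg_div {s r : ℝ} (hs : 0 < s) (hr : 0 < r) :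
    ∫ t : ℝ in Ioi 0, t ^ (-s - 1) * rexp (-r / t) = rieszWeight s r := by
  rw [rieszWeight, ← integral_rpow_mul_exp_neg_mul_Ioi hs hr]
  conv_rhs => rw [← integral_comp_rpow_Ioi _ (show (-1 : ℝ) ≠ 0 by norm_num)]
  refine setIntegral_congr_fun measurableSet_Ioi fun t (ht : 0 < t) => ?_
  simp only [smul_eq_mul, abs_neg, abs_one, one_mul]
  rw [← Real.rpow_mul ht.le, ← mul_assoc, ← Real.rpow_add ht, Real.rpow_neg_one]
  congr 2 <;> ring

theorem lintegral_rpow_neg_mul_exp_neg_div {s r : ℝ} (hs : 0 < s) (hr : 0 < r) :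
    ∫⁻ t : ℝ in Ioi 0, ENNReal.ofReal (t ^ (-s - 1) * rexp (-r / t))
      = ENNReal.ofReal (rieszWeight s r) := by
  have h := integral_rpow_neg_mul_exp_neg_div hs hr
  rw [← h, ofReal_integral_eq_lintegral_ofReal]
  · refine not_imp_comm.1 integral_undef ?_
    rw [h]; exact (rieszWeight_pos hs hr).ne'
  · filter_upwards [ae_restrict_mem measurableSet_Ioi] with t (ht : 0 < t)
    positivity

theorem rieszWeight_mul_sq {a : ℝ} (x : ℝ) :
    rieszWeight (a / 2) (π * x ^ 2) = rieszWeight (a / 2) π * |x| ^ (-a) := by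
  rw [rieszWeight, rieszWeight, one_div, mul_inv, Real.mul_rpow (by positivity) (by positivity),
    one_div, ← sq_abs, ← Real.rpow_two, ← Real.rpow_neg (abs_nonneg x),
    ← Real.rpow_mul (abs_nonneg x)]
  ring_nf

theorem ae_fst_ne_snd : ∀ᵐ q : ℝ × ℝ, q.1 ≠ q.2 := by
  have h : (volume : Measure (ℝ × ℝ)) (diagonal ℝ) = 0 := by
    rw [Measure.volume_eq_prod, Measure.measure_prod_null measurableSet_diagonal]
    refine ae_of_all _ fun x => ?_
    have : Prod.mk x ⁻¹' diagonal ℝ = {x} := by ext y; simp [eq_comm]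
    simp [this]
  filter_upwards [compl_mem_ae_iff.2 h] with q hq
  exact hq

theorem integrable_mul_mul_rpow_sub {s M : ℝ} (hs : 0 < s) (hs1 : s < 1) {f : ℝ → ℝ}
    (hf : Integrable f) (hf0 : ∀ x, 0 ≤ f x) (hM : ∀ x, f x ≤ M) :
    Integrable fun q : ℝ × ℝ => f q.1 * f q.2 * |q.1 - q.2| ^ (s - 1) := by
  have hM0 : 0 ≤ M := (hf0 0).trans (hM 0)
  set k : ℝ → ℝ := (Ioc (-1) 1).indicator fun z => |z| ^ (s - 1) with hk
  have hki : Integrable k := by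
    rw [hk, integrable_indicator_iff measurableSet_Ioc]
    have h1 : IntegrableOn (fun z : ℝ => |z| ^ (s - 1)) (Ioc 0 1) :=
      (((intervalIntegral.intervalIntegrable_rpow' (a := 0) (b := 1)
        (show -1 < s - 1 by linarith)).1).congr_fun (fun z hz => by rw [abs_of_pos hz.1])
        measurableSet_Ioc)
    have h2 : IntegrableOn (fun z : ℝ => |z| ^ (s - 1)) (Ioc (-1) 0) := by
      have := ((IntervalIntegrable.iff_comp_neg (by simp)).1
        (intervalIntegral.intervalIntegrable_rpow' (a := 0) (b := 1)
          (show -1 < s - 1 by linarith))).2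
      rw [neg_zero] at this
      exact this.congr_fun (fun z hz => by rw [abs_of_nonpos hz.2]) measurableSet_Ioc
    rw [← Ioc_union_Ioc_eq_Ioc (show (-1 : ℝ) ≤ 0 by norm_num) zero_le_one]
    exact h2.union h1
  have hconv : Integrable fun q : ℝ × ℝ => f q.2 * k (q.1 - q.2) :=
    hf.convolution_integrand (ContinuousLinearMap.mul ℝ ℝ) hki
  have hmul : Integrable fun q : ℝ × ℝ => f q.1 * f q.2 := hf.mul_prod hf
  refine ((hconv.const_mul M).add hmul).mono' ?_ (ae_of_all _ fun q => ?_)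
  · exact hmul.aestronglyMeasurable.mul (Measurable.aestronglyMeasurable (by fun_prop))
  · have h1 := hf0 q.1
    have h2 := hf0 q.2
    rw [Real.norm_of_nonneg (by positivity)]
    simp only [Pi.add_apply]
    by_cases hq : q.1 - q.2 ∈ Ioc (-1 : ℝ) 1
    · rw [hk, indicator_of_mem hq]
      have := hM q.1
      have h3 : 0 ≤ |q.1 - q.2| ^ (s - 1) := by positivity
      calc _ = f q.1 * (f q.2 * |q.1 - q.2| ^ (s - 1)) := by ring
        _ ≤ M * (f q.2 * |q.1 - q.2| ^ (s - 1)) := by gcongr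
        _ ≤ _ := le_add_of_nonneg_right (by positivity)
    · rw [hk, indicator_of_notMem hq, mul_zero, mul_zero, zero_add]
      refine mul_le_of_le_one_right (by positivity) ?_
      refine Real.rpow_le_one_of_one_le_of_nonpos ?_ (by linarith)
      by_contra! h
      rw [abs_lt] at h
      exact hq ⟨h.1, h.2.le⟩

/-- The Riesz energy form of `w`. -/
def rieszForm (s : ℝ) (w : ℝ → ℂ) : ℝ :=
  ∫ q : ℝ × ℝ, (w q.1 * (starRingEnd ℂ) (w q.2)).re * |q.1 - q.2| ^ (s - 1)

theorem abs_re_mul_conj_le (a b : ℂ) : |(a * (starRingEnd ℂ) b).re| ≤ ‖a‖ * ‖b‖ :=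
  (Complex.abs_re_le_norm _).trans (by rw [norm_mul, RCLike.norm_conj])

theorem integral_gaussian_mul_normSq_fourier_eq_re {w : ℝ → ℂ} (hw : Integrable w)
    {t : ℝ} (ht : 0 < t) :
    ∫ ξ : ℝ, rexp (-π * ξ ^ 2 / t) * ‖𝓕 w ξ‖ ^ 2
      = ∫ q : ℝ × ℝ, (w q.1 * (starRingEnd ℂ) (w q.2)).re *
          (t ^ (1 / 2 : ℝ) * rexp (-π * t * (q.1 - q.2) ^ 2)) := by
  have hcw : Integrable fun y => (starRingEnd ℂ) (w y) :=
    (LinearIsometryEquiv.integrable_comp_iff Complex.conjLIE).2 hw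
  have hi : Integrable fun q : ℝ × ℝ => w q.1 * (starRingEnd ℂ) (w q.2) *
      ((t ^ (1 / 2 : ℝ) * rexp (-π * t * (q.1 - q.2) ^ 2) : ℝ) : ℂ) := by
    refine (hw.mul_prod hcw).mul_bdd (c := t ^ (1 / 2 : ℝ)) (by fun_prop) (ae_of_all _ fun q => ?_)
    rw [Complex.norm_real, Real.norm_of_nonneg (by positivity)]
    refine mul_le_of_le_one_right (by positivity) (Real.exp_le_one_iff.2 ?_)
    have : 0 ≤ π * t * (q.1 - q.2) ^ 2 := by positivity
    linarith
  have h := integral_gaussian_mul_normSq_fourier hw ht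
  rw [← integral_prod _ hi, ← Measure.volume_eq_prod] at h
  have h2 := congrArg Complex.re h
  rw [Complex.ofReal_re] at h2
  rw [h2]
  have := integral_re (𝕜 := ℂ) hi
  refine this.symm.trans (integral_congr_ae (ae_of_all _ fun q => ?_))
  simp only [RCLike.re_eq_complex_re, Complex.re_mul_ofReal]

theorem integrable_rieszForm {s M : ℝ} (hs : 0 < s) (hs1 : s < 1) {w : ℝ → ℂ} (hw : Continuous w)
    (hwi : Integrable w) (hM : ∀ x, ‖w x‖ ≤ M) :
    Integrable fun q : ℝ × ℝ => (w q.1 * (starRingEnd ℂ) (w q.2)).re * |q.1 - q.2| ^ (s - 1) := by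
  refine (integrable_mul_mul_rpow_sub hs hs1 hwi.norm (fun _ => norm_nonneg _) hM).mono'
    (Measurable.aestronglyMeasurable (by fun_prop)) (ae_of_all _ fun q => ?_)
  rw [norm_mul, Real.norm_eq_abs, Real.norm_of_nonneg (by positivity)]
  gcongr
  exact abs_re_mul_conj_le _ _

theorem integrable_rpow_mul_exp_neg {a r : ℝ} (ha : 0 < a) (hr : 0 < r) :
    IntegrableOn (fun t : ℝ => t ^ (a - 1) * rexp (-(r * t))) (Ioi 0) := by
  refine not_imp_comm.1 integral_undef ?_
  rw [integral_rpow_mul_exp_neg_mul_Ioi ha hr]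
  exact (rieszWeight_pos ha hr).ne'

theorem lintegral_abs_rpow_mul_fourier_eq {s M : ℝ} (hs : 0 < s) (hs1 : s < 1) {w : ℝ → ℂ}
    (hw : Continuous w) (hwi : Integrable w) (hM : ∀ x, ‖w x‖ ≤ M) :
    ENNReal.ofReal (rieszWeight (s / 2) π) *
        ∫⁻ ξ : ℝ, ENNReal.ofReal (|ξ| ^ (-s)) * ‖𝓕 w ξ‖ₑ ^ 2
      = ENNReal.ofReal (rieszWeight ((1 - s) / 2) π * rieszForm s w) := by
  have hcF := continuous_fourier_of_integrable hwi
  have hκ : 0 < rieszWeight (s / 2) π := rieszWeight_pos (by linarith) Real.pi_pos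
  set F : ℝ → ℝ × ℝ → ℝ := fun t q => (w q.1 * (starRingEnd ℂ) (w q.2)).re *
    (t ^ ((1 - s) / 2 - 1) * rexp (-(π * (q.1 - q.2) ^ 2 * t))) with hF
  have hFt : ∀ q : ℝ × ℝ, q.1 ≠ q.2 → ∫ t in Ioi 0, t ^ ((1 - s) / 2 - 1) *
      rexp (-(π * (q.1 - q.2) ^ 2 * t)) = rieszWeight ((1 - s) / 2) π * |q.1 - q.2| ^ (s - 1) := by
    intro q hq
    have hq' : q.1 - q.2 ≠ 0 := sub_ne_zero.2 hq
    rw [integral_rpow_mul_exp_neg_mul_Ioi (by linarith) (by positivity)]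
    have := rieszWeight_mul_sq (a := 1 - s) (q.1 - q.2)
    rw [neg_sub] at this
    exact this
  have hFi : Integrable (Function.uncurry F) ((volume.restrict (Ioi 0)).prod volume) := by
    rw [integrable_prod_iff' (Measurable.aestronglyMeasurable (by
      simp only [Function.uncurry_def, hF]
      fun_prop))]
    constructor
    · filter_upwards [ae_fst_ne_snd] with q hq
      have hq' : q.1 - q.2 ≠ 0 := sub_ne_zero.2 hq
      have h : IntegrableOn (fun t : ℝ => t ^ ((1 - s) / 2 - 1) *
          rexp (-(π * (q.1 - q.2) ^ 2 * t))) (Ioi 0) :=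
        integrable_rpow_mul_exp_neg (by linarith) (by positivity)
      exact Integrable.const_mul (μ := volume.restrict (Ioi 0)) h
        ((w q.1 * (starRingEnd ℂ) (w q.2)).re)
    · refine ((integrable_rieszForm hs hs1 hw hwi hM).norm.const_mul
        (rieszWeight ((1 - s) / 2) π)).congr ?_
      filter_upwards [ae_fst_ne_snd] with q hq
      have : ∫ t in Ioi 0, ‖Function.uncurry F (t, q)‖ = ∫ t in Ioi 0,
          |(w q.1 * (starRingEnd ℂ) (w q.2)).re| * (t ^ ((1 - s) / 2 - 1) *
          rexp (-(π * (q.1 - q.2) ^ 2 * t))) := by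
        refine setIntegral_congr_fun measurableSet_Ioi fun t ht => ?_
        have ht' : (0 : ℝ) < t := ht
        simp only [Function.uncurry, hF]
        rw [norm_mul, Real.norm_eq_abs, Real.norm_of_nonneg (by positivity)]
      rw [this, integral_const_mul, hFt q hq, norm_mul, Real.norm_eq_abs,
        Real.norm_of_nonneg (by positivity)]
      ring
  have hFE : ∀ t ∈ Ioi (0 : ℝ), ∫ q, F t q
      = t ^ (-(s / 2) - 1) * ∫ ξ : ℝ, rexp (-π * ξ ^ 2 / t) * ‖𝓕 w ξ‖ ^ 2 := fun t ht => by
    have ht' : (0 : ℝ) < t := ht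
    rw [integral_gaussian_mul_normSq_fourier_eq_re hwi ht, ← integral_const_mul]
    refine integral_congr_ae (ae_of_all _ fun q => ?_)
    simp only [hF]
    rw [show (1 - s) / 2 - 1 = (-(s / 2) - 1) + 1 / 2 by ring, Real.rpow_add ht',
      show -(π * (q.1 - q.2) ^ 2 * t) = -π * t * (q.1 - q.2) ^ 2 by ring]
    ring
  have hQ : ∀ t ∈ Ioi (0 : ℝ), ∫⁻ ξ : ℝ, ENNReal.ofReal (t ^ (-(s / 2) - 1) *
      rexp (-(π * ξ ^ 2) / t)) * ‖𝓕 w ξ‖ₑ ^ 2 = ENNReal.ofReal (∫ q, F t q) := fun t ht => by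
    have ht' : (0 : ℝ) < t := ht
    rw [hFE t ht, ← integral_const_mul, ofReal_integral_eq_lintegral_ofReal]
    · refine lintegral_congr fun ξ => ?_
      rw [← ofReal_norm, ← ENNReal.ofReal_pow (norm_nonneg _),
        ← ENNReal.ofReal_mul (by positivity), mul_assoc, neg_mul]
    · refine Integrable.const_mul ?_ _
      have hg : Integrable fun ξ : ℝ => rexp (-(π / t) * ξ ^ 2) :=
        integrable_exp_neg_mul_sq (by positivity)
      refine (hg.mul_bdd (g := fun ξ => ‖𝓕 w ξ‖ ^ 2) (c := (∫ x, ‖w x‖) ^ 2) (by fun_prop)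
        (ae_of_all _ fun ξ => ?_)).congr (ae_of_all _ fun ξ => ?_)
      · rw [norm_pow, norm_norm]
        gcongr
        exact VectorFourier.norm_fourierIntegral_le_integral_norm _ _ _ _ _
      · simp only
        congr 2
        ring
    · exact ae_of_all _ fun ξ => by simp only [Pi.zero_apply]; positivity
  have hQ0 : ∀ t ∈ Ioi (0 : ℝ), 0 ≤ ∫ q, F t q := fun t ht => by
    have ht' : (0 : ℝ) < t := ht
    rw [hFE t ht]
    exact mul_nonneg (by positivity) (integral_nonneg fun ξ => by positivity)
  calc _ = ∫⁻ ξ : ℝ, ∫⁻ t : ℝ in Ioi 0, ENNReal.ofReal (t ^ (-(s / 2) - 1) *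
        rexp (-(π * ξ ^ 2) / t)) * ‖𝓕 w ξ‖ₑ ^ 2 := by
        rw [← lintegral_const_mul' _ _ ENNReal.ofReal_ne_top]
        refine lintegral_congr_ae ?_
        filter_upwards [Measure.ae_ne volume (0 : ℝ)] with ξ hξ
        rw [lintegral_mul_const' _ _ (by finiteness), lintegral_rpow_neg_mul_exp_neg_div (by linarith)
          (by positivity), rieszWeight_mul_sq, ENNReal.ofReal_mul hκ.le, mul_assoc]
    _ = ∫⁻ t : ℝ in Ioi 0, ENNReal.ofReal (∫ q, F t q) := by
        rw [lintegral_lintegral_swap (Measurable.aemeasurable (by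
          simp only [Function.uncurry_def]
          exact (Measurable.ennreal_ofReal (by fun_prop)).mul
            ((hcF.measurable.comp measurable_fst).enorm.pow_const 2)))]
        exact setLIntegral_congr_fun measurableSet_Ioi hQ
    _ = ENNReal.ofReal (∫ t in Ioi 0, ∫ q, F t q) := by
        refine (ofReal_integral_eq_lintegral_ofReal hFi.integral_prod_left ?_).symm
        filter_upwards [ae_restrict_mem measurableSet_Ioi] with t ht using hQ0 t ht
    _ = _ := by
        rw [integral_integral_swap hFi, rieszForm, ← integral_const_mul]
        congr 1
        refine integral_congr_ae ?_
        filter_upwards [ae_fst_ne_snd] with q hq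
        rw [integral_const_mul, hFt q hq]
        ring

/-- Lebesgue measure on one period `(0, π)`. -/
def periodMeasure : Measure ℝ := volume.restrict (Ioo 0 π)

instance isFiniteMeasure_periodMeasure : IsFiniteMeasure periodMeasure :=
  inferInstanceAs (IsFiniteMeasure (volume.restrict (Ioo 0 π)))

theorem measureReal_periodMeasure_univ : periodMeasure.real univ = π := by
  simp [periodMeasure, Measure.real, Real.pi_pos.le]

theorem integral_periodMeasure_eq_intervalIntegral {E : Type*} [NormedAddCommGroup E]
    [NormedSpace ℝ E] (f : ℝ → E) : ∫ t, f t ∂periodMeasure = ∫ t in (0 : ℝ)..π, f t := by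
  rw [periodMeasure, ← integral_Ioc_eq_integral_Ioo,
    intervalIntegral.integral_of_le Real.pi_pos.le]

theorem Function.Periodic.integral_periodMeasure_sub {E : Type*} [NormedAddCommGroup E]
    [NormedSpace ℝ E] {f : ℝ → E} (hf : Function.Periodic f π) (θ : ℝ) :
    ∫ t, f (t - θ) ∂periodMeasure = ∫ t, f t ∂periodMeasure := by
  rw [integral_periodMeasure_eq_intervalIntegral, integral_periodMeasure_eq_intervalIntegral,
    intervalIntegral.integral_comp_sub_right]
  have := hf.intervalIntegral_add_eq (-θ) 0
  rw [zero_add] at this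
  rw [← this]
  congr 1 <;> ring

theorem Function.Periodic.integral_periodMeasure_sub_left {E : Type*} [NormedAddCommGroup E]
    [NormedSpace ℝ E] {f : ℝ → E} (hf : Function.Periodic f π) (θ : ℝ) :
    ∫ t, f (θ - t) ∂periodMeasure = ∫ t, f t ∂periodMeasure := by
  rw [integral_periodMeasure_eq_intervalIntegral, integral_periodMeasure_eq_intervalIntegral,
    intervalIntegral.integral_comp_sub_left]
  have := hf.intervalIntegral_add_eq (θ - π) 0
  rw [zero_add] at this
  rw [← this]
  congr 1; ring

theorem integral_periodMeasure_eq_integral_arccot (F : ℝ → ℝ) :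
    ∫ t, F t ∂periodMeasure = ∫ x, Real.sin (arccot x) ^ 2 * F (arccot x) := by
  have h := integral_image_eq_integral_abs_deriv_smul (s := univ) MeasurableSet.univ
    (fun x _ => (hasDerivAt_arccot x).hasDerivWithinAt) (arccot_injective.injOn) F
  rw [image_univ, range_arccot, Measure.restrict_univ] at h
  rw [periodMeasure, h]
  refine integral_congr_ae (ae_of_all _ fun x => ?_)
  simp only [smul_eq_mul]
  congr 1
  rw [abs_neg, abs_of_pos (inv_pos.2 (one_add_sq_pos x)), ← Real.rpow_two (Real.sin (arccot x)),
    sin_arccot_rpow, neg_div_self two_ne_zero, Real.rpow_neg_one]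

/-- The kernel `|sin t| ^ r`. -/
def absSinPow (r t : ℝ) : ℝ := |Real.sin t| ^ r

theorem absSinPow_nonneg (r t : ℝ) : 0 ≤ absSinPow r t := by unfold absSinPow; positivity

theorem periodic_absSinPow (r : ℝ) : Function.Periodic (absSinPow r) π := fun t => by
  simp [absSinPow, Real.sin_add_pi]

theorem measurable_absSinPow (r : ℝ) : Measurable (absSinPow r) := by
  unfold absSinPow; fun_prop

theorem Measurable.absSinPow {α : Type*} [MeasurableSpace α] {f : α → ℝ} (hf : Measurable f)
    (r : ℝ) : Measurable fun x => absSinPow r (f x) :=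
  (measurable_absSinPow r).comp hf

theorem continuous_absSinPow {r : ℝ} (hr : 0 ≤ r) : Continuous (absSinPow r) := by
  unfold absSinPow
  exact Continuous.rpow_const (by fun_prop) fun _ => Or.inr hr

theorem absSinPow_le_one {r : ℝ} (hr : 0 ≤ r) (t : ℝ) : absSinPow r t ≤ 1 :=
  Real.rpow_le_one (abs_nonneg _) (Real.abs_sin_le_one t) hr

theorem absSinPow_eq_of_mem {r t : ℝ} (ht : t ∈ Ioo 0 π) : absSinPow r t = Real.sin t ^ r := by
  rw [absSinPow, abs_of_pos (Real.sin_pos_of_mem_Ioo ht)]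

theorem lintegral_periodMeasure_absSinPow (r : ℝ) :
    ∫⁻ t, ENNReal.ofReal (absSinPow r t) ∂periodMeasure = sinPowInt r := by
  rw [periodMeasure, sinPowInt]
  exact setLIntegral_congr_fun measurableSet_Ioo fun t ht => by
    simp only [absSinPow_eq_of_mem ht]

theorem integrable_absSinPow {r : ℝ} (hr : -1 < r) : Integrable (absSinPow r) periodMeasure := by
  refine (lintegral_ofReal_ne_top_iff_integrable (measurable_absSinPow r).aestronglyMeasurable
    (ae_of_all _ (absSinPow_nonneg r))).1 ?_
  rw [lintegral_periodMeasure_absSinPow]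
  exact sinPowInt_ne_top hr

theorem integrable_absSinPow_sub {r : ℝ} (hr : -1 < r) :
    Integrable (fun q : ℝ × ℝ => absSinPow r (q.1 - q.2)) (periodMeasure.prod periodMeasure) := by
  have hm : Measurable fun q : ℝ × ℝ => absSinPow r (q.1 - q.2) :=
    (measurable_fst.sub measurable_snd).absSinPow r
  refine (lintegral_ofReal_ne_top_iff_integrable hm.aestronglyMeasurable
    (ae_of_all _ fun q => absSinPow_nonneg r _)).1 ?_
  rw [lintegral_prod _ hm.ennreal_ofReal.aemeasurable]
  have h : ∀ x, ∫⁻ y, ENNReal.ofReal (absSinPow r (x - y)) ∂periodMeasure = sinPowInt r := by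
    intro x
    rw [← lintegral_periodMeasure_absSinPow]
    exact Function.Periodic.setLIntegral_sub_left_eq
      (F := fun t => ENNReal.ofReal (absSinPow r t)) (fun t => by
        simp only [periodic_absSinPow r t]) x
  simp only [h, lintegral_const]
  exact ENNReal.mul_ne_top (sinPowInt_ne_top hr) (measure_ne_top _ _)

/-- The energy form with kernel `|sin (θ - φ)| ^ (s - 1)`. -/
def circleForm (s : ℝ) (h : ℝ → ℂ) : ℝ :=
  ∫ q : ℝ × ℝ, (h q.1 * (starRingEnd ℂ) (h q.2)).re * absSinPow (s - 1) (q.1 - q.2)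
    ∂(periodMeasure.prod periodMeasure)

theorem integrable_circleForm {s M : ℝ} (hs : 0 < s) {h : ℝ → ℂ} (hh : Continuous h)
    (hM : ∀ x, ‖h x‖ ≤ M) : Integrable (fun q : ℝ × ℝ =>
      (h q.1 * (starRingEnd ℂ) (h q.2)).re * absSinPow (s - 1) (q.1 - q.2))
      (periodMeasure.prod periodMeasure) := by
  refine (integrable_absSinPow_sub (by linarith)).bdd_mul (c := M * M)
    (Measurable.aestronglyMeasurable (by fun_prop)) (ae_of_all _ fun q => ?_)
  exact (abs_re_mul_conj_le _ _).trans
    (mul_le_mul (hM _) (hM _) (norm_nonneg _) ((norm_nonneg _).trans (hM 0)))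

theorem rieszForm_prof {s : ℝ} (hs : 0 < s) (hs1 : s < 1) {h : ℝ → ℂ} (hh : Continuous h)
    (hper : Function.Periodic h π) : rieszForm s (prof (1 + s) h) = circleForm s h := by
  obtain ⟨M, hM⟩ := exists_norm_prof_le (by linarith : 0 ≤ 1 + s) hh hper
  obtain ⟨M', -, hM'⟩ := exists_bound_of_periodic hh hper
  have h1 := integrable_rieszForm hs hs1 (continuous_prof (1 + s) hh)
    (integrable_prof (by linarith) hh hper) hM
  rw [rieszForm, circleForm, Measure.volume_eq_prod, integral_prod _ h1,
    integral_prod _ (integrable_circleForm hs hh hM'), integral_periodMeasure_eq_integral_arccot]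
  refine integral_congr_ae (ae_of_all _ fun x => ?_)
  simp only
  rw [integral_periodMeasure_eq_integral_arccot, ← integral_const_mul]
  refine integral_congr_ae ?_
  filter_upwards [Measure.ae_ne volume x] with y hy
  have hx0 := sin_arccot_pos x
  have hy0 := sin_arccot_pos y
  rw [absSinPow, sin_arccot_sub_arccot, abs_mul, abs_of_pos (mul_pos hx0 hy0), abs_sub_comm y x,
    Real.mul_rpow (abs_nonneg _) (by positivity), Real.mul_rpow hx0.le hy0.le, prof_eq, prof_eq,
    map_mul, Complex.conj_ofReal]
  have e : ∀ z : ℝ, 0 < z → z ^ (1 + s) = z ^ 2 * z ^ (s - 1) := fun z hz => by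
    rw [← Real.rpow_two, ← Real.rpow_add hz]; ring_nf
  rw [show ((Real.sin (arccot x) ^ (1 + s) : ℝ) : ℂ) * h (arccot x) *
      (((Real.sin (arccot y) ^ (1 + s) : ℝ) : ℂ) * (starRingEnd ℂ) (h (arccot y)))
      = ((Real.sin (arccot x) ^ (1 + s) * Real.sin (arccot y) ^ (1 + s) : ℝ) : ℂ) *
        (h (arccot x) * (starRingEnd ℂ) (h (arccot y))) by push_cast; ring,
    Complex.re_ofReal_mul, e _ hx0, e _ hy0]
  ring

theorem prof_absSinPow_mul (p a : ℝ) (g : ℝ → ℂ) :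
    prof p (fun t => (absSinPow a t : ℂ) * g t) = prof (p + a) g := by
  ext x
  rw [prof_eq, prof_eq, absSinPow_eq_of_mem (arccot_mem_Ioo x), Real.rpow_add (sin_arccot_pos x)]
  push_cast; ring

theorem csNormSq_eq_circleForm {s a : ℝ} (hs : 0 < s) (hs1 : s < 1) (ha : 0 ≤ a) {g : ℝ → ℂ}
    (hg : ContDiff ℝ 1 g) (hper : Function.Periodic g π) :
    ENNReal.ofReal (rieszWeight (s / 2) π) * csNormSq s (1 + s + a) g
      = ENNReal.ofReal (rieszWeight ((1 - s) / 2) π *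
          circleForm s (fun t => (absSinPow a t : ℂ) * g t)) := by
  obtain ⟨M, hM⟩ := exists_norm_prof_le (by linarith : 0 ≤ 1 + s + a) hg.continuous hper
  have hc := continuous_absSinPow ha
  have hgc := hg.continuous
  rw [csNormSq_eq_fourier (by linarith) hg hper, lintegral_abs_rpow_mul_fourier_eq hs hs1
    (continuous_prof _ hgc) (integrable_prof (by linarith) hgc hper) hM,
    ← prof_absSinPow_mul, rieszForm_prof hs hs1 (by fun_prop)]
  intro t
  simp only [periodic_absSinPow a t, hper t]

/-- The exponential `t ↦ exp (2 i n t)`, of period `π`. -/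
def circleExp (n : ℤ) (t : ℝ) : ℂ := cexp ((2 * n * t : ℝ) * I)

/-- The Fourier coefficients of a function of period `π`, without normalisation. -/
def periodCoeff (f : ℝ → ℂ) (n : ℤ) : ℂ := ∫ t, circleExp (-n) t * f t ∂periodMeasure

theorem continuous_circleExp (n : ℤ) : Continuous (circleExp n) := by
  unfold circleExp; fun_prop

theorem norm_circleExp (n : ℤ) (t : ℝ) : ‖circleExp n t‖ = 1 := by
  rw [circleExp, Complex.norm_exp_ofReal_mul_I]

theorem circleExp_add (m n : ℤ) (t : ℝ) :
    circleExp (m + n) t = circleExp m t * circleExp n t := by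
  rw [circleExp, circleExp, circleExp, ← Complex.exp_add]
  push_cast; ring_nf

theorem circleExp_sub_apply (n : ℤ) (t θ : ℝ) :
    circleExp n (t - θ) = circleExp n t * circleExp (-n) θ := by
  rw [circleExp, circleExp, circleExp, ← Complex.exp_add]
  push_cast; ring_nf

theorem periodic_circleExp (n : ℤ) : Function.Periodic (circleExp n) π := fun t => by
  rw [circleExp, circleExp, Complex.exp_eq_exp_iff_exists_int]
  exact ⟨n, by push_cast; ring⟩

theorem circleExp_zero (t : ℝ) : circleExp 0 t = 1 := by simp [circleExp]

theorem circleExp_re (n : ℤ) (t : ℝ) : (circleExp n t).re = Real.cos (2 * n * t) := by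
  rw [circleExp, Complex.exp_ofReal_mul_I_re]

theorem circleExp_im (n : ℤ) (t : ℝ) : (circleExp n t).im = Real.sin (2 * n * t) := by
  rw [circleExp, Complex.exp_ofReal_mul_I_im]

theorem circleExp_neg (n : ℤ) (t : ℝ) : circleExp (-n) t = (starRingEnd ℂ) (circleExp n t) := by
  rw [circleExp, circleExp, ← Complex.exp_conj, map_mul, Complex.conj_ofReal, Complex.conj_I]
  push_cast; ring_nf

theorem re_circleExp_mul_conj (n : ℤ) (x y : ℝ) :
    (circleExp n x * (starRingEnd ℂ) (circleExp n y)).re = Real.cos (2 * n * (x - y)) := by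
  rw [← circleExp_neg, ← circleExp_sub_apply, circleExp_re]

theorem normSq_one_sub_circleExp (n : ℤ) (t : ℝ) :
    ‖1 - circleExp n t‖ ^ 2 = 2 - 2 * Real.cos (2 * n * t) := by
  rw [← Complex.normSq_eq_norm_sq, Complex.normSq_apply]
  simp only [Complex.sub_re, Complex.sub_im, Complex.one_re, Complex.one_im, circleExp_re,
    circleExp_im]
  have := Real.sin_sq_add_cos_sq (2 * n * t)
  linear_combination this

theorem integrable_periodMeasure_of_continuous {E : Type*} [NormedAddCommGroup E] {f : ℝ → E}
    (hf : Continuous f) : Integrable f periodMeasure :=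
  (hf.integrableOn_Icc (a := 0) (b := π)).mono_set Ioo_subset_Icc_self

theorem HasSum.of_eq {f g : ℤ → ℝ} {a b : ℝ} (h : HasSum f a) (hf : ∀ n, g n = f n)
    (hab : b = a) : HasSum g b := by
  rw [hab, funext hf]; exact h

theorem hasSum_normSq_periodCoeff {f : ℝ → ℂ} (hf : Continuous f) :
    HasSum (fun n => ‖periodCoeff f n‖ ^ 2 / π) (∫ t, ‖f t‖ ^ 2 ∂periodMeasure) := by
  have hmem : MemLp f 2 (volume.restrict (Ioc 0 π)) := by
    rw [memLp_two_iff_integrable_sq_norm hf.aestronglyMeasurable]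
    exact ((hf.norm.pow 2).integrableOn_Icc (a := 0) (b := π)).mono_set Ioc_subset_Icc_self
  have h := (hasSum_sq_fourierCoeffOn Real.pi_pos hmem).mul_left π
  rw [integral_periodMeasure_eq_intervalIntegral]
  have e : ∀ n, fourierCoeffOn Real.pi_pos f n = (1 / π : ℝ) • periodCoeff f n := fun n => by
    rw [fourierCoeffOn_eq_integral, periodCoeff, integral_periodMeasure_eq_intervalIntegral,
      sub_zero]
    congr 1
    refine intervalIntegral.integral_congr fun t _ => ?_
    simp only [fourier_coe_apply, smul_eq_mul, circleExp]
    congr 2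
    have : (π : ℂ) ≠ 0 := by exact_mod_cast Real.pi_ne_zero
    push_cast
    field_simp
  have hp := Real.pi_pos
  refine h.of_eq (fun n => ?_) ?_
  · rw [e, norm_smul, mul_pow, Real.norm_of_nonneg (by positivity)]
    field_simp
  · rw [sub_zero, smul_eq_mul]
    field_simp

theorem periodCoeff_comp_sub {g : ℝ → ℂ} (hper : Function.Periodic g π) (τ : ℝ) (n : ℤ) :
    periodCoeff (fun t => g (t - τ)) n = circleExp (-n) τ * periodCoeff g n := by
  have h : Function.Periodic (fun t => circleExp (-n) t * g t) π := fun t => by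
    simp only [periodic_circleExp (-n) t, hper t]
  rw [periodCoeff, periodCoeff, ← h.integral_periodMeasure_sub τ, ← integral_const_mul]
  refine integral_congr_ae (ae_of_all _ fun t => ?_)
  simp only
  rw [circleExp_sub_apply, neg_neg]
  have : circleExp (-n) τ * circleExp n τ = 1 := by
    rw [← circleExp_add, neg_add_cancel, circleExp_zero]
  linear_combination (-circleExp (-n) t * g (t - τ)) * this

/-- The real part of the autocorrelation of `g` over one period. -/
def autocorr (g : ℝ → ℂ) (τ : ℝ) : ℝ :=
  ∫ t, (g t * (starRingEnd ℂ) (g (t - τ))).re ∂periodMeasure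

theorem hasSum_autocorr {g : ℝ → ℂ} (hg : Continuous g) (hper : Function.Periodic g π) (τ : ℝ) :
    HasSum (fun n : ℤ => ‖periodCoeff g n‖ ^ 2 / π * Real.cos (2 * n * τ)) (autocorr g τ) := by
  have h1 := hasSum_normSq_periodCoeff hg
  have h2 := hasSum_normSq_periodCoeff (f := fun t => g t - g (t - τ)) (by fun_prop)
  have hc : ∀ n, periodCoeff (fun t => g t - g (t - τ)) n
      = (1 - circleExp (-n) τ) * periodCoeff g n := fun n => by
    rw [sub_mul, one_mul, ← periodCoeff_comp_sub hper, periodCoeff, periodCoeff, periodCoeff,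
      ← integral_sub]
    · simp only [mul_sub]
    · exact integrable_periodMeasure_of_continuous ((continuous_circleExp _).mul hg)
    · exact integrable_periodMeasure_of_continuous ((continuous_circleExp _).mul (by fun_prop))
  have hN : Function.Periodic (fun t => ‖g t‖ ^ 2) π := fun t => by simp only [hper t]
  have hI : autocorr g τ = (∫ t, ‖g t‖ ^ 2 ∂periodMeasure) -
      (∫ t, ‖g t - g (t - τ)‖ ^ 2 ∂periodMeasure) / 2 := by
    have e : ∀ t, ‖g t - g (t - τ)‖ ^ 2 = ‖g t‖ ^ 2 + ‖g (t - τ)‖ ^ 2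
        - 2 * (g t * (starRingEnd ℂ) (g (t - τ))).re := fun t => by
      simp only [← Complex.normSq_eq_norm_sq, Complex.normSq_sub]
    have i1 : Integrable (fun t => ‖g t‖ ^ 2) periodMeasure :=
      integrable_periodMeasure_of_continuous (by fun_prop)
    have i2 : Integrable (fun t => ‖g (t - τ)‖ ^ 2) periodMeasure :=
      integrable_periodMeasure_of_continuous (by fun_prop)
    have i3 : Integrable (fun t => 2 * (g t * (starRingEnd ℂ) (g (t - τ))).re) periodMeasure :=
      integrable_periodMeasure_of_continuous (by fun_prop)
    simp only [e]
    rw [integral_sub (f := fun t => ‖g t‖ ^ 2 + ‖g (t - τ)‖ ^ 2) (i1.add i2) i3, integral_add i1 i2, hN.integral_periodMeasure_sub τ,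
      integral_const_mul, autocorr]
    ring
  rw [hI]
  refine (h1.sub (h2.div_const 2)).of_eq (fun n => ?_) rfl
  rw [hc, norm_mul, mul_pow, normSq_one_sub_circleExp]
  push_cast
  rw [show 2 * -(n : ℝ) * τ = -(2 * n * τ) by ring, Real.cos_neg]
  ring

theorem integral_re_mul_conj_comp_sub {g : ℝ → ℂ} (hper : Function.Periodic g π) (x y : ℝ) :
    ∫ θ, (g (x - θ) * (starRingEnd ℂ) (g (y - θ))).re ∂periodMeasure = autocorr g (x - y) := by
  have h : Function.Periodic (fun t => (g t * (starRingEnd ℂ) (g (t - (x - y)))).re) π :=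
    fun t => by simp only [hper t, add_sub_right_comm, hper _]
  rw [autocorr, ← h.integral_periodMeasure_sub_left x]
  refine integral_congr_ae (ae_of_all _ fun θ => ?_)
  simp only
  rw [show x - θ - (x - y) = y - θ by ring]

theorem re_ofReal_mul_mul_conj (a b : ℝ) (z w : ℂ) :
    ((a * z) * (starRingEnd ℂ) (b * w)).re = a * b * (z * (starRingEnd ℂ) w).re := by
  rw [map_mul, Complex.conj_ofReal, show (a : ℂ) * z * (b * (starRingEnd ℂ) w)
    = ((a * b : ℝ) : ℂ) * (z * (starRingEnd ℂ) w) by push_cast; ring, Complex.re_ofReal_mul]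

theorem integrable_uncurry_circleForm_sub {s : ℝ} (hs : 0 < s) {S : ℝ → ℝ} (hS : Continuous S)
    (hS1 : ∀ t, |S t| ≤ 1) {g : ℝ → ℂ} (hg : Continuous g) (hper : Function.Periodic g π) :
    Integrable (Function.uncurry fun (θ : ℝ) (q : ℝ × ℝ) => ((S q.1 * g (q.1 - θ)) *
      (starRingEnd ℂ) (S q.2 * g (q.2 - θ))).re * absSinPow (s - 1) (q.1 - q.2))
      (periodMeasure.prod (periodMeasure.prod periodMeasure)) := by
  obtain ⟨M, hM0, hM⟩ := exists_bound_of_periodic hg hper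
  have hK := (integrable_absSinPow_sub (r := s - 1) (by linarith)).comp_snd periodMeasure
  refine hK.bdd_mul (c := M * M) (Measurable.aestronglyMeasurable (by fun_prop))
    (ae_of_all _ fun q => ?_)
  have hb : ∀ x y, ‖(S x : ℂ) * g y‖ ≤ M := fun x y => by
    rw [norm_mul, Complex.norm_real, Real.norm_eq_abs]
    exact (mul_le_of_le_one_left (norm_nonneg _) (hS1 x)).trans (hM y)
  exact (abs_re_mul_conj_le _ _).trans (mul_le_mul (hb _ _) (hb _ _) (norm_nonneg _) hM0)

theorem integrable_circleForm_sub {s : ℝ} (hs : 0 < s) {S : ℝ → ℝ} (hS : Continuous S)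
    (hS1 : ∀ t, |S t| ≤ 1) {g : ℝ → ℂ} (hg : Continuous g) (hper : Function.Periodic g π) :
    Integrable (fun θ => circleForm s fun t => S t * g (t - θ)) periodMeasure :=
  (integrable_uncurry_circleForm_sub hs hS hS1 hg hper).integral_prod_left

theorem hasSum_integral_circleForm_sub {s : ℝ} (hs : 0 < s) {S : ℝ → ℝ} (hS : Continuous S)
    (hS1 : ∀ t, |S t| ≤ 1) {g : ℝ → ℂ} (hg : Continuous g) (hper : Function.Periodic g π) :
    HasSum (fun n : ℤ => ‖periodCoeff g n‖ ^ 2 / π * circleForm s fun t => S t * circleExp n t)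
      (∫ θ, circleForm s (fun t => S t * g (t - θ)) ∂periodMeasure) := by
  have hK := integrable_absSinPow_sub (r := s - 1) (by linarith)
  have hint : ∀ n : ℤ, Integrable (fun q : ℝ × ℝ => S q.1 * S q.2 *
      Real.cos (2 * n * (q.1 - q.2)) * absSinPow (s - 1) (q.1 - q.2))
      (periodMeasure.prod periodMeasure) := fun n => by
    refine hK.bdd_mul (c := 1) (Measurable.aestronglyMeasurable (by fun_prop))
      (ae_of_all _ fun q => ?_)
    rw [norm_mul, norm_mul]
    exact mul_le_one₀ (mul_le_one₀ (hS1 _) (norm_nonneg _) (hS1 _)) (norm_nonneg _)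
      (Real.abs_cos_le_one _)
  have h := hasSum_integral_of_summable_integral_norm
    (fun n : ℤ => (hint n).const_mul (‖periodCoeff g n‖ ^ 2 / π)) (by
      refine Summable.of_nonneg_of_le (fun n => integral_nonneg fun q => norm_nonneg _)
        (fun n => ?_) ((hasSum_normSq_periodCoeff hg).summable.mul_right
          (∫ q : ℝ × ℝ, absSinPow (s - 1) (q.1 - q.2) ∂(periodMeasure.prod periodMeasure)))
      rw [← integral_const_mul]
      refine integral_mono ((hint n).const_mul _).norm (hK.const_mul _) fun q => ?_
      simp only
      have hp := Real.pi_pos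
      rw [norm_mul, Real.norm_of_nonneg (by positivity), norm_mul,
        Real.norm_of_nonneg (absSinPow_nonneg _ _)]
      gcongr
      refine mul_le_of_le_one_left (absSinPow_nonneg _ _) ?_
      rw [norm_mul, norm_mul]
      exact mul_le_one₀ (mul_le_one₀ (hS1 _) (norm_nonneg _) (hS1 _)) (norm_nonneg _)
        (Real.abs_cos_le_one _))
  refine h.of_eq (fun n => ?_) ?_
  · rw [integral_const_mul, circleForm]
    congr 1
    refine integral_congr_ae (ae_of_all _ fun q => ?_)
    simp only
    rw [re_ofReal_mul_mul_conj, re_circleExp_mul_conj]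
  · simp only [circleForm]
    rw [integral_integral_swap (integrable_uncurry_circleForm_sub hs hS hS1 hg hper)]
    refine integral_congr_ae (ae_of_all _ fun q => ?_)
    simp only [re_ofReal_mul_mul_conj]
    have e := (((hasSum_autocorr hg hper (q.1 - q.2)).mul_left (S q.1 * S q.2)).mul_right
      (absSinPow (s - 1) (q.1 - q.2))).tsum_eq
    rw [integral_mul_const, integral_const_mul, integral_re_mul_conj_comp_sub hper, ← e]
    refine tsum_congr fun n => ?_
    ring

theorem circleForm_comp_sub {s : ℝ} (hs : 0 < s) {h : ℝ → ℂ} (hh : Continuous h)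
    (hper : Function.Periodic h π) (θ : ℝ) :
    circleForm s (fun t => h (t - θ)) = circleForm s h := by
  obtain ⟨M, -, hM⟩ := exists_bound_of_periodic hh hper
  rw [circleForm, circleForm, integral_prod _ (integrable_circleForm hs
    (h := fun t => h (t - θ)) (by fun_prop) fun x => hM _), integral_prod _ (integrable_circleForm hs hh hM)]
  simp only
  have h1 : Function.Periodic (fun x => ∫ y, (h x * (starRingEnd ℂ) (h y)).re *
      absSinPow (s - 1) (x - y) ∂periodMeasure) π := fun x => by
    simp only [hper x, add_sub_right_comm, periodic_absSinPow _ _]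
  rw [← h1.integral_periodMeasure_sub θ]
  refine integral_congr_ae (ae_of_all _ fun x => ?_)
  have h2 : Function.Periodic (fun y => (h (x - θ) * (starRingEnd ℂ) (h y)).re *
      absSinPow (s - 1) (x - θ - y)) π := fun y => by
    have := periodic_absSinPow (s - 1) (x - θ - (y + π))
    simp only [hper y, ← this]
    congr 2; ring
  simp only
  rw [← h2.integral_periodMeasure_sub θ]
  refine integral_congr_ae (ae_of_all _ fun y => ?_)
  simp only
  rw [sub_sub_sub_cancel_right]

/-- The cosine coefficients of `|sin| ^ b`. -/
def sinCosInt (b : ℝ) (m : ℤ) : ℝ := ∫ t, absSinPow b t * Real.cos (2 * m * t) ∂periodMeasure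

theorem sinCosInt_neg (b : ℝ) (m : ℤ) : sinCosInt b (-m) = sinCosInt b m := by
  unfold sinCosInt
  push_cast
  simp only [mul_neg, neg_mul, Real.cos_neg]

theorem sinCosInt_natAbs (b : ℝ) (m : ℤ) : sinCosInt b m.natAbs = sinCosInt b m := by
  rcases Int.natAbs_eq m with h | h
  · rw [← h]
  · conv_rhs => rw [h]
    rw [sinCosInt_neg]

theorem circleForm_circleExp {s : ℝ} (hs : 0 < s) (n : ℤ) :
    circleForm s (circleExp n) = π * sinCosInt (s - 1) n := by
  rw [circleForm, integral_prod _ (integrable_circleForm hs (continuous_circleExp n)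
    fun x => (norm_circleExp n x).le)]
  simp only [re_circleExp_mul_conj]
  have h1 : Function.Periodic (fun t => absSinPow (s - 1) t * Real.cos (2 * n * t)) π :=
    fun t => by
      simp only
      rw [periodic_absSinPow, ← circleExp_re, ← circleExp_re, periodic_circleExp]
  have h2 : ∀ x, ∫ y, Real.cos (2 * n * (x - y)) * absSinPow (s - 1) (x - y) ∂periodMeasure
      = sinCosInt (s - 1) n := fun x => by
    rw [sinCosInt, ← h1.integral_periodMeasure_sub_left x]
    simp only [mul_comm]
  simp only [h2, integral_const, measureReal_periodMeasure_univ, smul_eq_mul]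

theorem hasSum_circleForm {s : ℝ} (hs : 0 < s) {h : ℝ → ℂ} (hh : Continuous h)
    (hper : Function.Periodic h π) :
    HasSum (fun n : ℤ => ‖periodCoeff h n‖ ^ 2 * sinCosInt (s - 1) n) (π * circleForm s h) := by
  have h1 := hasSum_integral_circleForm_sub hs (S := fun _ => 1) continuous_const (by simp) hh hper
  refine h1.of_eq (fun n => ?_) ?_
  · simp only [Complex.ofReal_one, one_mul]
    rw [circleForm_circleExp hs]
    have := Real.pi_ne_zero
    field_simp
  · simp only [Complex.ofReal_one, one_mul, circleForm_comp_sub hs hh hper, integral_const,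
      measureReal_periodMeasure_univ, smul_eq_mul]

theorem sinCosInt_recursion {b : ℝ} (hb : -1 < b) (m : ℤ) :
    (m + 1 + b / 2) * sinCosInt b (m + 1) = (m - b / 2) * sinCosInt b m := by
  have hi : ∀ k : ℤ, Integrable (fun t => absSinPow b t * Real.cos (2 * k * t)) periodMeasure :=
    fun k => (integrable_absSinPow hb).mul_bdd (c := 1)
      (Measurable.aestronglyMeasurable (by fun_prop))
      (ae_of_all _ fun t => Real.abs_cos_le_one _)
  have hii : ∀ {f : ℝ → ℝ}, Integrable f periodMeasure → IntervalIntegrable f volume 0 π :=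
    fun {f} hf => by
      rw [intervalIntegrable_iff_integrableOn_Ioo_of_le Real.pi_pos.le]
      exact hf
  have hF := intervalIntegral.integral_eq_sub_of_hasDerivAt_of_le (a := 0) (b := π)
    (f := fun t => Real.sin t ^ (b + 1) * Real.cos ((2 * m + 1) * t))
    (f' := fun t => (m + 1 + b / 2) * (absSinPow b t * Real.cos (2 * (m + 1 : ℤ) * t))
      - (m - b / 2) * (absSinPow b t * Real.cos (2 * m * t))) Real.pi_pos.le
    (Continuous.continuousOn (by
      refine Continuous.mul (Continuous.rpow_const (by fun_prop) fun _ => Or.inr ?_) (by fun_prop)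
      linarith))
    (fun t ht => by
      have hs := Real.sin_pos_of_mem_Ioo ht
      have h1 := (Real.hasDerivAt_sin t).rpow_const (p := b + 1) (Or.inl hs.ne')
      have h2 := ((hasDerivAt_id t).const_mul (2 * m + 1 : ℝ)).cos
      refine (h1.mul h2).congr_deriv ?_
      simp only [id, mul_one]
      rw [absSinPow_eq_of_mem ht, add_sub_cancel_right, Real.rpow_add_one hs.ne',
        show 2 * ((m + 1 : ℤ) : ℝ) * t = (2 * m + 1) * t + t by push_cast; ring,
        show 2 * (m : ℝ) * t = (2 * m + 1) * t - t by ring, Real.cos_add, Real.cos_sub]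
      ring)
    ((hii ((hi (m + 1)).const_mul _)).sub (hii ((hi m).const_mul _)))
  have hb' : b + 1 ≠ 0 := by linarith
  simp only [Real.sin_pi, Real.sin_zero, Real.zero_rpow hb', zero_mul, sub_zero] at hF
  rw [← integral_periodMeasure_eq_intervalIntegral, integral_sub ((hi (m + 1)).const_mul _)
    ((hi m).const_mul _), integral_const_mul, integral_const_mul] at hF
  exact sub_eq_zero.1 hF

theorem sinCosInt_zero_pos {b : ℝ} (hb : -1 < b) : 0 < sinCosInt b 0 := by
  simp only [sinCosInt, Int.cast_zero, mul_zero, zero_mul, Real.cos_zero, mul_one]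
  rw [integral_pos_iff_support_of_nonneg (absSinPow_nonneg b) (integrable_absSinPow hb)]
  have h : Ioo 0 π ⊆ Function.support (absSinPow b) := fun t ht => by
    rw [Function.mem_support, absSinPow_eq_of_mem ht]
    exact (Real.rpow_pos_of_pos (Real.sin_pos_of_mem_Ioo ht) _).ne'
  refine lt_of_lt_of_le ?_ (measure_mono h)
  simp [periodMeasure, Real.pi_pos]

theorem sinCosInt_recursion_nat {s : ℝ} (hs : 0 < s) (m : ℕ) :
    (m + 1 - (1 - s) / 2) * sinCosInt (s - 1) (m + 1 : ℕ)
      = (m + (1 - s) / 2) * sinCosInt (s - 1) m := by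
  have := sinCosInt_recursion (b := s - 1) (by linarith) m
  push_cast at this ⊢
  linear_combination this

theorem sinCosInt_pos {s : ℝ} (hs : 0 < s) (hs1 : s < 1) (m : ℕ) : 0 < sinCosInt (s - 1) m := by
  induction m with
  | zero => exact sinCosInt_zero_pos (by linarith)
  | succ m ih =>
    have h := sinCosInt_recursion_nat hs m
    have hm : (0 : ℝ) ≤ m := Nat.cast_nonneg m
    have h1 : 0 < (m + (1 - s) / 2) * sinCosInt (s - 1) m := mul_pos (by linarith) ih
    rw [← h] at h1
    exact pos_of_mul_pos_right h1 (by linarith)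

theorem antitone_sinCosInt {s : ℝ} (hs : 0 < s) (hs1 : s < 1) :
    Antitone fun m : ℕ => sinCosInt (s - 1) m :=
  antitone_nat_of_succ_le fun m => by
    have h := sinCosInt_recursion_nat hs m
    have hm : (0 : ℝ) ≤ m := Nat.cast_nonneg m
    have h1 := sinCosInt_pos hs hs1 m
    have h2 : (0 : ℝ) < m + 1 - (1 - s) / 2 := by linarith
    refine le_of_mul_le_mul_left ?_ h2
    rw [h]
    gcongr
    linarith

theorem monotone_mul_sinCosInt {s : ℝ} (hs : 0 < s) (hs1 : s < 1) :
    Monotone fun m : ℕ => (m + (1 - s) / 2) * sinCosInt (s - 1) m :=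
  monotone_nat_of_le_succ fun m => by
    rw [← sinCosInt_recursion_nat hs m]
    have h1 := sinCosInt_pos hs hs1 (m + 1)
    gcongr
    push_cast
    linarith

theorem sinCosInt_add_le {s : ℝ} (hs : 0 < s) (hs1 : s < 1) (n k : ℤ) :
    sinCosInt (s - 1) (k + n) ≤ (1 + k.natAbs / ((1 - s) / 2)) * sinCosInt (s - 1) n := by
  rw [← sinCosInt_natAbs _ (k + n), ← sinCosInt_natAbs _ n]
  have hδ : 0 < (1 - s) / 2 := by linarith
  have hpos := sinCosInt_pos hs hs1 n.natAbs
  have hk : (0 : ℝ) ≤ k.natAbs / ((1 - s) / 2) := by positivity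
  rcases le_total n.natAbs (k + n).natAbs with h | h
  · refine (antitone_sinCosInt hs hs1 h).trans ?_
    exact le_mul_of_one_le_left hpos.le (by linarith)
  · have h1 := monotone_mul_sinCosInt hs hs1 h
    simp only at h1
    have h2 : (n.natAbs : ℝ) ≤ (k + n).natAbs + k.natAbs := by
      exact_mod_cast (by omega : n.natAbs ≤ (k + n).natAbs + k.natAbs)
    have h3 : (0 : ℝ) ≤ (k + n).natAbs := Nat.cast_nonneg _
    refine le_of_mul_le_mul_left (h1.trans ?_)
      (by linarith : 0 < ((k + n).natAbs : ℝ) + (1 - s) / 2)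
    rw [← mul_assoc]
    refine mul_le_mul_of_nonneg_right ?_ hpos.le
    have h4 : k.natAbs / ((1 - s) / 2) * ((1 - s) / 2) = (k.natAbs : ℝ) :=
      div_mul_cancel₀ _ hδ.ne'
    nlinarith [mul_nonneg h3 hk]

theorem sinCosInt_intCast_nonneg {s : ℝ} (hs : 0 < s) (hs1 : s < 1) (n : ℤ) :
    0 ≤ sinCosInt (s - 1) n := by
  rw [← sinCosInt_natAbs]; exact (sinCosInt_pos hs hs1 _).le

theorem norm_periodCoeff_absSinPow {a : ℝ} (ha : 0 ≤ a) (n : ℤ) :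
    ‖periodCoeff (fun t => absSinPow a t) n‖ ^ 2 = sinCosInt a n ^ 2 := by
  set f : ℝ → ℂ := fun t => circleExp (-n) t * (absSinPow a t : ℂ) with hf
  have hper : Function.Periodic f π := fun t => by
    simp only [hf, periodic_circleExp (-n) t, periodic_absSinPow a t]
  have hfi : Integrable f periodMeasure := integrable_periodMeasure_of_continuous
    ((continuous_circleExp _).mul (continuous_ofReal.comp (continuous_absSinPow ha)))
  have hre : (∫ t, f t ∂periodMeasure).re = sinCosInt a n := by
    have := integral_re (𝕜 := ℂ) hfi
    simp only [RCLike.re_eq_complex_re] at this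
    rw [← this, sinCosInt]
    refine integral_congr_ae (ae_of_all _ fun t => ?_)
    simp only [hf]
    rw [Complex.re_mul_ofReal, circleExp_re, mul_comm]
    push_cast
    rw [show 2 * -(n : ℝ) * t = -(2 * n * t) by ring, Real.cos_neg]
  have him : (starRingEnd ℂ) (∫ t, f t ∂periodMeasure) = ∫ t, f t ∂periodMeasure := by
    rw [← integral_conj]
    conv_rhs => rw [← hper.integral_periodMeasure_sub_left 0]
    refine integral_congr_ae (ae_of_all _ fun t => ?_)
    simp only [hf]
    rw [map_mul, Complex.conj_ofReal, ← circleExp_neg, zero_sub]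
    simp [circleExp, absSinPow]
  rw [periodCoeff]
  change ‖∫ t, f t ∂periodMeasure‖ ^ 2 = _
  rw [Complex.conj_eq_iff_re] at him
  rw [← him, hre, Complex.norm_real, Real.norm_eq_abs, sq_abs]

theorem summable_mul_sinCosInt_sq {a : ℝ} (ha : 0 < a) :
    Summable fun m : ℕ => (m : ℝ) * sinCosInt a m ^ 2 := by
  have hstep : ∀ N : ℕ, ∑ m ∈ Finset.range N, (m : ℝ) * sinCosInt a m ^ 2
      = ((a / 2) ^ 2 * sinCosInt a 0 ^ 2 - (N + a / 2) ^ 2 * sinCosInt a N ^ 2) / (2 * a) := by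
    intro N
    induction N with
    | zero => simp
    | succ N ih =>
      have h := sinCosInt_recursion (b := a) (by linarith) N
      rw [Finset.sum_range_succ, ih]
      push_cast at h ⊢
      field_simp
      linear_combination 4 * ((N + 1 + a / 2) * sinCosInt a (N + 1)
        + (N - a / 2) * sinCosInt a N) * h
  refine summable_of_sum_range_le (c := (a / 2) ^ 2 * sinCosInt a 0 ^ 2 / (2 * a))
    (fun m => by positivity) fun N => ?_
  rw [hstep]
  gcongr
  exact sub_le_self _ (by positivity)

theorem summable_weight_sinCosInt_sq {a δ : ℝ} (ha : 0 < a) :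
    Summable fun k : ℤ => (1 + k.natAbs / δ) * sinCosInt a k ^ 2 := by
  have h1 : Summable fun k : ℤ => sinCosInt a k ^ 2 := by
    have := (hasSum_normSq_periodCoeff (f := fun t => (absSinPow a t : ℂ))
      (continuous_ofReal.comp (continuous_absSinPow ha.le))).summable.mul_right π
    refine this.congr fun k => ?_
    rw [norm_periodCoeff_absSinPow ha.le]
    exact div_mul_cancel₀ _ Real.pi_ne_zero
  have h2 : Summable fun k : ℤ => (k.natAbs : ℝ) * sinCosInt a k ^ 2 := by
    have h := summable_mul_sinCosInt_sq ha
    refine Summable.of_nat_of_neg ?_ ?_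
    · simpa using h
    · simpa [sinCosInt_neg] using h
  refine (h1.add (h2.div_const δ)).congr fun k => ?_
  ring

theorem exists_circleForm_circleExp_le {s a : ℝ} (hs : 0 < s) (hs1 : s < 1) (ha : 0 < a) :
    ∃ B : ℝ, 0 ≤ B ∧ ∀ n : ℤ, circleForm s (fun t => absSinPow a t * circleExp n t)
      ≤ B * sinCosInt (s - 1) n := by
  have hB := summable_weight_sinCosInt_sq (δ := (1 - s) / 2) ha
  have hδ : 0 < (1 - s) / 2 := by linarith
  have hπ := Real.pi_pos
  refine ⟨(∑' k : ℤ, (1 + k.natAbs / ((1 - s) / 2)) * sinCosInt a k ^ 2) / π,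
    div_nonneg (tsum_nonneg fun k => by positivity) hπ.le, fun n => ?_⟩
  have hc := continuous_absSinPow ha.le
  have hce := continuous_circleExp n
  have h := hasSum_circleForm hs (h := fun t => (absSinPow a t : ℂ) * circleExp n t)
    (by fun_prop) (fun t => by simp only [periodic_absSinPow a t, periodic_circleExp n t])
  rw [← (Equiv.addRight n).hasSum_iff] at h
  have hle := hasSum_le (fun k => ?_) h (hB.hasSum.mul_right (sinCosInt (s - 1) n))
  · rw [div_mul_eq_mul_div, le_div_iff₀ hπ, mul_comm]
    exact hle
  · have e : periodCoeff (fun t => (absSinPow a t : ℂ) * circleExp n t) (k + n)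
        = periodCoeff (fun t => absSinPow a t) k := by
      rw [periodCoeff, periodCoeff]
      refine integral_congr_ae (ae_of_all _ fun t => ?_)
      simp only
      rw [show -k = -(k + n) + n by ring, circleExp_add (-(k + n)) n]
      ring
    simp only [Function.comp_apply, Equiv.coe_addRight]
    rw [e, norm_periodCoeff_absSinPow ha.le, mul_right_comm]
    rw [mul_comm]
    exact mul_le_mul_of_nonneg_right (sinCosInt_add_le hs hs1 n k) (sq_nonneg _)

theorem circleForm_nonneg {s : ℝ} (hs : 0 < s) (hs1 : s < 1) {h : ℝ → ℂ} (hh : Continuous h)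
    (hper : Function.Periodic h π) : 0 ≤ circleForm s h := by
  have := (hasSum_circleForm hs hh hper).nonneg fun n =>
    mul_nonneg (sq_nonneg _) (sinCosInt_intCast_nonneg hs hs1 n)
  exact (mul_nonneg_iff_of_pos_left Real.pi_pos).1 this

theorem averageBound_pos {s u : ℝ} (hs : 0 < s) (hsu : s < u) (hu : u < 1) :
    AverageBound s u := by
  have hs1 : s < 1 := hsu.trans hu
  set a := u - s with ha'
  have ha : 0 < a := sub_pos.2 hsu
  obtain ⟨B, hB0, hB⟩ := exists_circleForm_circleExp_le hs hs1 ha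
  have hπ := Real.pi_pos
  have hc := continuous_absSinPow ha.le
  have hκ : 0 < rieszWeight (s / 2) π := rieszWeight_pos (by linarith) hπ
  have hκ' : 0 < rieszWeight ((1 - s) / 2) π := rieszWeight_pos (by linarith) hπ
  refine averageBound_of_Ioo (C := ENNReal.ofReal B) ENNReal.ofReal_ne_top fun g hg hper => ?_
  have hgc := hg.continuous
  have hbound : ∫ θ, circleForm s (fun t => (absSinPow a t : ℂ) * g (t - θ)) ∂periodMeasure
      ≤ B * circleForm s g := by
    have h1 := hasSum_integral_circleForm_sub hs hc
      (fun t => by rw [abs_of_nonneg (absSinPow_nonneg a t)]; exact absSinPow_le_one ha.le t)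
      hgc hper
    have h2 := (hasSum_circleForm hs hgc hper).mul_left (B / π)
    have h3 := hasSum_le (fun n => ?_) h1 h2
    · refine h3.trans (le_of_eq ?_)
      field_simp
    · calc _ ≤ ‖periodCoeff g n‖ ^ 2 / π * (B * sinCosInt (s - 1) n) := by gcongr; exact hB n
        _ = _ := by ring
  have hgθ : ∀ θ, ContDiff ℝ 1 fun t => g (t - θ) := fun θ => hg.comp_sub_const θ
  have hpθ : ∀ θ, Function.Periodic (fun t => g (t - θ)) π := fun θ => hper.sub_const θ
  have e1 : ∀ θ, ENNReal.ofReal (rieszWeight (s / 2) π) * csNormSq s (1 + u) (fun t => g (t - θ))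
      = ENNReal.ofReal (rieszWeight ((1 - s) / 2) π *
        circleForm s (fun t => (absSinPow a t : ℂ) * g (t - θ))) := fun θ => by
    rw [← csNormSq_eq_circleForm hs hs1 ha.le (hgθ θ) (hpθ θ), ha',
      show 1 + s + (u - s) = 1 + u by ring]
  have e0 : ENNReal.ofReal (rieszWeight (s / 2) π) * csNormSq s (1 + s) g
      = ENNReal.ofReal (rieszWeight ((1 - s) / 2) π * circleForm s g) := by
    have := csNormSq_eq_circleForm hs hs1 le_rfl hg hper
    simpa [absSinPow] using this
  refine (ENNReal.mul_le_mul_iff_right (ENNReal.ofReal_pos.2 hκ).ne' ENNReal.ofReal_ne_top).1 ?_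
  calc ENNReal.ofReal (rieszWeight (s / 2) π) *
        ∫⁻ θ in Ioo 0 π, csNormSq s (1 + u) (fun t => g (t - θ))
      = ∫⁻ θ, ENNReal.ofReal (rieszWeight ((1 - s) / 2) π *
          circleForm s (fun t => (absSinPow a t : ℂ) * g (t - θ))) ∂periodMeasure := by
        rw [← lintegral_const_mul' _ _ ENNReal.ofReal_ne_top]
        simp only [e1]
        rfl
    _ = ENNReal.ofReal (rieszWeight ((1 - s) / 2) π *
          ∫ θ, circleForm s (fun t => (absSinPow a t : ℂ) * g (t - θ)) ∂periodMeasure) := by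
        rw [← integral_const_mul, ofReal_integral_eq_lintegral_ofReal]
        · refine (integrable_circleForm_sub hs hc (fun t => ?_) hgc hper).const_mul _
          rw [abs_of_nonneg (absSinPow_nonneg a t)]
          exact absSinPow_le_one ha.le t
        · refine ae_of_all _ fun θ => mul_nonneg hκ'.le (circleForm_nonneg hs hs1 (by fun_prop) ?_)
          intro t
          have := hpθ θ t
          simp only at this
          simp only [periodic_absSinPow a t, this]
    _ ≤ ENNReal.ofReal (B * (rieszWeight ((1 - s) / 2) π * circleForm s g)) := by
        refine ENNReal.ofReal_le_ofReal ?_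
        rw [mul_left_comm]
        gcongr
    _ = _ := by
        rw [ENNReal.ofReal_mul hB0, ← e0, mul_left_comm]

end

/-- for `u ∈ (−1,1)` and `μ ∈ (−1−u, 0)`, there is `c_{u,μ} > 0` such that
every smooth vector `v(x) = (1+x²)^{−(1+u)/2} g(arccot x)` of `P(u,+)^∞` (with `g` smooth
and `π`-periodic, i.e. `g = Φ(e^{2iθ})` for smooth `Φ` on the circle) satisfies
`⫴v⫴²_{u+μ} ≤ c_{u,μ} ‖(1+x²)^{−μ/2} v(x)‖²_{C_{u+μ}}`, the improper Fourier transforms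
existing for `ξ ≠ 0`. -/
theorem stmt19 (u μ : ℝ) (hu : u ∈ Set.Ioo (-1 : ℝ) 1) (hμ₁ : -1 - u < μ) (hμ₂ : μ < 0) :
    ∃ c : ℝ, 0 < c ∧
      ∀ g : ℝ → ℂ, ContDiff ℝ (⊤ : ℕ∞) g → (∀ θ : ℝ, g (θ + Real.pi) = g θ) →
        ∀ v : ℝ → ℂ,
          (v = fun x : ℝ =>
            ((1 + x ^ 2 : ℝ) : ℂ) ^ (-(1 + (u : ℂ)) / 2) * g (arccot x)) →
        ∃ F : ℝ → ℝ → ℂ, ∃ G : ℝ → ℂ,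
          (∀ θ : ℝ, ∀ ξ : ℝ, ξ ≠ 0 → IsImpFT (piPlus (u : ℂ) θ v) ξ (F θ ξ)) ∧
          (∀ ξ : ℝ, ξ ≠ 0 →
            IsImpFT (fun x : ℝ =>
              ((1 + x ^ 2 : ℝ) : ℂ) ^ (-(μ : ℂ) / 2) * v x) ξ (G ξ)) ∧
          (∫⁻ θ in Ioc (0:ℝ) (2 * π),
              ∫⁻ ξ : ℝ, ENNReal.ofReal (|ξ| ^ (-u - μ)) * (‖F θ ξ‖₊ : ℝ≥0∞) ^ 2)
            ≤ ENNReal.ofReal c *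
                (∫⁻ ξ : ℝ, ENNReal.ofReal (|ξ| ^ (-u - μ)) * (‖G ξ‖₊ : ℝ≥0∞) ^ 2) := by
  refine exists_bound_of_averageBound u μ hu hμ₁ ?_
  rcases lt_trichotomy (u + μ) 0 with h | h | h
  · exact averageBound_neg h (by linarith) (by linarith) hu.2
  · rw [h]
    exact averageBound_zero (by linarith)
  · exact averageBound_pos h (by linarith) hu.2
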